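/- arXiv:1812.06477 — 2 statements merged into one kernel-verified Lean document; each statement's English description precedes it below -/
import Mathlib

section
/- For every ε > 0, the probability that a uniformly random simple 2-regular graph G on n labelled vertices satisfies (1−ε)·log n ≤ Z(G) ≤ (1+ε)·log n tends to 1 as n → ∞. Here log denotes the natural logarithm. -/
/-- One step of the zero forcing colour-change rule: some black vertex `v ∈ S`
whose unique white neighbour is `w` forces `w`, giving `T = insert w S`. -/
def zfStep {V : Type*} [DecidableEq V] (G : SimpleGraph V) (S T : Finset V) : Prop :=
  ∃ v ∈ S, ∃ w, w ∉ S ∧ G.Adj v w ∧ (∀ u, G.Adj v u → u ∉ S → u = w) ∧ T = insert w S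

/-- `S` is a zero forcing set: iterating the colour-change rule from `S` reaches all of `V`. -/
def IsZeroForcingSet {V : Type*} [DecidableEq V] [Fintype V] (G : SimpleGraph V)
    (S : Finset V) : Prop :=
  Relation.ReflTransGen (zfStep G) S Finset.univ

/-- The zero forcing number: minimum size of a zero forcing set. -/
noncomputable def zeroForcingNumber {V : Type*} [DecidableEq V] [Fintype V]
    (G : SimpleGraph V) : ℕ :=
  sInf {k | ∃ S : Finset V, IsZeroForcingSet G S ∧ S.card = k}

/-- `(v 0, …, v (k-1))` is a Z-sequence: each `v i` has a neighbour outside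
`⋃_{j<i} N[v j]`. -/
def IsZSeq {V : Type*} (G : SimpleGraph V) {k : ℕ} (v : Fin k → V) : Prop :=
  ∀ i : Fin k, ∃ x, G.Adj (v i) x ∧ ∀ j : Fin k, j < i → x ≠ v j ∧ ¬ G.Adj (v j) x

/-- `w` is a witness sequence for the Z-sequence `v`: each `w i` is a neighbour of `v i`
lying outside `⋃_{j<i} N[v j]`. -/
def IsWitnessSeq {V : Type*} (G : SimpleGraph V) {k : ℕ} (v w : Fin k → V) : Prop :=
  ∀ i : Fin k, G.Adj (v i) (w i) ∧ ∀ j : Fin k, j < i → w i ≠ v j ∧ ¬ G.Adj (v j) (w i)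

/-- The Z-Grundy domination number: maximum length of a Z-sequence. -/
noncomputable def zGrundyNumber {V : Type*} [Fintype V] (G : SimpleGraph V) : ℕ :=
  sSup {k | ∃ v : Fin k → V, IsZSeq G v}
open scoped Classical in
/-- The proportion of simple `d`-regular graphs on the labelled vertex set `Fin n`
that satisfy the property `P`. -/
noncomputable def regularProportion (d n : ℕ) (P : SimpleGraph (Fin n) → Prop) : ℝ :=
  (Nat.card {G : SimpleGraph (Fin n) // G.IsRegularOfDegree d ∧ P G} : ℝ) /
    (Nat.card {G : SimpleGraph (Fin n) // G.IsRegularOfDegree d} : ℝ)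


namespace ZF

set_option linter.unusedSectionVars false

open Finset

section comb
open scoped Classical

variable {V : Type*} [Fintype V] [DecidableEq V]

/-- `v` has exactly two neighbours. -/
def D2 (G : SimpleGraph V) (v : V) : Prop :=
  ∃ p q, p ≠ q ∧ ∀ u, G.Adj v u ↔ (u = p ∨ u = q)

/-- `G` is 2-regular on `S` and has no edges elsewhere. -/
def RS (S : Finset V) (G : SimpleGraph V) : Prop :=
  (∀ v ∈ S, D2 G v) ∧ ∀ v, v ∉ S → ∀ u, ¬ G.Adj v u

/-- Number of components meeting `S`. -/
noncomputable def cc (S : Finset V) (G : SimpleGraph V) : ℕ :=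
  (S.image G.connectedComponentMk).card

/-- replace the path a z b by the edge a b -/
def contr (z a b : V) (G : SimpleGraph V) : SimpleGraph V :=
  SimpleGraph.fromRel fun u v => (u ≠ z ∧ v ≠ z ∧ G.Adj u v) ∨ (u = a ∧ v = b)

/-- replace the edge a b by the path a z b -/
def subdiv (z a b : V) (G : SimpleGraph V) : SimpleGraph V :=
  SimpleGraph.fromRel fun u v => (G.Adj u v ∧ ¬ (u = a ∧ v = b) ∧ ¬ (u = b ∧ v = a)) ∨
    (u = z ∧ v = a) ∨ (u = z ∧ v = b)

/-- delete the triangle -/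
def delT (z a b : V) (G : SimpleGraph V) : SimpleGraph V :=
  SimpleGraph.fromRel fun u v => (u ≠ z ∧ v ≠ z ∧ u ≠ a ∧ v ≠ a ∧ u ≠ b ∧ v ≠ b ∧ G.Adj u v)

/-- add the triangle -/
def addT (z a b : V) (G : SimpleGraph V) : SimpleGraph V :=
  SimpleGraph.fromRel fun u v => G.Adj u v ∨ (u = z ∧ v = a) ∨ (u = z ∧ v = b) ∨ (u = a ∧ v = b)

theorem contr_adj {z a b : V} {G : SimpleGraph V} (hab : a ≠ b) (u v : V) :
    (contr z a b G).Adj u v ↔ (u ≠ z ∧ v ≠ z ∧ G.Adj u v) ∨ (u = a ∧ v = b) ∨ (u = b ∧ v = a) := by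
  have h1 := G.adj_comm u v
  have h2 : G.Adj u v → u ≠ v := fun h => h.ne
  simp only [contr, SimpleGraph.fromRel_adj]
  grind

theorem subdiv_adj {z a b : V} {G : SimpleGraph V} (hza : z ≠ a) (hzb : z ≠ b) (u v : V) :
    (subdiv z a b G).Adj u v ↔ (G.Adj u v ∧ ¬ (u = a ∧ v = b) ∧ ¬ (u = b ∧ v = a)) ∨
    (u = z ∧ v = a) ∨ (u = z ∧ v = b) ∨ (v = z ∧ u = a) ∨ (v = z ∧ u = b) := by
  have h1 := G.adj_comm u v
  have h2 : G.Adj u v → u ≠ v := fun h => h.ne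
  simp only [subdiv, SimpleGraph.fromRel_adj]
  grind

theorem delT_adj {z a b : V} {G : SimpleGraph V} (u v : V) :
    (delT z a b G).Adj u v ↔
      (u ≠ z ∧ v ≠ z ∧ u ≠ a ∧ v ≠ a ∧ u ≠ b ∧ v ≠ b ∧ G.Adj u v) := by
  have h1 := G.adj_comm u v
  have h2 : G.Adj u v → u ≠ v := fun h => h.ne
  simp only [delT, SimpleGraph.fromRel_adj]
  grind

theorem addT_adj {z a b : V} {G : SimpleGraph V} (hza : z ≠ a) (hzb : z ≠ b) (hab : a ≠ b)
    (u v : V) :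
    (addT z a b G).Adj u v ↔ G.Adj u v ∨ (u = z ∧ v = a) ∨ (u = z ∧ v = b) ∨ (u = a ∧ v = b) ∨
      (v = z ∧ u = a) ∨ (v = z ∧ u = b) ∨ (v = a ∧ u = b) := by
  have h1 := G.adj_comm u v
  have h2 : G.Adj u v → u ≠ v := fun h => h.ne
  simp only [addT, SimpleGraph.fromRel_adj]
  grind

theorem D2.third {G : SimpleGraph V} {v p q r : V} (h : D2 G v) (hp : G.Adj v p) (hq : G.Adj v q)
    (hpq : p ≠ q) (hr : G.Adj v r) : r = p ∨ r = q := by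
  obtain ⟨s, t, hst, hu⟩ := h
  have := hu p; have := hu q; have := hu r
  grind

theorem contr_RS {S : Finset V} {z a b : V} {G : SimpleGraph V} (hz : z ∉ S)
    (ha : a ∈ S) (hb : b ∈ S) (hab : a ≠ b) (hG : RS (insert z S) G)
    (h1 : G.Adj z a) (h2 : G.Adj z b) (h3 : ¬ G.Adj a b) : RS S (contr z a b G) := by
  have hza : z ≠ a := h1.ne
  have hzb : z ≠ b := h2.ne
  have hZ := hG.1 z (mem_insert_self _ _)
  constructor
  · intro v hv
    have hvz : v ≠ z := by rintro rfl; exact hz hv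
    obtain ⟨p, q, hpq, hu⟩ := hG.1 v (mem_insert_of_mem hv)
    have hup : G.Adj v z → v = a ∨ v = b := fun h => hZ.third h1 h2 hab h.symm
    have e1 := hu z
    have e2 := hu a
    have e3 := hu b
    have e4 := G.adj_comm v z
    have e5 := G.adj_comm a b
    by_cases hva : v = a
    · subst hva
      by_cases hp : p = z
      · refine ⟨b, q, by grind, fun u => ?_⟩
        rw [contr_adj hab, hu]; grind
      · refine ⟨p, b, by grind, fun u => ?_⟩
        rw [contr_adj hab, hu]; grind
    · by_cases hvb : v = b
      · subst hvb
        by_cases hp : p = z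
        · refine ⟨a, q, by grind, fun u => ?_⟩
          rw [contr_adj hab, hu]; grind
        · refine ⟨p, a, by grind, fun u => ?_⟩
          rw [contr_adj hab, hu]; grind
      · refine ⟨p, q, hpq, fun u => ?_⟩
        rw [contr_adj hab, hu]; grind
  · intro v hv u
    rw [contr_adj hab]
    have := hG.2 v
    grind

theorem subdiv_RS {S : Finset V} {z a b : V} {G : SimpleGraph V} (hz : z ∉ S)
    (ha : a ∈ S) (hb : b ∈ S) (hab : a ≠ b) (hG : RS S G)
    (h3 : G.Adj a b) : RS (insert z S) (subdiv z a b G) := by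
  have hza : z ≠ a := by rintro rfl; exact hz ha
  have hzb : z ≠ b := by rintro rfl; exact hz hb
  constructor
  · intro v hv
    by_cases hvz : v = z
    · subst hvz
      have := hG.2 v hz
      refine ⟨a, b, hab, fun u => ?_⟩
      rw [subdiv_adj hza hzb]
      grind
    · obtain ⟨p, q, hpq, hu⟩ := hG.1 v (by simpa [hvz] using hv)
      have e1 := hu z
      have e2 := hu a
      have e3 := hu b
      have e4 := G.adj_comm v z
      have e5 := G.adj_comm a b
      have e6 := hG.2 z hz v
      by_cases hva : v = a
      · subst hva
        by_cases hp : p = b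
        · refine ⟨z, q, by grind, fun u => ?_⟩
          rw [subdiv_adj hza hzb, hu]; grind
        · refine ⟨p, z, by grind, fun u => ?_⟩
          rw [subdiv_adj hza hzb, hu]; grind
      · by_cases hvb : v = b
        · subst hvb
          by_cases hp : p = a
          · refine ⟨z, q, by grind, fun u => ?_⟩
            rw [subdiv_adj hza hzb, hu]; grind
          · refine ⟨p, z, by grind, fun u => ?_⟩
            rw [subdiv_adj hza hzb, hu]; grind
        · refine ⟨p, q, hpq, fun u => ?_⟩
          rw [subdiv_adj hza hzb, hu]; grind
  · intro v hv u
    rw [subdiv_adj hza hzb]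
    have := hG.2 v
    grind

theorem subdiv_contr {S : Finset V} {z a b : V} {G : SimpleGraph V}
    (hab : a ≠ b) (hG : RS (insert z S) G)
    (h1 : G.Adj z a) (h2 : G.Adj z b) (h3 : ¬ G.Adj a b) :
    subdiv z a b (contr z a b G) = G := by
  have hZ := hG.1 z (mem_insert_self _ _)
  ext u v
  rw [subdiv_adj h1.ne h2.ne, contr_adj hab]
  have t1 : G.Adj z v → v = a ∨ v = b := fun h => hZ.third h1 h2 hab h
  have t2 : G.Adj z u → u = a ∨ u = b := fun h => hZ.third h1 h2 hab h
  have e1 := G.adj_comm z u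
  have e2 := G.adj_comm a z
  have e3 := G.adj_comm b z
  have e4 := G.adj_comm a b
  grind

theorem contr_subdiv {S : Finset V} {z a b : V} {G : SimpleGraph V} (hz : z ∉ S)
    (ha : a ∈ S) (hb : b ∈ S) (hab : a ≠ b) (hG : RS S G)
    (h3 : G.Adj a b) : contr z a b (subdiv z a b G) = G := by
  have hza : z ≠ a := by rintro rfl; exact hz ha
  have hzb : z ≠ b := by rintro rfl; exact hz hb
  ext u v
  rw [contr_adj hab, subdiv_adj hza hzb]
  have e1 := hG.2 z hz
  have e2 := G.adj_comm u v
  have e4 := G.adj_comm a b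
  grind

theorem delT_RS {S : Finset V} {z a b : V} {G : SimpleGraph V} (hz : z ∉ S)
    (ha : a ∈ S) (hb : b ∈ S) (hab : a ≠ b) (hG : RS (insert z S) G)
    (h1 : G.Adj z a) (h2 : G.Adj z b) (h3 : G.Adj a b) :
    RS ((S.erase a).erase b) (delT z a b G) := by
  have hza : z ≠ a := h1.ne
  have hzb : z ≠ b := h2.ne
  have hZ := hG.1 z (mem_insert_self _ _)
  have hA := hG.1 a (mem_insert_of_mem ha)
  have hB := hG.1 b (mem_insert_of_mem hb)
  constructor
  · intro v hv
    by_cases hvz : v = z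
    · subst hvz; grind
    · obtain ⟨p, q, hpq, hu⟩ := hG.1 v (by grind)
      have t1 : G.Adj z v → v = a ∨ v = b := fun h => hZ.third h1 h2 hab h
      have t2 : G.Adj a v → v = z ∨ v = b := fun h => hA.third h1.symm h3 hzb h
      have t3 : G.Adj b v → v = z ∨ v = a := fun h => hB.third h2.symm h3.symm hza h
      have e1 := G.adj_comm z v
      have e2 := G.adj_comm a v
      have e3 := G.adj_comm b v
      refine ⟨p, q, hpq, fun u => ?_⟩
      rw [delT_adj, ← hu]; grind
  · intro v hv u
    rw [delT_adj]
    have := hG.2 v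
    grind

theorem addT_RS {S : Finset V} {z a b : V} {G : SimpleGraph V} (hz : z ∉ S)
    (ha : a ∈ S) (hb : b ∈ S) (hab : a ≠ b) (hG : RS ((S.erase a).erase b) G) :
    RS (insert z S) (addT z a b G) := by
  have hza : z ≠ a := by rintro rfl; exact hz ha
  have hzb : z ≠ b := by rintro rfl; exact hz hb
  have nz := hG.2 z (by grind)
  have na := hG.2 a (by grind)
  have nb := hG.2 b (by grind)
  constructor
  · intro v hv
    by_cases hvz : v = z
    · subst hvz
      refine ⟨a, b, hab, fun u => ?_⟩
      rw [addT_adj hza hzb hab]; grind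
    by_cases hva : v = a
    · subst hva
      refine ⟨z, b, hzb, fun u => ?_⟩
      rw [addT_adj hza hzb hab]; grind
    by_cases hvb : v = b
    · subst hvb
      refine ⟨z, a, hza, fun u => ?_⟩
      rw [addT_adj hza hzb hab]; grind
    obtain ⟨p, q, hpq, hu⟩ := hG.1 v (by grind)
    refine ⟨p, q, hpq, fun u => ?_⟩
    rw [addT_adj hza hzb hab, ← hu]; grind
  · intro v hv u
    rw [addT_adj hza hzb hab]
    have := hG.2 v
    grind

theorem addT_delT {S : Finset V} {z a b : V} {G : SimpleGraph V}
    (ha : a ∈ S) (hb : b ∈ S) (hab : a ≠ b) (hG : RS (insert z S) G)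
    (h1 : G.Adj z a) (h2 : G.Adj z b) (h3 : G.Adj a b) :
    addT z a b (delT z a b G) = G := by
  have hza : z ≠ a := h1.ne
  have hzb : z ≠ b := h2.ne
  have hZ := hG.1 z (mem_insert_self _ _)
  have hA := hG.1 a (mem_insert_of_mem ha)
  have hB := hG.1 b (mem_insert_of_mem hb)
  have t1 : ∀ v, G.Adj z v → v = a ∨ v = b := fun v h => hZ.third h1 h2 hab h
  have t2 : ∀ v, G.Adj a v → v = z ∨ v = b := fun v h => hA.third h1.symm h3 hzb h
  have t3 : ∀ v, G.Adj b v → v = z ∨ v = a := fun v h => hB.third h2.symm h3.symm hza h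
  ext u v
  rw [addT_adj hza hzb hab, delT_adj]
  have e1 := G.adj_comm u v
  have e2 := G.adj_comm a z
  have e3 := G.adj_comm b z
  have e4 := G.adj_comm a b
  have := t1 u
  have := t1 v
  have := t2 u
  have := t2 v
  have := t3 u
  have := t3 v
  grind

theorem delT_addT {S : Finset V} {z a b : V} {G : SimpleGraph V} (hz : z ∉ S)
    (ha : a ∈ S) (hb : b ∈ S) (hab : a ≠ b) (hG : RS ((S.erase a).erase b) G) :
    delT z a b (addT z a b G) = G := by
  have hza : z ≠ a := by rintro rfl; exact hz ha
  have hzb : z ≠ b := by rintro rfl; exact hz hb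
  have nz := hG.2 z (by grind)
  have na := hG.2 a (by grind)
  have nb := hG.2 b (by grind)
  ext u v
  rw [delT_adj, addT_adj hza hzb hab]
  have e1 := G.adj_comm u v
  grind

theorem card_image_congr {α β γ : Type*} (S : Finset α) (f : α → β) (g : α → γ)
    (h : ∀ u ∈ S, ∀ v ∈ S, f u = f v ↔ g u = g v) : (S.image f).card = (S.image g).card := by
  induction S using Finset.induction_on with
  | empty => simp
  | insert a S ha ih =>
    have ih' := ih (fun u hu v hv => h u (by simp [hu]) v (by simp [hv]))
    rw [image_insert, image_insert]
    by_cases hm : f a ∈ S.image f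
    · have hm' : g a ∈ S.image g := by
        rw [mem_image] at hm ⊢
        obtain ⟨v, hv, e⟩ := hm
        exact ⟨v, hv, (h v (by simp [hv]) a (by simp)).1 e⟩
      rw [insert_eq_of_mem hm, insert_eq_of_mem hm', ih']
    · have hm' : g a ∉ S.image g := by
        rw [mem_image] at hm ⊢
        rintro ⟨v, hv, e⟩
        exact hm ⟨v, hv, (h v (by simp [hv]) a (by simp)).2 e⟩
      rw [card_insert_of_notMem hm, card_insert_of_notMem hm', ih']

theorem reach_map {G H : SimpleGraph V} (φ : V → V)
    (h : ∀ u v, G.Adj u v → H.Reachable (φ u) (φ v)) {u v : V} (huv : G.Reachable u v) :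
    H.Reachable (φ u) (φ v) := by
  obtain ⟨w⟩ := huv
  induction w with
  | nil => exact SimpleGraph.Reachable.refl _
  | cons e _ ih => exact (h _ _ e).trans ih

theorem cc_contr {S : Finset V} {z a b : V} {G : SimpleGraph V} (hz : z ∉ S)
    (ha : a ∈ S) (hb : b ∈ S) (hab : a ≠ b) (hG : RS (insert z S) G)
    (h1 : G.Adj z a) (h2 : G.Adj z b) :
    cc (insert z S) G = cc S (contr z a b G) := by
  have hZ := hG.1 z (mem_insert_self _ _)
  have t1 : ∀ v, G.Adj z v → v = a ∨ v = b := fun v h => hZ.third h1 h2 hab h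
  unfold cc
  rw [image_insert, insert_eq_of_mem]
  · apply card_image_congr
    intro u hu v hv
    rw [SimpleGraph.ConnectedComponent.eq, SimpleGraph.ConnectedComponent.eq]
    constructor
    · intro h
      have := reach_map (H := contr z a b G) (fun v => if v = z then a else v) ?_ h
      · have hu' : u ≠ z := by rintro rfl; exact hz hu
        have hv' : v ≠ z := by rintro rfl; exact hz hv
        simpa [hu', hv'] using this
      · have hba : (contr z a b G).Adj a b := by rw [contr_adj hab]; simp
        intro p q hpq
        have hne := hpq.ne
        by_cases hp : p = z
        · subst hp
          rcases t1 q hpq with rfl | rfl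
          · simp [hne.symm]
          · simpa [hne.symm] using hba.reachable
        · by_cases hq : q = z
          · subst hq
            rcases t1 p hpq.symm with rfl | rfl
            · simp [hne]
            · simpa [hne] using hba.symm.reachable
          · simp only [hp, hq, if_false]
            apply SimpleGraph.Adj.reachable
            rw [contr_adj hab]; simp [hp, hq, hpq]
    · intro h
      have := reach_map (H := G) id ?_ h
      · simpa using this
      · intro p q hpq
        rw [contr_adj hab] at hpq
        have hr : G.Reachable a b := h1.symm.reachable.trans h2.reachable
        rcases hpq with h | ⟨rfl, rfl⟩ | ⟨rfl, rfl⟩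
        · exact h.2.2.reachable
        · exact hr
        · exact hr.symm
  · rw [mem_image]
    exact ⟨a, ha, SimpleGraph.ConnectedComponent.eq.2 h1.symm.reachable⟩

theorem reach_closed {G : SimpleGraph V} (P : V → Prop)
    (h : ∀ u v, P u → G.Adj u v → P v) {u v : V} (huv : G.Reachable u v) (hu : P u) : P v := by
  obtain ⟨w⟩ := huv
  induction w with
  | nil => exact hu
  | cons e _ ih => exact ih (h _ _ hu e)

theorem cc_delT {S : Finset V} {z a b : V} {G : SimpleGraph V} (hz : z ∉ S)
    (ha : a ∈ S) (hb : b ∈ S) (hab : a ≠ b) (hG : RS (insert z S) G)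
    (h1 : G.Adj z a) (h2 : G.Adj z b) (h3 : G.Adj a b) :
    cc (insert z S) G = cc ((S.erase a).erase b) (delT z a b G) + 1 := by
  have hza : z ≠ a := h1.ne
  have hzb : z ≠ b := h2.ne
  have hZ := hG.1 z (mem_insert_self _ _)
  have hA := hG.1 a (mem_insert_of_mem ha)
  have hB := hG.1 b (mem_insert_of_mem hb)
  have t1 : ∀ v, G.Adj z v → v = a ∨ v = b := fun v h => hZ.third h1 h2 hab h
  have t2 : ∀ v, G.Adj a v → v = z ∨ v = b := fun v h => hA.third h1.symm h3 hzb h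
  have t3 : ∀ v, G.Adj b v → v = z ∨ v = a := fun v h => hB.third h2.symm h3.symm hza h
  have hS : insert z S = insert z (insert a (insert b ((S.erase a).erase b))) := by
    ext; grind
  have ea : G.connectedComponentMk a = G.connectedComponentMk z :=
    SimpleGraph.ConnectedComponent.eq.2 h1.symm.reachable
  have eb : G.connectedComponentMk b = G.connectedComponentMk z :=
    SimpleGraph.ConnectedComponent.eq.2 h2.symm.reachable
  unfold cc
  rw [hS, image_insert, image_insert, image_insert, ea, eb, insert_idem, insert_idem,
    card_insert_of_notMem]
  · congr 1
    apply card_image_congr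
    intro u hu v hv
    rw [SimpleGraph.ConnectedComponent.eq, SimpleGraph.ConnectedComponent.eq]
    constructor
    · intro h
      refine (reach_closed (fun w => (w ≠ z ∧ w ≠ a ∧ w ≠ b) ∧ (delT z a b G).Reachable u w)
        ?_ h ⟨by grind, SimpleGraph.Reachable.refl _⟩).2
      rintro p q ⟨hp, hr⟩ hpq
      have q1 := t1 p
      have q2 := t2 p
      have q3 := t3 p
      have hpq' := hpq.symm
      have hq : q ≠ z ∧ q ≠ a ∧ q ≠ b := by grind
      refine ⟨hq, hr.trans (SimpleGraph.Adj.reachable ?_)⟩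
      rw [delT_adj]; grind
    · intro h
      refine reach_map (H := G) id ?_ h
      intro p q hpq
      rw [delT_adj] at hpq
      exact hpq.2.2.2.2.2.2.reachable
  · rw [mem_image]
    rintro ⟨v, hv, e⟩
    have := reach_closed (fun w => w = z ∨ w = a ∨ w = b) ?_
      (SimpleGraph.ConnectedComponent.eq.1 e).symm (Or.inl rfl)
    · grind
    · intro p q hp hpq
      have q1 := t1 q
      have q2 := t2 q
      have q3 := t3 q
      grind

/-- weighted count -/
noncomputable def F (x : ℝ) (S : Finset V) : ℝ :=
  ∑ G : SimpleGraph V with RS S G, x ^ cc S G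

theorem sum_A (x : ℝ) {S : Finset V} {z a b : V} (hz : z ∉ S)
    (ha : a ∈ S) (hb : b ∈ S) (hab : a ≠ b) :
    ∑ G : SimpleGraph V with (RS (insert z S) G ∧ G.Adj z a ∧ G.Adj z b ∧ ¬ G.Adj a b),
      x ^ cc (insert z S) G = ∑ G : SimpleGraph V with (RS S G ∧ G.Adj a b), x ^ cc S G := by
  have hza : z ≠ a := by rintro rfl; exact hz ha
  have hzb : z ≠ b := by rintro rfl; exact hz hb
  apply Finset.sum_bij' (fun G _ => contr z a b G) (fun G _ => subdiv z a b G)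
  · intro G hG
    simp only [mem_filter, mem_univ, true_and] at hG ⊢
    refine ⟨contr_RS hz ha hb hab hG.1 hG.2.1 hG.2.2.1 hG.2.2.2, ?_⟩
    rw [contr_adj hab]; simp
  · intro G hG
    simp only [mem_filter, mem_univ, true_and] at hG ⊢
    refine ⟨subdiv_RS hz ha hb hab hG.1 hG.2, ?_⟩
    rw [subdiv_adj hza hzb, subdiv_adj hza hzb, subdiv_adj hza hzb]
    grind
  · intro G hG
    simp only [mem_filter, mem_univ, true_and] at hG
    exact subdiv_contr hab hG.1 hG.2.1 hG.2.2.1 hG.2.2.2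
  · intro G hG
    simp only [mem_filter, mem_univ, true_and] at hG
    exact contr_subdiv hz ha hb hab hG.1 hG.2
  · intro G hG
    simp only [mem_filter, mem_univ, true_and] at hG
    rw [cc_contr hz ha hb hab hG.1 hG.2.1 hG.2.2.1]

theorem sum_T (x : ℝ) {S : Finset V} {z a b : V} (hz : z ∉ S)
    (ha : a ∈ S) (hb : b ∈ S) (hab : a ≠ b) :
    ∑ G : SimpleGraph V with (RS (insert z S) G ∧ G.Adj z a ∧ G.Adj z b ∧ G.Adj a b),
      x ^ cc (insert z S) G = x * F x ((S.erase a).erase b) := by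
  have hza : z ≠ a := by rintro rfl; exact hz ha
  have hzb : z ≠ b := by rintro rfl; exact hz hb
  unfold F
  rw [Finset.mul_sum]
  apply Finset.sum_bij' (fun G _ => delT z a b G) (fun G _ => addT z a b G)
  · intro G hG
    simp only [mem_filter, mem_univ, true_and] at hG ⊢
    exact delT_RS hz ha hb hab hG.1 hG.2.1 hG.2.2.1 hG.2.2.2
  · intro G hG
    simp only [mem_filter, mem_univ, true_and] at hG ⊢
    refine ⟨addT_RS hz ha hb hab hG, ?_⟩
    rw [addT_adj hza hzb hab, addT_adj hza hzb hab, addT_adj hza hzb hab]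
    grind
  · intro G hG
    simp only [mem_filter, mem_univ, true_and] at hG
    exact addT_delT ha hb hab hG.1 hG.2.1 hG.2.2.1 hG.2.2.2
  · intro G hG
    simp only [mem_filter, mem_univ, true_and] at hG
    exact delT_addT hz ha hb hab hG
  · intro G hG
    simp only [mem_filter, mem_univ, true_and] at hG
    rw [cc_delT hz ha hb hab hG.1 hG.2.1 hG.2.2.1 hG.2.2.2, pow_succ']

theorem D2.card_pairs {S : Finset V} {G : SimpleGraph V} {z : V} (h : D2 G z)
    (hS : ∀ u, G.Adj z u → u ∈ S) :
    (S.offDiag.filter fun p => G.Adj z p.1 ∧ G.Adj z p.2).card = 2 := by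
  obtain ⟨p, q, hpq, hu⟩ := h
  have hp : p ∈ S := hS p ((hu p).2 (by simp))
  have hq : q ∈ S := hS q ((hu q).2 (by simp))
  have : (S.offDiag.filter fun p => G.Adj z p.1 ∧ G.Adj z p.2) = {(p, q), (q, p)} := by
    ext ⟨s, t⟩
    simp only [mem_filter, mem_offDiag, hu, mem_insert, mem_singleton, Prod.mk.injEq]
    grind
  rw [this, card_pair]
  grind

theorem card_adj_pairs {S : Finset V} {G : SimpleGraph V} (h : RS S G) :
    (S.offDiag.filter fun p => G.Adj p.1 p.2).card = 2 * S.card := by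
  have : (S.offDiag.filter fun p => G.Adj p.1 p.2) =
      (S.sigma (fun a => univ.filter (G.Adj a))).map
     ⟨fun p : (_ : V) × V => (p.1, p.2), by rintro ⟨a, b⟩ ⟨c, d⟩; simp⟩ := by
    ext ⟨s, t⟩
    simp only [mem_filter, mem_offDiag, mem_map, mem_sigma, mem_univ, true_and, Sigma.exists]
    constructor
    · rintro ⟨⟨hs, -, -⟩, hst⟩
      exact ⟨s, t, ⟨hs, hst⟩, rfl⟩
    · rintro ⟨a, b, ⟨ha, hab⟩, e⟩
      have e1 : a = s := congrArg Prod.fst e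
      have e2 : b = t := congrArg Prod.snd e
      subst e1 e2
      refine ⟨⟨ha, ?_, hab.ne⟩, hab⟩
      by_contra hb
      exact h.2 b hb a hab.symm
  rw [this, card_map, card_sigma, mul_comm, ← smul_eq_mul, ← sum_const]
  refine sum_congr rfl fun a ha => ?_
  obtain ⟨p, q, hpq, hu⟩ := h.1 a ha
  rw [show univ.filter (G.Adj a) = {p, q} by ext; simp [hu], card_pair hpq]

theorem F_rec (x : ℝ) {S : Finset V} {z : V} (hz : z ∉ S) :
    2 * F x (insert z S) = 2 * S.card * F x S +
      ∑ p ∈ S.offDiag, x * F x ((S.erase p.1).erase p.2) := by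
  have e1 : 2 * F x (insert z S) = ∑ G : SimpleGraph V with RS (insert z S) G,
      ∑ p ∈ S.offDiag, if G.Adj z p.1 ∧ G.Adj z p.2 then x ^ cc (insert z S) G else 0 := by
    unfold F
    rw [mul_sum]
    refine sum_congr rfl fun G hG => ?_
    simp only [mem_filter, mem_univ, true_and] at hG
    rw [← sum_filter, sum_const, (hG.1 z (mem_insert_self _ _)).card_pairs]
    · simp
    · intro u hu
      have := hG.2 u
      have := hu.symm
      have := hu.ne
      grind
  have e2 : 2 * S.card * F x S = ∑ G : SimpleGraph V with RS S G,
      ∑ p ∈ S.offDiag, if G.Adj p.1 p.2 then x ^ cc S G else 0 := by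
    unfold F
    rw [mul_sum]
    refine sum_congr rfl fun G hG => ?_
    simp only [mem_filter, mem_univ, true_and] at hG
    rw [← sum_filter, sum_const, card_adj_pairs hG]
    simp
  rw [e1, e2, sum_comm, sum_comm (s := filter (RS S) univ), ← sum_add_distrib]
  refine sum_congr rfl fun p hp => ?_
  rw [mem_offDiag] at hp
  rw [← sum_T x hz hp.1 hp.2.1 hp.2.2, ← sum_filter, ← sum_filter, filter_filter, filter_filter,
    ← sum_A x hz hp.1 hp.2.1 hp.2.2, ← sum_union]
  · refine sum_congr ?_ fun _ _ => rfl
    ext G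
    simp only [mem_filter, mem_union, mem_univ, true_and]
    tauto
  · rw [disjoint_left]
    intro G h1 h2
    simp only [mem_filter, mem_univ, true_and] at h1 h2
    tauto

/-- the numerical sequence -/
noncomputable def f (x : ℝ) : ℕ → ℝ
  | 0 => 1
  | 1 => 0
  | 2 => 0
  | (n + 3) => (n + 2) * f x (n + 2) + (n + 2) * (n + 1) / 2 * x * f x n

theorem F_eq (x : ℝ) (n : ℕ) : ∀ S : Finset V, S.card = n → F x S = f x n := by
  induction n using Nat.strong_induction_on with
  | _ n ih =>
    intro S hS
    rcases n with _ | n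
    · rw [card_eq_zero] at hS
      subst hS
      have : (univ.filter (RS (∅ : Finset V))) = {⊥} := by
        ext G
        simp only [mem_filter, mem_univ, true_and, mem_singleton, RS]
        constructor
        · rintro ⟨-, h⟩
          ext u v
          simpa using h u (by simp) v
        · rintro rfl
          simp
      unfold F
      rw [this]
      simp [cc, f]
    · obtain ⟨z, T, hz, rfl, hT⟩ := card_eq_succ.1 hS
      have h := F_rec x hz
      rw [hT, ih n (by omega) T hT] at h
      have h2 : ∑ p ∈ T.offDiag, x * F x ((T.erase p.1).erase p.2) =
          ∑ p ∈ T.offDiag, x * f x (n - 2) := by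
        refine sum_congr rfl fun p hp => ?_
        rw [mem_offDiag] at hp
        rw [ih (n - 2) (by omega)]
        rw [card_erase_of_mem (by grind), card_erase_of_mem (by grind), hT]
        omega
      rw [h2, sum_const, offDiag_card, hT, nsmul_eq_mul] at h
      rcases n with _ | _ | n
      · simp [f] at h ⊢; linarith
      · simp [f] at h ⊢; linarith
      · have : (((n + 1 + 1) * (n + 1 + 1) - (n + 1 + 1) : ℕ) : ℝ) = (n + 2) * (n + 1) := by
          rw [Nat.cast_sub (by nlinarith)]; push_cast; ring
        rw [this] at h
        rw [f]
        push_cast at h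
        show _ = (n + 2) * f x (n + 1 + 1) + _
        linarith

theorem zf_closed_exists (G : SimpleGraph V) (S : Finset V) :
    ∃ T, Relation.ReflTransGen (zfStep G) S T ∧ S ⊆ T ∧ ∀ T', ¬ zfStep G T T' := by
  by_cases h : ∃ T', zfStep G S T'
  · obtain ⟨T', hT'⟩ := h
    have hlt : S ⊂ T' := by
      obtain ⟨v, hv, w, hw, -, -, rfl⟩ := hT'
      exact ssubset_insert hw
    have hdec : Fintype.card V - T'.card < Fintype.card V - S.card := by
      have := card_lt_card hlt
      have := card_le_univ T'
      omega
    obtain ⟨T, h1, h2, h3⟩ := zf_closed_exists G T'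
    exact ⟨T, Relation.ReflTransGen.head hT' h1, hlt.1.trans h2, h3⟩
  · push Not at h
    exact ⟨S, Relation.ReflTransGen.refl, Subset.refl _, h⟩
termination_by Fintype.card V - S.card

theorem zf_upper {G : SimpleGraph V} (hG : RS univ G) :
    ∃ S : Finset V, IsZeroForcingSet G S ∧ S.card ≤ 2 * cc univ G := by
  choose p q hpq hu using fun v => hG.1 v (mem_univ v)
  set C := univ.image G.connectedComponentMk with hC
  let S := C.image (fun c => c.out) ∪ C.image (fun c => p c.out)
  refine ⟨S, ?_, ?_⟩
  · obtain ⟨T, h1, h2, h3⟩ := zf_closed_exists G S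
    have hT : T = univ := by
      rw [eq_univ_iff_forall]
      intro v
      set r := (G.connectedComponentMk v).out with hr
      have hmem : G.connectedComponentMk v ∈ C := mem_image_of_mem _ (mem_univ _)
      have hrT : r ∈ T := h2 (mem_union_left _ (mem_image_of_mem _ hmem))
      have hpT : p r ∈ T := h2 (mem_union_right _
        (mem_image_of_mem (fun c : G.ConnectedComponent => p c.out) hmem))
      have hreach : G.Reachable r v := by
        apply SimpleGraph.ConnectedComponent.eq.1
        exact Quot.out_eq (G.connectedComponentMk v)
      refine (reach_closed (fun w => w ∈ T ∧ ∃ t, G.Adj w t ∧ t ∈ T) ?_ hreach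
        ⟨hrT, p r, (hu r (p r)).2 (by simp), hpT⟩).1
      rintro w y ⟨hw, t, hwt, ht⟩ hwy
      refine ⟨?_, w, hwy.symm, hw⟩
      by_contra hy
      refine h3 _ ⟨w, hw, y, hy, hwy, ?_, rfl⟩
      intro u hwu hu'
      have := (hG.1 w (mem_univ w)).third hwt hwy (by rintro rfl; exact hy ht) hwu
      grind
    rw [hT] at h1
    exact h1
  · calc S.card ≤ _ := card_union_le _ _
      _ ≤ C.card + C.card := add_le_add card_image_le card_image_le
      _ = 2 * cc univ G := by rw [hC, cc]; ring

theorem zf_lower_aux {G : SimpleGraph V} (hG : RS univ G) {S T : Finset V}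
    (h : Relation.ReflTransGen (zfStep G) S T) (c : G.ConnectedComponent)
    (hc : (S.filter fun v => G.connectedComponentMk v = c).card < 2) :
    (T.filter fun v => G.connectedComponentMk v = c).card < 2 := by
  induction h with
  | refl => exact hc
  | @tail T U _ hs ih =>
    obtain ⟨v, hv, w, hw, hvw, huniq, rfl⟩ := hs
    by_cases hwc : G.connectedComponentMk w = c
    · exfalso
      obtain ⟨p, q, hpq, hu⟩ := hG.1 v (mem_univ v)
      have hex : ∃ t, G.Adj v t ∧ t ≠ w := by
        by_cases hp : p = w
        · exact ⟨q, (hu q).2 (by simp), by grind⟩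
        · exact ⟨p, (hu p).2 (by simp), hp⟩
      obtain ⟨t, ht, htw⟩ := hex
      have htT : t ∈ T := by
        by_contra h
        exact htw (huniq t ht h)
      have hvc : G.connectedComponentMk v = c := by
        rw [← hwc]; exact SimpleGraph.ConnectedComponent.eq.2 hvw.reachable
      have htc : G.connectedComponentMk t = c := by
        rw [← hvc]; exact SimpleGraph.ConnectedComponent.eq.2 ht.symm.reachable
      have : 1 < (T.filter fun v => G.connectedComponentMk v = c).card :=
        one_lt_card.2 ⟨v, by simp [hv, hvc], t, by simp [htT, htc], ht.ne⟩
      omega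
    · rw [filter_insert, if_neg hwc]
      exact ih

theorem zf_lower {G : SimpleGraph V} (hG : RS univ G) {S : Finset V}
    (h : IsZeroForcingSet G S) : 2 * cc univ G ≤ S.card := by
  unfold cc
  apply mul_card_image_le_card_of_maps_to (f := G.connectedComponentMk)
    (fun v _ => mem_image_of_mem _ (mem_univ v))
  intro c hc
  by_contra hlt
  push Not at hlt
  have h2 := zf_lower_aux hG h c hlt
  rw [mem_image] at hc
  obtain ⟨v, -, rfl⟩ := hc
  obtain ⟨p, q, hpq, hu⟩ := hG.1 v (mem_univ v)
  have hv : G.Adj v p := (hu p).2 (by simp)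
  have : 1 < (univ.filter fun u => G.connectedComponentMk u = G.connectedComponentMk v).card :=
    one_lt_card.2 ⟨v, by simp, p, by simpa using hv.symm.reachable, hv.ne⟩
  omega

theorem zf_eq {G : SimpleGraph V} (hG : RS univ G) : zeroForcingNumber G = 2 * cc univ G := by
  unfold zeroForcingNumber
  obtain ⟨S, h1, h2⟩ := zf_upper hG
  apply le_antisymm
  · refine le_trans (Nat.sInf_le ?_) h2
    exact ⟨S, h1, rfl⟩
  · refine le_csInf ⟨S.card, S, h1, rfl⟩ ?_
    rintro k ⟨S, h, rfl⟩
    exact zf_lower hG h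

theorem RS_univ_iff (G : SimpleGraph V) [G.LocallyFinite] :
    RS univ G ↔ G.IsRegularOfDegree 2 := by
  unfold RS SimpleGraph.IsRegularOfDegree
  simp only [mem_univ, true_implies, not_true, false_implies, implies_true, and_true]
  refine forall_congr' fun v => ?_
  rw [← SimpleGraph.card_neighborFinset_eq_degree, card_eq_two]
  unfold D2
  refine exists_congr fun p => exists_congr fun q => and_congr Iff.rfl ?_
  rw [Finset.ext_iff]
  simp

end comb

section analysis
open Real

/-- normalised sequence -/
noncomputable def r (x : ℝ) (n : ℕ) : ℝ := f x (n + 1) / n.factorial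

theorem r_rec (x : ℝ) (n : ℕ) : r x (n + 3) = r x (n + 2) + x / 2 * (r x n / (n + 1)) := by
  unfold r
  rw [f]
  have h0 : (n.factorial : ℝ) ≠ 0 := by positivity
  have h1 : (n : ℝ) + 1 ≠ 0 := by positivity
  have h2 : (n : ℝ) + 2 ≠ 0 := by positivity
  have h3 : (n : ℝ) + 3 ≠ 0 := by positivity
  have e3 : ((n + 3).factorial : ℝ) = (n + 3) * (n + 2) * (n + 1) * n.factorial := by
    rw [Nat.factorial_succ, Nat.factorial_succ, Nat.factorial_succ]; push_cast; ring
  have e2 : ((n + 2).factorial : ℝ) = (n + 2) * (n + 1) * n.factorial := by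
    rw [Nat.factorial_succ, Nat.factorial_succ]; push_cast; ring
  rw [e3, e2]
  push_cast
  field_simp
  ring

theorem r0 (x : ℝ) : r x 0 = 0 := by simp [r, f]
theorem r1 (x : ℝ) : r x 1 = 0 := by simp [r, f]
theorem r2 (x : ℝ) : r x 2 = x / 2 := by simp [r, f]
theorem r3 (x : ℝ) : r x 3 = x / 2 := by rw [r_rec, r0, r2]; simp
theorem r4 (x : ℝ) : r x 4 = x / 2 := by
  have := r_rec x 1
  rw [r1, r3] at this; simpa using this

theorem r_mono (x : ℝ) (hx : 0 < x) (n : ℕ) : 0 ≤ r x n ∧ r x n ≤ r x (n + 1) := by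
  induction n using Nat.strong_induction_on with
  | _ n ih =>
    rcases n with _ | _ | n
    · simp [r0, r1]
    · simp [r1, r2]; positivity
    · have h1 := ih n (by omega)
      have h2 := ih (n + 1) (by omega)
      refine ⟨h2.1.trans h2.2, ?_⟩
      have := r_rec x n
      have h3 : 0 ≤ x / 2 * (r x n / (n + 1)) := by have := h1.1; positivity
      rw [show n + 1 + 1 + 1 = n + 3 from rfl, this]
      show r x (n + 2) ≤ _
      linarith

theorem r_upper (x : ℝ) (hx : 0 < x) (n : ℕ) (hn : 1 ≤ n) :
    r x (n + 2) ≤ x / 2 * (n : ℝ) ^ (x / 2) := by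
  induction n, hn using Nat.le_induction with
  | base => simp [r3]
  | succ n hn ih =>
    have hn' : (0 : ℝ) < n := by exact_mod_cast hn
    have h1 := r_rec x n
    have m1 := r_mono x hx n
    have m2 := r_mono x hx (n + 1)
    have hle : r x n ≤ r x (n + 2) := m1.2.trans m2.2
    have step : r x (n + 3) ≤ r x (n + 2) * (1 + x / 2 / (n + 1)) := by
      rw [h1]
      have : r x n / (n + 1) ≤ r x (n + 2) / (n + 1) := by gcongr
      have := mul_le_mul_of_nonneg_left this (by positivity : 0 ≤ x / 2)
      calc _ ≤ r x (n + 2) + x / 2 * (r x (n + 2) / (n + 1)) := by linarith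
        _ = _ := by ring
    have hlog : 1 / ((n : ℝ) + 1) ≤ log ((n + 1) / n) := by
      have := Real.one_sub_inv_le_log_of_pos (x := ((n : ℝ) + 1) / n) (by positivity)
      refine le_trans (le_of_eq ?_) this
      field_simp
      ring
    have hp : 1 + x / 2 / (n + 1) ≤ (((n : ℝ) + 1) / n) ^ (x / 2) := by
      rw [Real.rpow_def_of_pos (by positivity)]
      calc 1 + x / 2 / ((n : ℝ) + 1) ≤ exp (x / 2 / (n + 1)) := by
            have := Real.add_one_le_exp (x / 2 / ((n : ℝ) + 1)); linarith
        _ ≤ _ := by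
            apply Real.exp_le_exp.2
            calc x / 2 / ((n : ℝ) + 1) = 1 / ((n : ℝ) + 1) * (x / 2) := by ring
              _ ≤ _ := by gcongr
    calc r x (n + 1 + 2) ≤ r x (n + 2) * (1 + x / 2 / (n + 1)) := step
      _ ≤ (x / 2 * (n : ℝ) ^ (x / 2)) * (((n : ℝ) + 1) / n) ^ (x / 2) := by
          gcongr
      _ = x / 2 * ((n + 1 : ℕ) : ℝ) ^ (x / 2) := by
          rw [mul_assoc, ← Real.mul_rpow hn'.le (by positivity)]
          push_cast
          congr 2
          field_simp

theorem r_lower (n : ℕ) : √(n + 3) / 5 ≤ r 1 (n + 2) := by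
  induction n using Nat.strong_induction_on with
  | _ n ih =>
    have key : ∀ y : ℝ, y ≤ 6 → √y / 5 ≤ 1 / 2 := by
      intro y hy
      have : √y ≤ 5 / 2 := by
        rw [Real.sqrt_le_left (by norm_num)]; norm_num; linarith
      linarith
    rcases n with _ | _ | _ | n
    · simp only [zero_add, r2]; apply key; norm_num
    · rw [show 0 + 1 + 2 = 3 from rfl, r3]; apply key; norm_num
    · rw [show 0 + 1 + 1 + 2 = 4 from rfl, r4]; apply key; norm_num
    · have h1 := ih n (by omega)
      have h2 := ih (n + 2) (by omega)
      have h := r_rec 1 (n + 2)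
      rw [show n + 1 + 1 + 1 + 2 = n + 2 + 3 from by omega, h]
      push_cast at h1 h2 ⊢
      set s := √((n : ℝ) + 3) with hs
      set t := √((n : ℝ) + 2 + 3) with ht
      have hs0 : 0 < s := Real.sqrt_pos.2 (by positivity)
      have hst : s ≤ t := Real.sqrt_le_sqrt (by linarith)
      have hss : s * s = n + 3 := Real.mul_self_sqrt (by positivity)
      have htt : t * t = n + 5 := by rw [ht, Real.mul_self_sqrt (by positivity)]; ring
      have hu : √((n : ℝ) + 1 + 1 + 1 + 3) ≤ t + 1 / (2 * s) := by
        apply Real.sqrt_le_iff.2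
        refine ⟨by positivity, ?_⟩
        have e : (t + 1 / (2 * s)) ^ 2 = t * t + t / s + 1 / (4 * s ^ 2) := by
          field_simp; ring
        rw [e, htt]
        have : 1 ≤ t / s := (one_le_div hs0).2 hst
        have : 0 ≤ 1 / (4 * s ^ 2) := by positivity
        linarith
      have hd : 1 / s / 5 ≤ r 1 (n + 2) / (n + 2 + 1) := by
        rw [show (n : ℝ) + 2 + 1 = s * s by rw [hss]; ring]
        calc 1 / s / 5 = s / 5 / (s * s) := by field_simp
          _ ≤ _ := by gcongr
      have e : 1 / (2 * s) = 1 / s / 2 := by field_simp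
      rw [e] at hu
      linarith

theorem f_pos (n : ℕ) : 0 < f 1 (n + 3) := by
  have h := r_lower n
  have h2 : 0 < r 1 (n + 2) := lt_of_lt_of_le (by positivity) h
  unfold r at h2
  have := (div_pos_iff_of_pos_right (by positivity)).1 h2
  exact this

theorem f_ratio (x : ℝ) (hx : 0 < x) (n : ℕ) (hn : 4 ≤ n) :
    f x n / f 1 n ≤ 5 * (x / 2) * (n : ℝ) ^ ((x - 1) / 2) := by
  obtain ⟨m, rfl⟩ : ∃ m, n = m + 3 := ⟨n - 3, by omega⟩
  have h1 := r_upper x hx m (by omega)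
  have h2 := r_lower m
  have hfac : (0 : ℝ) < (m + 2).factorial := by positivity
  have e : f x (m + 3) / f 1 (m + 3) = r x (m + 2) / r 1 (m + 2) := by
    unfold r; rw [div_div_div_cancel_right₀ hfac.ne']
  have hm : (0 : ℝ) < (m : ℝ) + 3 := by positivity
  rw [e]
  calc r x (m + 2) / r 1 (m + 2) ≤ (x / 2 * ((m : ℝ) + 3) ^ (x / 2)) / (√(m + 3) / 5) := by
        gcongr
        refine h1.trans ?_
        gcongr
        linarith
    _ = _ := by
        push_cast
        rw [show (x - 1) / 2 = x / 2 - 1 / 2 by ring, Real.rpow_sub hm, Real.sqrt_eq_rpow]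
        field_simp

end analysis

section final
open scoped Classical
open Real Filter Topology

/-- number of 2-regular graphs with a property -/
noncomputable def cnt (n : ℕ) (Q : SimpleGraph (Fin n) → Prop) : ℕ :=
  (univ.filter fun G : SimpleGraph (Fin n) => RS univ G ∧ Q G).card

theorem cnt_union (n : ℕ) (P Q R : SimpleGraph (Fin n) → Prop)
    (h : ∀ G, P G ∨ Q G ∨ R G) : f 1 n ≤ (cnt n P : ℝ) + (cnt n Q + cnt n R) := by
  have hcard : f 1 n = ((univ.filter fun G : SimpleGraph (Fin n) => RS univ G).card : ℝ) := by
    rw [← F_eq 1 n (univ : Finset (Fin n)) (by simp), F]; simp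
  rw [hcard]
  unfold cnt
  norm_cast
  refine le_trans (card_le_card ?_) ((card_union_le _ _).trans
    (Nat.add_le_add_left (card_union_le _ _) _))
  intro G hG
  simp only [mem_filter, mem_univ, true_and, mem_union] at hG ⊢
  have := h G
  tauto

theorem bad_bound (x s : ℝ) (hx : 0 < x) (n : ℕ) (hn : 4 ≤ n) (Q : SimpleGraph (Fin n) → Prop)
    (hQ : ∀ G, RS univ G → Q G → 0 ≤ log x * (2 * (cc univ G : ℝ) - s * log n)) :
    (cnt n Q : ℝ) / f 1 n ≤
      5 * (x / 2) * (n : ℝ) ^ (((x - 1) - s * log x) / 2) := by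
  have hn0 : (0 : ℝ) < n := by exact_mod_cast (by omega : 0 < n)
  have hf : 0 < f 1 n := by
    obtain ⟨m, rfl⟩ : ∃ m, n = m + 3 := ⟨n - 3, by omega⟩
    exact f_pos m
  have h1 : (cnt n Q : ℝ) ≤
      f x n * (n : ℝ) ^ (- (s * log x) / 2) := by
    rw [← F_eq x n (univ : Finset (Fin n)) (by simp), F, sum_mul, cnt, card_eq_sum_ones, Nat.cast_sum]
    calc _ ≤ ∑ G : SimpleGraph (Fin n) with (RS univ G ∧ Q G),
          x ^ cc univ G * (n : ℝ) ^ (- (s * log x) / 2) := by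
          refine sum_le_sum fun G hG => ?_
          simp only [mem_filter, mem_univ, true_and] at hG
          have := hQ G hG.1 hG.2
          rw [← Real.rpow_natCast, Real.rpow_def_of_pos hx, Real.rpow_def_of_pos hn0,
            ← Real.exp_add, Nat.cast_one]
          apply Real.one_le_exp
          linarith
      _ ≤ _ := by
          refine sum_le_sum_of_subset_of_nonneg ?_ fun G _ _ => by positivity
          intro G hG
          simp only [mem_filter, mem_univ, true_and] at hG ⊢
          exact hG.1
  calc _ ≤ f x n * (n : ℝ) ^ (- (s * log x) / 2) / f 1 n := by gcongr
    _ = f x n / f 1 n * (n : ℝ) ^ (- (s * log x) / 2) := by ring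
    _ ≤ 5 * (x / 2) * (n : ℝ) ^ ((x - 1) / 2) * (n : ℝ) ^ (- (s * log x) / 2) := by
        gcongr
        exact f_ratio x hx n hn
    _ = _ := by
        rw [mul_assoc, ← Real.rpow_add hn0]
        congr 2
        ring

theorem bad_tendsto (x s : ℝ) (h : x - 1 < s * log x) :
    Tendsto (fun n : ℕ => 5 * (x / 2) * (n : ℝ) ^ (((x - 1) - s * log x) / 2)) atTop (𝓝 0) := by
  have := (tendsto_rpow_neg_atTop (y := (s * log x - (x - 1)) / 2) (by linarith)).comp
    (tendsto_natCast_atTop_atTop (R := ℝ))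
  have := this.const_mul (5 * (x / 2))
  rw [mul_zero] at this
  refine this.congr fun n => ?_
  simp only [Function.comp]
  congr 2
  ring

theorem prop_eq (n : ℕ) (P : SimpleGraph (Fin n) → Prop) :
    regularProportion 2 n P =
      (cnt n P : ℝ) / f 1 n := by
  unfold regularProportion cnt
  simp only [← RS_univ_iff]
  rw [Nat.card_eq_fintype_card, Nat.card_eq_fintype_card, Fintype.card_subtype,
    Fintype.card_subtype]
  congr 1
  rw [← F_eq 1 n (univ : Finset (Fin n)) (by simp), F]
  simp

theorem main (ε : ℝ) (hε : 0 < ε) :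
    Filter.Tendsto
      (fun n : ℕ => regularProportion 2 n fun G =>
        (1 - ε) * Real.log n ≤ (zeroForcingNumber G : ℝ) ∧
          (zeroForcingNumber G : ℝ) ≤ (1 + ε) * Real.log n)
      Filter.atTop (nhds 1) := by
  obtain ⟨x, hx0, hx1, hx⟩ : ∃ x : ℝ, 0 < x ∧ x < 1 ∧ x - 1 < (1 - ε) * log x := by
    by_cases h1 : 1 ≤ ε
    · refine ⟨1 / 2, by norm_num, by norm_num, ?_⟩
      have : log (1 / 2) < 0 := Real.log_neg (by norm_num) (by norm_num)
      nlinarith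
    · push Not at h1
      refine ⟨1 - ε / 2, by linarith, by linarith, ?_⟩
      have hp : 0 < 1 - ε / 2 := by linarith
      have := Real.one_sub_inv_le_log_of_pos hp
      have h2 := mul_le_mul_of_nonneg_left this (by linarith : 0 ≤ 1 - ε)
      refine lt_of_lt_of_le ?_ h2
      rw [← sub_pos]
      have : (1 - ε) * (1 - (1 - ε / 2)⁻¹) - (1 - ε / 2 - 1) = (ε / 2) ^ 2 / (1 - ε / 2) := by
        have hne : (2 : ℝ) - ε ≠ 0 := by linarith
        have hne2 : 1 - ε / 2 ≠ 0 := hp.ne'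
        have hi := inv_mul_cancel₀ hne2
        rw [eq_div_iff hne2]
        linear_combination (-(1 - ε)) * hi
      rw [this]; positivity
  obtain ⟨y, hy1, hy⟩ : ∃ y : ℝ, 1 < y ∧ y - 1 < (1 + ε) * log y := by
    refine ⟨1 + ε / 2, by linarith, ?_⟩
    have hp : 0 < 1 + ε / 2 := by linarith
    have := Real.one_sub_inv_le_log_of_pos hp
    have h2 := mul_le_mul_of_nonneg_left this (by linarith : 0 ≤ 1 + ε)
    refine lt_of_lt_of_le ?_ h2
    rw [← sub_pos]
    have : (1 + ε) * (1 - (1 + ε / 2)⁻¹) - (1 + ε / 2 - 1) = (ε / 2) ^ 2 / (1 + ε / 2) := by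
      field_simp; ring
    rw [this]; positivity
  have lim := (tendsto_const_nhds (x := (1 : ℝ)) (f := atTop (α := ℕ))).sub
    ((bad_tendsto x (1 - ε) hx).add (bad_tendsto y (1 + ε) hy))
  rw [add_zero, sub_zero] at lim
  refine tendsto_of_tendsto_of_tendsto_of_le_of_le' lim (tendsto_const_nhds (x := (1 : ℝ))) ?_ ?_
  · filter_upwards [eventually_ge_atTop 4] with n hn
    have hf : 0 < f 1 n := by
      obtain ⟨m, rfl⟩ : ∃ m, n = m + 3 := ⟨n - 3, by omega⟩
      exact f_pos m
    have b1 := bad_bound x (1 - ε) hx0 n hn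
      (fun G => (zeroForcingNumber G : ℝ) < (1 - ε) * log n) (by
        intro G hG hQ
        rw [zf_eq hG] at hQ
        push_cast at hQ
        exact mul_nonneg_of_nonpos_of_nonpos (Real.log_nonpos hx0.le hx1.le) (by linarith))
    have b2 := bad_bound y (1 + ε) (by linarith) n hn
      (fun G => (1 + ε) * log n < (zeroForcingNumber G : ℝ)) (by
        intro G hG hQ
        rw [zf_eq hG] at hQ
        push_cast at hQ
        exact mul_nonneg (Real.log_nonneg hy1.le) (by linarith))
    rw [prop_eq]
    have hsub := cnt_union n (fun G => (1 - ε) * Real.log n ≤ (zeroForcingNumber G : ℝ) ∧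
          (zeroForcingNumber G : ℝ) ≤ (1 + ε) * Real.log n)
      (fun G => (zeroForcingNumber G : ℝ) < (1 - ε) * log n)
      (fun G => (1 + ε) * log n < (zeroForcingNumber G : ℝ)) (by
        intro G
        by_cases c1 : (1 - ε) * Real.log n ≤ (zeroForcingNumber G : ℝ)
        · by_cases c2 : (zeroForcingNumber G : ℝ) ≤ (1 + ε) * Real.log n
          · exact Or.inl ⟨c1, c2⟩
          · exact Or.inr (Or.inr (not_le.1 c2))
        · exact Or.inr (Or.inl (not_le.1 c1)))
    have := (div_le_div_iff_of_pos_right hf).2 hsub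
    rw [div_self hf.ne', add_div, add_div] at this
    linarith
  · filter_upwards [eventually_ge_atTop 4] with n hn
    have hf : 0 < f 1 n := by
      obtain ⟨m, rfl⟩ : ∃ m, n = m + 3 := ⟨n - 3, by omega⟩
      exact f_pos m
    rw [prop_eq, div_le_one hf, ← F_eq 1 n (univ : Finset (Fin n)) (by simp), F, cnt]
    simp only [one_pow, sum_const, nsmul_eq_mul, mul_one, Nat.cast_le]
    refine card_le_card ?_
    intro G hG
    simp only [mem_filter, mem_univ, true_and] at hG ⊢
    exact hG.1

end final

end ZF

/-- For every `ε > 0`, a.a.s. a uniformly random simple 2-regular graph `G` on `n`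
labelled vertices satisfies `(1−ε) log n ≤ Z(G) ≤ (1+ε) log n`. -/
theorem aas_zeroForcing_two_regular (ε : ℝ) (hε : 0 < ε) :
    Filter.Tendsto
      (fun n : ℕ => regularProportion 2 n fun G =>
        (1 - ε) * Real.log n ≤ (zeroForcingNumber G : ℝ) ∧
          (zeroForcingNumber G : ℝ) ≤ (1 + ε) * Real.log n)
      Filter.atTop (nhds 1) := by
  exact ZF.main ε hε
end

section
/- The probability that a uniformly random simple 3-regular graph G on n labelled vertices satisfies Z(G) ≤ 0.17057·n tends to 1 as n → ∞ along even integers n. -/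
namespace ZFC
open Finset

section process
variable {V : Type*} [Fintype V] [DecidableEq V] {K : Type*}

/-- `w` is forced by some vertex of `B`. -/
def Forced (G : SimpleGraph V) (B : V → Prop) (w : V) : Prop :=
  ∃ u, B u ∧ G.Adj u w ∧ ∀ z, G.Adj u z → z ≠ w → B z

/-- `w` has at least two neighbours in `B`. -/
def TwoBlack (G : SimpleGraph V) (B : V → Prop) (w : V) : Prop :=
  ∃ x y, x ≠ y ∧ G.Adj w x ∧ G.Adj w y ∧ B x ∧ B y

/-- the synchronous process -/
def proc (G : SimpleGraph V) (seed : K) (chk : ℕ → K → Prop) (L : V → K) : ℕ → V → Prop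
  | 0 => fun v => L v = seed
  | t + 1 => fun v => proc G seed chk L t v ∨ Forced G (proc G seed chk L t) v ∨
      (chk t (L v) ∧ TwoBlack G (proc G seed chk L t) v)

/-- self-selected at time `t` -/
def Sel (G : SimpleGraph V) (seed : K) (chk : ℕ → K → Prop) (L : V → K) (t : ℕ) (v : V) : Prop :=
  ¬ proc G seed chk L t v ∧ ¬ Forced G (proc G seed chk L t) v ∧
      (chk t (L v) ∧ TwoBlack G (proc G seed chk L t) v)

/-- the vertices we pay for -/
def Paid (G : SimpleGraph V) (seed : K) (chk : ℕ → K → Prop) (T : ℕ) (L : V → K) (v : V) : Prop :=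
  L v = seed ∨ (∃ t < T, Sel G seed chk L t v) ∨ ¬ proc G seed chk L T v

lemma zf_closed (G : SimpleGraph V) (S C : Finset V)
    (h : Relation.ReflTransGen (zfStep G) S C) : S ⊆ C := by
  induction h with
  | refl => exact subset_rfl
  | tail _ h2 ih =>
    obtain ⟨v, hv, w, hw, _, _, rfl⟩ := h2
    exact ih.trans (Finset.subset_insert _ _)

lemma zf_paid (G : SimpleGraph V) (seed : K) (chk : ℕ → K → Prop) (T : ℕ) (L : V → K)
    (S : Finset V) (hS : ∀ v, Paid G seed chk T L v → v ∈ S) : IsZeroForcingSet G S := by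
  classical
  -- a maximal reachable set
  obtain ⟨C, hC, hmax⟩ := Finset.exists_max_image
    ((Finset.univ : Finset (Finset V)).filter (fun C => Relation.ReflTransGen (zfStep G) S C))
    Finset.card ⟨S, by simp [Relation.ReflTransGen.refl]⟩
  simp only [Finset.mem_filter, Finset.mem_univ, true_and] at hC hmax
  have hSC := zf_closed G S C hC
  have hcl : ∀ u ∈ C, ∀ w, G.Adj u w → (∀ z, G.Adj u z → z ≠ w → z ∈ C) → w ∈ C := by
    intro u hu w huw hz
    by_contra hw
    have := hmax (insert w C) (hC.tail ⟨u, hu, w, hw, huw, fun z hz1 hz2 => by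
      by_contra h; exact hz2 (hz z hz1 h), rfl⟩)
    rw [Finset.card_insert_of_notMem hw] at this
    omega
  have hB : ∀ t ≤ T, ∀ v, proc G seed chk L t v → v ∈ C := by
    intro t
    induction t with
    | zero => intro _ v hv; exact hSC (hS v (Or.inl hv))
    | succ t ih =>
      intro ht v hv
      have ih := ih (by omega)
      rcases hv with hv | hv | hv
      · exact ih v hv
      · obtain ⟨u, hu, huw, hz⟩ := hv
        exact hcl u (ih u hu) v huw fun z h1 h2 => ih z (hz z h1 h2)
      · by_cases h1 : proc G seed chk L t v
        · exact ih v h1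
        by_cases h2 : Forced G (proc G seed chk L t) v
        · obtain ⟨u, hu, huw, hz⟩ := h2
          exact hcl u (ih u hu) v huw fun z h1 h2 => ih z (hz z h1 h2)
        exact hSC (hS v (Or.inr (Or.inl ⟨t, by omega, h1, h2, hv⟩)))
  have : C = Finset.univ := by
    ext v
    simp only [Finset.mem_univ, iff_true]
    by_cases h : proc G seed chk L T v
    · exact hB T le_rfl v h
    · exact hSC (hS v (Or.inr (Or.inr h)))
  unfold IsZeroForcingSet
  rw [← this]; exact hC

lemma zf_le_card (G : SimpleGraph V) (S : Finset V) (h : IsZeroForcingSet G S) :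
    zeroForcingNumber G ≤ S.card :=
  Nat.sInf_le ⟨S, h, rfl⟩

end process
end ZFC

namespace ZFC
open Finset

/-- The behaviour of a branch (time-indexed). `w t r`: the root of the branch is white at time `t`
if its parent is black since time `r` and never forces; `q t`: with a white parent, the root
has not become able to force its parent before time `t`. -/
structure Ty where
  w : ℕ → ℕ → Prop
  q : ℕ → Prop
  q_zero : q 0
  q_anti : ∀ t, q (t + 1) → q t
  w_anti : ∀ t r, w (t + 1) r → w t r
  w_irrel : ∀ t r r', t ≤ r → t ≤ r' → w t r → w t r'
  w_q : ∀ t, w t t → q (t + 1)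

namespace Ty

/-- trivial type -/
def triv : Ty where
  w := fun _ _ => True
  q := fun _ => True
  q_zero := trivial
  q_anti := fun _ _ => trivial
  w_anti := fun _ _ _ => trivial
  w_irrel := fun _ _ _ _ _ _ => trivial
  w_q := fun _ _ => trivial

lemma w_le (a : Ty) {s t : ℕ} (h : s ≤ t) (r : ℕ) (hw : a.w t r) : a.w s r := by
  induction t, h using Nat.le_induction with
  | base => exact hw
  | succ t _ ih => exact ih (a.w_anti t r hw)

lemma q_le (a : Ty) {s t : ℕ} (h : s ≤ t) (hw : a.q t) : a.q s := by
  induction t, h using Nat.le_induction with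
  | base => exact hw
  | succ t _ ih => exact ih (a.q_anti t hw)

/-- white at `t` with parent black since `r ≥ s` gives white at `s` with white parent -/
lemma w_diag (a : Ty) {s t r : ℕ} (h : s ≤ t) (hr : s ≤ r) (hw : a.w t r) : a.w s s :=
  a.w_irrel s r s hr le_rfl (a.w_le h r hw)

end Ty

section types
variable {K : Type*} (seed : K) (chk : ℕ → K → Prop)

/-- white indicator of a composed branch -/
def wF (k : K) (a b : Ty) : ℕ → ℕ → Prop
  | 0, _ => k ≠ seed
  | t + 1, r => wF k a b t r ∧ a.q (t + 1) ∧ b.q (t + 1) ∧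
      (chk t k → (a.w t t ∨ b.w t t) ∧ (r ≤ t → a.w t t ∧ b.w t t))

/-- black time is `r` -/
def btF (k : K) (a b : Ty) (r : ℕ) : Prop :=
  ¬ wF seed chk k a b r r ∧ ∀ s < r, wF seed chk k a b s s

/-- not fired before `t` -/
def qF (k : K) (a b : Ty) : ℕ → Prop
  | 0 => True
  | t + 1 => wF seed chk k a b t t ∨ ∃ r ≤ t, btF seed chk k a b r ∧ (a.w t r ∨ b.w t r)

lemma wF_irrel (k : K) (a b : Ty) : ∀ t r r', t ≤ r → t ≤ r' →
    wF seed chk k a b t r → wF seed chk k a b t r'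
  | 0, _, _, _, _, h => h
  | t + 1, r, r', h1, h2, h => by
    obtain ⟨ha, hb, hc, hd⟩ := h
    exact ⟨wF_irrel k a b t r r' (by omega) (by omega) ha, hb, hc,
      fun hk => ⟨(hd hk).1, fun hr => by omega⟩⟩

/-- composition of branch types -/
def comp (k : K) (a b : Ty) : Ty where
  w := wF seed chk k a b
  q := qF seed chk k a b
  q_zero := trivial
  q_anti := by
    intro t h
    cases t with
    | zero => trivial
    | succ t =>
      rcases h with h | ⟨r, hr, hb, h⟩
      · exact Or.inl (wF_irrel seed chk k a b t (t+1) t (by omega) le_rfl h.1)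
      · rcases Nat.lt_or_ge t r with h2 | h2
        · have : r = t + 1 := by omega
          subst this
          exact Or.inl (hb.2 t (by omega))
        · exact Or.inr ⟨r, h2, hb, h.imp (a.w_anti t r) (b.w_anti t r)⟩
  w_anti := fun t r h => h.1
  w_irrel := wF_irrel seed chk k a b
  w_q := fun t h => Or.inl h

end types

section graph
variable {V : Type*} {K : Type*} 

/-- `kd x u` lists the two neighbours of `x` different from `u`. -/
def IsKids (G : SimpleGraph V) (kd : V → V → V × V) : Prop :=
  ∀ x u, G.Adj x u → (kd x u).1 ≠ (kd x u).2 ∧ (kd x u).1 ≠ u ∧ (kd x u).2 ≠ u ∧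
    ∀ z, G.Adj x z ↔ (z = u ∨ z = (kd x u).1 ∨ z = (kd x u).2)

/-- branch types on a graph -/
def ty (seed : K) (chk : ℕ → K → Prop) (kd : V → V → V × V) (L : V → K) : ℕ → V → V → Ty
  | 0, _, _ => Ty.triv
  | d + 1, x, u => comp seed chk (L x) (ty seed chk kd L d (kd x u).1 x) (ty seed chk kd L d (kd x u).2 x)

variable (G : SimpleGraph V) (seed : K) (chk : ℕ → K → Prop) (kd : V → V → V × V) (L : V → K)

lemma proc_mono {s t : ℕ} (h : s ≤ t) (v : V) (hv : proc G seed chk L s v) :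
    proc G seed chk L t v := by
  induction t, h using Nat.le_induction with
  | base => exact hv
  | succ t _ ih => exact Or.inl ih

/-- exactness of the white indicators -/
def ExA (t : ℕ) : Prop := ∀ u w, G.Adj u w → ∀ d, 2 * t + 1 ≤ d → ∀ r,
  (∀ s < t, (proc G seed chk L s w ↔ r ≤ s)) →
  (∀ s < t, proc G seed chk L s w → ∃ z, G.Adj w z ∧ z ≠ u ∧ ¬ proc G seed chk L s z) →
  (¬ proc G seed chk L t u ↔ (ty seed chk kd L d u w).w t r)

/-- exactness of the fired indicators -/
def ExB (t : ℕ) : Prop := ∀ u w, G.Adj u w → ∀ d, 2 * t + 2 ≤ d →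
  ¬ proc G seed chk L t w →
  (¬ (proc G seed chk L t u ∧ proc G seed chk L t (kd u w).1 ∧ proc G seed chk L t (kd u w).2) ↔
    (ty seed chk kd L d u w).q (t + 1))

variable {G kd} 

lemma ExA_white (t : ℕ) (h : ExA G seed chk kd L t) (u w : V) (huw : G.Adj u w) (d : ℕ)
    (hd : 2 * t + 1 ≤ d) (hw : ∀ s < t, ¬ proc G seed chk L s w) :
    ¬ proc G seed chk L t u ↔ (ty seed chk kd L d u w).w t t :=
  h u w huw d hd t (fun s hs => ⟨fun h => absurd h (hw s hs), fun h => by omega⟩)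
    (fun s hs h => absurd h (hw s hs))

lemma exB_of_exA (hk : IsKids G kd) (t : ℕ) (hA : ∀ s ≤ t, ExA G seed chk kd L s) :
    ExB G seed chk kd L t := by
  intro u w huw d hd hw
  obtain ⟨d, rfl⟩ : ∃ d', d = d' + 1 := ⟨d - 1, by omega⟩
  obtain ⟨h12, h1, h2, hadj⟩ := hk u w huw
  have hws : ∀ s ≤ t, ¬ proc G seed chk L s w := fun s hs h => hw (proc_mono G seed chk L hs w h)
  have hwhite : ∀ s ≤ t, (¬ proc G seed chk L s u ↔ (ty seed chk kd L (d+1) u w).w s s) :=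
    fun s hs => ExA_white seed chk L s (hA s hs) u w huw (d+1) (by omega)
      (fun s' hs' => hws s' (by omega))
  change _ ↔ (wF seed chk _ _ _ t t ∨ ∃ r ≤ t, btF seed chk _ _ _ r ∧ _)
  by_cases hu : proc G seed chk L t u
  · -- black
    have hnw : ¬ wF seed chk (L u) (ty seed chk kd L d (kd u w).1 u) (ty seed chk kd L d (kd u w).2 u) t t :=
      fun h => ((hwhite t le_rfl).2 h) hu
    classical
    let r0 := Nat.find (⟨t, hu⟩ : ∃ s, proc G seed chk L s u)
    have hr0 : proc G seed chk L r0 u := Nat.find_spec (⟨t, hu⟩ : ∃ s, proc G seed chk L s u)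
    have hr0t : r0 ≤ t := Nat.find_min' _ hu
    have hmin : ∀ s < r0, ¬ proc G seed chk L s u := fun s hs => Nat.find_min _ hs
    have hiff : ∀ s, proc G seed chk L s u ↔ r0 ≤ s := fun s =>
      ⟨fun h => by by_contra h'; exact hmin s (by omega) h, fun h => proc_mono G seed chk L h u hr0⟩
    have hbt : ∀ r ≤ t, (btF seed chk (L u) (ty seed chk kd L d (kd u w).1 u)
        (ty seed chk kd L d (kd u w).2 u) r ↔ r = r0) := by
      intro r hr
      constructor
      · rintro ⟨ha, hb⟩
        have ha' : proc G seed chk L r u := by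
          by_contra h; exact ha ((hwhite r hr).1 h)
        have h1 := (hiff r).1 ha'
        by_contra hne
        exact (hwhite r0 hr0t).2 (hb r0 (by omega)) hr0
      · rintro rfl
        exact ⟨fun h => (hwhite _ hr0t).2 h hr0, fun s hs => (hwhite s (by omega)).1 (hmin s hs)⟩
    have hkid : ∀ z, G.Adj u z → z ≠ w → 
        (¬ proc G seed chk L t z ↔ (ty seed chk kd L d z u).w t r0) := by
      intro z hz hzw
      refine hA t le_rfl z u hz.symm d (by omega) r0 (fun s _ => hiff s) ?_
      intro s hs _
      exact ⟨w, huw, hzw.symm, hws s (by omega)⟩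
    have k1 := hkid (kd u w).1 ((hadj _).2 (by simp)) h1
    have k2 := hkid (kd u w).2 ((hadj _).2 (by simp)) h2
    constructor
    · intro h
      right
      refine ⟨r0, hr0t, (hbt r0 hr0t).2 rfl, ?_⟩
      rw [← k1, ← k2]; tauto
    · rintro (h | ⟨r, hr, hb, h⟩)
      · exact absurd h hnw
      · rw [hbt r hr] at hb
        subst hb
        rw [← k1, ← k2] at h; tauto
  · have := (hwhite t le_rfl).1 hu
    constructor
    · intro _; left; exact this
    · intro _ h; exact hu h.1

lemma forced_iff (hk : IsKids G kd) (B : V → Prop) (u z : V) (huz : G.Adj u z) :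
    (B z ∧ ∀ y, G.Adj z y → y ≠ u → B y) ↔ (B z ∧ B (kd z u).1 ∧ B (kd z u).2) := by
  obtain ⟨h12, h1, h2, hadj⟩ := hk z u huz.symm
  constructor
  · rintro ⟨a, b⟩
    exact ⟨a, b _ ((hadj _).2 (by simp)) h1, b _ ((hadj _).2 (by simp)) h2⟩
  · rintro ⟨a, b, c⟩
    refine ⟨a, fun y hy hyu => ?_⟩
    rcases (hadj y).1 hy with h | h | h
    · exact absurd h hyu
    · rw [h]; exact b
    · rw [h]; exact c

lemma twoBlack_iff (G : SimpleGraph V) (B : V → Prop) (u x y z : V) (hxy : x ≠ y) (hxz : x ≠ z)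
    (hyz : y ≠ z) (hadj : ∀ c, G.Adj u c ↔ (c = x ∨ c = y ∨ c = z)) :
    TwoBlack G B u ↔ ((B x ∧ B y) ∨ (B x ∧ B z) ∨ (B y ∧ B z)) := by
  constructor
  · rintro ⟨c, e, hce, hc, he, bc, be⟩
    rcases (hadj c).1 hc with rfl | rfl | rfl <;> rcases (hadj e).1 he with rfl | rfl | rfl
    · exact absurd rfl hce
    · exact Or.inl ⟨bc, be⟩
    · exact Or.inr (Or.inl ⟨bc, be⟩)
    · exact Or.inl ⟨be, bc⟩
    · exact absurd rfl hce
    · exact Or.inr (Or.inr ⟨bc, be⟩)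
    · exact Or.inr (Or.inl ⟨be, bc⟩)
    · exact Or.inr (Or.inr ⟨be, bc⟩)
    · exact absurd rfl hce
  · rintro (⟨a, b⟩ | ⟨a, b⟩ | ⟨a, b⟩)
    · exact ⟨x, y, hxy, (hadj _).2 (by simp), (hadj _).2 (by simp), a, b⟩
    · exact ⟨x, z, hxz, (hadj _).2 (by simp), (hadj _).2 (by simp), a, b⟩
    · exact ⟨y, z, hyz, (hadj _).2 (by simp), (hadj _).2 (by simp), a, b⟩

lemma exA_succ (hk : IsKids G kd) (t : ℕ) (hA : ExA G seed chk kd L t)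
    (hB : ExB G seed chk kd L t) : ExA G seed chk kd L (t + 1) := by
  intro u w huw d hd r hw1 hw2
  have hAt := hA u w huw d (by omega) r (fun s hs => hw1 s (by omega)) (fun s hs => hw2 s (by omega))
  obtain ⟨d, rfl⟩ : ∃ d', d = d' + 1 := ⟨d - 1, by omega⟩
  obtain ⟨h12, h1, h2, hadj⟩ := hk u w huw
  have e : (ty seed chk kd L (d+1) u w).w (t+1) r ↔ ((ty seed chk kd L (d+1) u w).w t r ∧
    (ty seed chk kd L d (kd u w).1 u).q (t + 1) ∧ (ty seed chk kd L d (kd u w).2 u).q (t + 1) ∧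
    (chk t (L u) → ((ty seed chk kd L d (kd u w).1 u).w t t ∨ (ty seed chk kd L d (kd u w).2 u).w t t)
     ∧ (r ≤ t → (ty seed chk kd L d (kd u w).1 u).w t t ∧ (ty seed chk kd L d (kd u w).2 u).w t t))) :=
    Iff.rfl
  rw [e, ← hAt]
  by_cases hu : proc G seed chk L t u
  · simp only [hu, not_true_eq_false, false_and, iff_false, not_not]
    exact Or.inl hu
  have hus : ∀ s < t, ¬ proc G seed chk L s u := fun s hs h => hu (proc_mono G seed chk L hs.le u h)
  have a1 : G.Adj u (kd u w).1 := (hadj _).2 (by simp)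
  have a2 : G.Adj u (kd u w).2 := (hadj _).2 (by simp)
  have q1 := hB _ u a1.symm d (by omega) hu
  have q2 := hB _ u a2.symm d (by omega) hu
  have w1 := ExA_white seed chk L t hA _ u a1.symm d (by omega) hus
  have w2 := ExA_white seed chk L t hA _ u a2.symm d (by omega) hus
  rw [← q1, ← q2, ← w1, ← w2, ← forced_iff hk _ u _ a1, ← forced_iff hk _ u _ a2, ← hw1 t (by omega)]
  have hF : Forced G (proc G seed chk L t) u ↔
      ((proc G seed chk L t (kd u w).1 ∧ ∀ y, G.Adj (kd u w).1 y → y ≠ u → proc G seed chk L t y) ∨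
      (proc G seed chk L t (kd u w).2 ∧ ∀ y, G.Adj (kd u w).2 y → y ≠ u → proc G seed chk L t y)) := by
    constructor
    · rintro ⟨z, hz, hzu, hall⟩
      rcases (hadj z).1 hzu.symm with h | h | h
      · subst h
        obtain ⟨y, hy1, hy2, hy3⟩ := hw2 t (by omega) hz
        exact absurd (hall y hy1 hy2) hy3
      · left; rw [← h]; exact ⟨hz, hall⟩
      · right; rw [← h]; exact ⟨hz, hall⟩
    · rintro (h | h)
      · exact ⟨_, h.1, a1.symm, h.2⟩
      · exact ⟨_, h.1, a2.symm, h.2⟩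
  have hT : TwoBlack G (proc G seed chk L t) u ↔
      ((proc G seed chk L t w ∧ proc G seed chk L t (kd u w).1) ∨
       (proc G seed chk L t w ∧ proc G seed chk L t (kd u w).2) ∨
       (proc G seed chk L t (kd u w).1 ∧ proc G seed chk L t (kd u w).2)) := by
    exact twoBlack_iff G _ u _ _ _ h1.symm h2.symm h12 hadj
  change ¬ (_ ∨ _ ∨ _) ↔ _
  rw [hF, hT]
  generalize (proc G seed chk L t (kd u w).1 ∧ ∀ y, G.Adj (kd u w).1 y → y ≠ u → proc G seed chk L t y) = f1
  generalize (proc G seed chk L t (kd u w).2 ∧ ∀ y, G.Adj (kd u w).2 y → y ≠ u → proc G seed chk L t y) = f2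
  generalize proc G seed chk L t (kd u w).1 = b1
  generalize proc G seed chk L t (kd u w).2 = b2
  generalize proc G seed chk L t w = b3
  revert hu
  generalize proc G seed chk L t u = b4
  generalize chk t (L u) = c
  clear * -
  by_cases b1 <;> by_cases b2 <;> by_cases b3 <;> simp_all <;> tauto

lemma exAB (hk : IsKids G kd) (t : ℕ) :
    (∀ s ≤ t, ExA G seed chk kd L s) ∧ ExB G seed chk kd L t := by
  induction t with
  | zero =>
    have h0 : ∀ s ≤ 0, ExA G seed chk kd L s := by
      intro s hs
      obtain rfl : s = 0 := by omega
      intro u w huw d hd r _ _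
      obtain ⟨d, rfl⟩ : ∃ d', d = d' + 1 := ⟨d - 1, by omega⟩
      exact Iff.rfl
    exact ⟨h0, exB_of_exA seed chk L hk 0 h0⟩
  | succ t ih =>
    have : ∀ s ≤ t + 1, ExA G seed chk kd L s := by
      intro s hs
      rcases Nat.lt_or_ge t s with h | h
      · obtain rfl : s = t + 1 := by omega
        exact exA_succ seed chk L hk t (ih.1 t le_rfl) ih.2
      · exact ih.1 s h
    exact ⟨this, exB_of_exA seed chk L hk (t+1) this⟩

end graph
end ZFC

namespace ZFC
open Finset

section root
variable {V : Type*} {K : Type*} (seed : K) (chk : ℕ → K → Prop)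

/-- at most one of three branches has a black root at time `s` -/
def AMO (a b c : Ty) (s : ℕ) : Prop :=
  (a.w s s ∧ b.w s s) ∨ (a.w s s ∧ c.w s s) ∨ (b.w s s ∧ c.w s s)

/-- no branch has fired before `t` -/
def Q3 (a b c : Ty) (t : ℕ) : Prop := a.q t ∧ b.q t ∧ c.q t

/-- root white -/
def RW (k : K) (a b c : Ty) : ℕ → Prop
  | 0 => k ≠ seed
  | t + 1 => RW k a b c t ∧ Q3 a b c (t + 1) ∧ (chk t k → AMO a b c t)

/-- root selected at `t` -/
def RS (k : K) (a b c : Ty) (t : ℕ) : Prop :=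
  RW seed chk k a b c t ∧ Q3 a b c (t + 1) ∧ chk t k ∧ ¬ AMO a b c t

/-- root paid for -/
def RP (T : ℕ) (k : K) (a b c : Ty) : Prop :=
  k = seed ∨ (∃ t < T, RS seed chk k a b c t) ∨ RW seed chk k a b c T

lemma root_exact {G : SimpleGraph V} {kd : V → V → V × V} (L : V → K) (hk : IsKids G kd)
    (v x y z : V) (hxy : x ≠ y) (hxz : x ≠ z) (hyz : y ≠ z)
    (hadj : ∀ c, G.Adj v c ↔ (c = x ∨ c = y ∨ c = z)) (d t : ℕ) (hd : 2 * t + 2 ≤ d)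
    (hv : ¬ proc G seed chk L t v) :
    (¬ Forced G (proc G seed chk L t) v ↔ 
      Q3 (ty seed chk kd L d x v) (ty seed chk kd L d y v) (ty seed chk kd L d z v) (t + 1)) ∧
    (¬ TwoBlack G (proc G seed chk L t) v ↔ 
      AMO (ty seed chk kd L d x v) (ty seed chk kd L d y v) (ty seed chk kd L d z v) t) := by
  obtain ⟨hA, hB⟩ := exAB seed chk L hk t
  have ax : G.Adj v x := (hadj _).2 (by simp)
  have ay : G.Adj v y := (hadj _).2 (by simp)
  have az : G.Adj v z := (hadj _).2 (by simp)
  have hvs : ∀ s < t, ¬ proc G seed chk L s v := fun s hs h => hv (proc_mono G seed chk L hs.le v h)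
  constructor
  · unfold Q3
    rw [← hB x v ax.symm d hd hv, ← hB y v ay.symm d hd hv, ← hB z v az.symm d hd hv,
      ← forced_iff hk _ v _ ax, ← forced_iff hk _ v _ ay, ← forced_iff hk _ v _ az]
    constructor
    · intro h
      exact ⟨fun h' => h ⟨x, h'.1, ax.symm, h'.2⟩, fun h' => h ⟨y, h'.1, ay.symm, h'.2⟩,
        fun h' => h ⟨z, h'.1, az.symm, h'.2⟩⟩
    · rintro ⟨h1, h2, h3⟩ ⟨c, hc, hcv, hall⟩
      rcases (hadj c).1 hcv.symm with rfl | rfl | rfl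
      · exact h1 ⟨hc, hall⟩
      · exact h2 ⟨hc, hall⟩
      · exact h3 ⟨hc, hall⟩
  · unfold AMO
    rw [← ExA_white seed chk L t (hA t le_rfl) x v ax.symm d (by omega) hvs,
      ← ExA_white seed chk L t (hA t le_rfl) y v ay.symm d (by omega) hvs,
      ← ExA_white seed chk L t (hA t le_rfl) z v az.symm d (by omega) hvs,
      twoBlack_iff G _ v x y z hxy hxz hyz hadj]
    tauto

lemma root_white {G : SimpleGraph V} {kd : V → V → V × V} (L : V → K) (hk : IsKids G kd)
    (v x y z : V) (hxy : x ≠ y) (hxz : x ≠ z) (hyz : y ≠ z)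
    (hadj : ∀ c, G.Adj v c ↔ (c = x ∨ c = y ∨ c = z)) (d t : ℕ) (hd : 2 * t + 2 ≤ d) :
    ¬ proc G seed chk L t v ↔ 
      RW seed chk (L v) (ty seed chk kd L d x v) (ty seed chk kd L d y v) (ty seed chk kd L d z v) t := by
  induction t with
  | zero => exact Iff.rfl
  | succ t ih =>
    have ih := ih (by omega)
    change ¬ (_ ∨ _ ∨ _) ↔ (_ ∧ _ ∧ _)
    rw [← ih]
    by_cases hv : proc G seed chk L t v
    · simp [hv]
    obtain ⟨h1, h2⟩ := root_exact seed chk L hk v x y z hxy hxz hyz hadj d t (by omega) hv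
    rw [← h1, ← h2]
    tauto

lemma root_paid {G : SimpleGraph V} {kd : V → V → V × V} (L : V → K) (hk : IsKids G kd)
    (v x y z : V) (hxy : x ≠ y) (hxz : x ≠ z) (hyz : y ≠ z)
    (hadj : ∀ c, G.Adj v c ↔ (c = x ∨ c = y ∨ c = z)) (d T : ℕ) (hd : 2 * T + 2 ≤ d)
    (h : Paid G seed chk T L v) :
      RP seed chk T (L v) (ty seed chk kd L d x v) (ty seed chk kd L d y v) (ty seed chk kd L d z v) := by
  rcases h with h | ⟨t, ht, h1, h2, h3, h4⟩ | h
  · exact Or.inl h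
  · refine Or.inr (Or.inl ⟨t, ht, ?_⟩)
    obtain ⟨e1, e2⟩ := root_exact seed chk L hk v x y z hxy hxz hyz hadj d t (by omega) h1
    refine ⟨(root_white seed chk L hk v x y z hxy hxz hyz hadj d t (by omega)).1 h1, e1.1 h2, h3, ?_⟩
    rw [← e2]; exact not_not.2 h4
  · exact Or.inr (Or.inr ((root_white seed chk L hk v x y z hxy hxz hyz hadj d T hd).1 h))

end root

section expect
variable {V : Type*} [Fintype V] [DecidableEq V] {K : Type*} [Fintype K] (p : K → ℝ)

/-- weight of a labelling -/
noncomputable def wt (L : V → K) : ℝ := ∏ v, p (L v)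

/-- expectation over i.i.d. labels -/
noncomputable def EL (f : (V → K) → ℝ) : ℝ := ∑ L : V → K, wt p L * f L

lemma EL_coord (hp : ∑ k, p k = 1) (x : V) (g : K → ℝ) :
    EL p (fun L : V → K => g (L x)) = ∑ k, p k * g k := by
  unfold EL wt
  have : ∀ L : V → K, (∏ v, p (L v)) * g (L x) =
      ∏ v, (p (L v) * if v = x then g (L v) else 1) := by
    intro L
    rw [Finset.prod_mul_distrib]
    congr 1
    rw [Finset.prod_ite_eq' Finset.univ x (fun v => g (L v))]
    simp
  simp_rw [this]
  have h2 := Finset.prod_univ_sum (fun _ : V => (Finset.univ : Finset K))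
    (fun v k => p k * if v = x then g k else (1:ℝ))
  rw [Fintype.piFinset_univ] at h2
  rw [← h2]
  rw [← Finset.mul_prod_erase _ _ (Finset.mem_univ x)]
  rw [Finset.prod_eq_one (s := Finset.univ.erase x)]
  · simp
  · intro v hv
    have : v ≠ x := (Finset.mem_erase.1 hv).1
    simp [this, hp]

lemma EL_const (hp : ∑ k, p k = 1) (c : ℝ) : EL p (fun _ : V → K => c) = c := by
  unfold EL wt
  rw [← Finset.sum_mul]
  have h2 := Finset.prod_univ_sum (fun _ : V => (Finset.univ : Finset K)) (fun _ k => p k)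
  rw [Fintype.piFinset_univ] at h2
  rw [← h2, hp]; simp

lemma EL_mono (h0 : ∀ k, 0 ≤ p k) (f g : (V → K) → ℝ) (h : ∀ L, f L ≤ g L) : EL p f ≤ EL p g :=
  Finset.sum_le_sum fun L _ => mul_le_mul_of_nonneg_left (h L) (Finset.prod_nonneg fun v _ => h0 _)

lemma EL_sum {ι : Type*} (s : Finset ι) (f : ι → (V → K) → ℝ) :
    EL p (fun L => ∑ i ∈ s, f i L) = ∑ i ∈ s, EL p (f i) := by
  unfold EL
  simp_rw [Finset.mul_sum]
  exact Finset.sum_comm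

open Classical in
/-- merge two labellings along a set -/
noncomputable def merge (A : Set V) (L L' : V → K) : V → K := fun v => if v ∈ A then L v else L' v

lemma EL_indep (hp : ∑ k, p k = 1) {α β : Type*} (A : Set V) (X : (V → K) → α) (Y : (V → K) → β)
    (hX : ∀ L L', (∀ v ∈ A, L v = L' v) → X L = X L')
    (hY : ∀ L L', (∀ v, v ∉ A → L v = L' v) → Y L = Y L') (F : α → β → ℝ) :
    EL p (fun L => F (X L) (Y L)) = EL p (fun L => EL p (fun L' => F (X L) (Y L'))) := by
  classical
  have h1 : EL p (fun L => F (X L) (Y L)) =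
      ∑ P : (V → K) × (V → K), wt p P.1 * wt p P.2 * F (X P.1) (Y P.1) := by
    rw [Fintype.sum_prod_type]
    unfold EL
    refine Finset.sum_congr rfl fun L _ => ?_
    have := EL_const p hp (V := V) 1
    unfold EL at this
    simp only [mul_one] at this
    dsimp only
    rw [← Finset.sum_mul, ← Finset.mul_sum, this, mul_one]
  have h2 : EL p (fun L => EL p (fun L' => F (X L) (Y L'))) =
      ∑ P : (V → K) × (V → K), wt p P.1 * wt p P.2 * F (X P.1) (Y P.2) := by
    rw [Fintype.sum_prod_type]
    unfold EL
    refine Finset.sum_congr rfl fun L _ => ?_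
    rw [Finset.mul_sum]
    refine Finset.sum_congr rfl fun L' _ => ?_
    ring
  rw [h1, h2]
  have hinv : Function.Involutive
      (fun P : (V → K) × (V → K) => (merge A P.1 P.2, merge A P.2 P.1)) := by
    rintro ⟨L, L'⟩
    refine Prod.ext ?_ ?_ <;> funext v <;> simp only [merge] <;> split_ifs <;> rfl
  rw [← Equiv.sum_comp (hinv.toPerm)]
  refine Finset.sum_congr rfl fun P _ => ?_
  obtain ⟨L, L'⟩ := P
  simp only [Function.Involutive.coe_toPerm]
  have e1 : wt p (merge A L L') * wt p (merge A L' L) = wt p L * wt p L' := by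
    unfold wt
    rw [← Finset.prod_mul_distrib, ← Finset.prod_mul_distrib]
    refine Finset.prod_congr rfl fun v _ => ?_
    simp only [merge]
    split_ifs
    · rfl
    · ring
  rw [e1, hX (merge A L L') L (fun v hv => by simp [merge, hv]),
    hY (merge A L L') L' (fun v hv => by simp [merge, hv])]

end expect

set_option linter.unusedSectionVars false
set_option linter.unusedVariables false

section transfer
variable {V : Type*} [Fintype V] [DecidableEq V] {K : Type*} [Fintype K] (p : K → ℝ)
  (seed : K) (chk : ℕ → K → Prop) (kd : V → V → V × V)

/-- law of the branch type of depth `d`, as an expectation functional -/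
noncomputable def mu : ℕ → (Ty → ℝ) → ℝ
  | 0, f => f Ty.triv
  | d + 1, f => ∑ k, p k * mu d (fun a => mu d (fun b => f (comp seed chk k a b)))

/-- vertices visited by a branch -/
def dset : ℕ → V → V → Set V
  | 0, _, _ => ∅
  | d + 1, x, u => {x} ∪ (dset d (kd x u).1 x ∪ dset d (kd x u).2 x)

/-- tree-like branch -/
def Good : ℕ → V → V → Prop
  | 0, _, _ => True
  | d + 1, x, u => Good d (kd x u).1 x ∧ Good d (kd x u).2 x ∧ x ∉ dset kd d (kd x u).1 x ∧
      x ∉ dset kd d (kd x u).2 x ∧ Disjoint (dset kd d (kd x u).1 x) (dset kd d (kd x u).2 x)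

lemma ty_dep (d : ℕ) (x u : V) (L L' : V → K) (h : ∀ v ∈ dset kd d x u, L v = L' v) :
    ty seed chk kd L d x u = ty seed chk kd L' d x u := by
  induction d generalizing x u with
  | zero => rfl
  | succ d ih =>
    simp only [ty]
    rw [ih _ _ fun v hv => h v (Or.inr (Or.inl hv)), ih _ _ fun v hv => h v (Or.inr (Or.inr hv)),
      h x (Or.inl rfl)]

lemma EL_ty (hp : ∑ k, p k = 1) (d : ℕ) (x u : V) (hg : Good kd d x u) (f : Ty → ℝ) :
    EL p (fun L => f (ty seed chk kd L d x u)) = mu p seed chk d f := by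
  induction d generalizing x u f with
  | zero => exact EL_const (V := V) p hp (f Ty.triv)
  | succ d ih =>
    obtain ⟨g1, g2, n1, n2, hd⟩ := hg
    have s1 := EL_indep p hp {x} (fun L : V → K => L x)
      (fun L : V → K => (ty seed chk kd L d (kd x u).1 x, ty seed chk kd L d (kd x u).2 x))
      (fun L L' h => h x rfl)
      (fun L L' h => by
        rw [ty_dep seed chk kd d _ _ L L' fun v hv => h v (by rintro rfl; exact n1 hv),
          ty_dep seed chk kd d _ _ L L' fun v hv => h v (by rintro rfl; exact n2 hv)])
      (fun k ab => f (comp seed chk k ab.1 ab.2))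
    have s2 : ∀ k, EL p (fun L : V → K => f (comp seed chk k
        (ty seed chk kd L d (kd x u).1 x) (ty seed chk kd L d (kd x u).2 x))) =
        mu p seed chk d (fun a => mu p seed chk d (fun b => f (comp seed chk k a b))) := by
      intro k
      rw [EL_indep p hp (dset kd d (kd x u).1 x) (fun L : V → K => ty seed chk kd L d (kd x u).1 x)
        (fun L : V → K => ty seed chk kd L d (kd x u).2 x)
        (fun L L' h => ty_dep seed chk kd d _ _ L L' h)
        (fun L L' h => ty_dep seed chk kd d _ _ L L' fun v hv => h v fun hv' =>
          Set.disjoint_left.1 hd hv' hv)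
        (fun a b => f (comp seed chk k a b))]
      rw [← ih _ _ g1 (fun a => mu p seed chk d (fun b => f (comp seed chk k a b)))]
      congr 1
      funext L
      exact ih _ _ g2 (fun b => f (comp seed chk k (ty seed chk kd L d (kd x u).1 x) b))
    simp only [ty, mu]
    rw [s1]
    simp only [s2]
    exact EL_coord p hp x (fun k => mu p seed chk d (fun a => mu p seed chk d (fun b => f (comp seed chk k a b))))

lemma EL_root (hp : ∑ k, p k = 1) (d : ℕ) (v x y z : V) (gx : Good kd d x v) (gy : Good kd d y v)
    (gz : Good kd d z v) (nx : v ∉ dset kd d x v) (ny : v ∉ dset kd d y v) (nz : v ∉ dset kd d z v)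
    (hxy : Disjoint (dset kd d x v) (dset kd d y v)) (hxz : Disjoint (dset kd d x v) (dset kd d z v))
    (hyz : Disjoint (dset kd d y v) (dset kd d z v)) (F : K → Ty → Ty → Ty → ℝ) :
    EL p (fun L => F (L v) (ty seed chk kd L d x v) (ty seed chk kd L d y v) (ty seed chk kd L d z v)) =
    ∑ k, p k * mu p seed chk d (fun a => mu p seed chk d (fun b => mu p seed chk d (fun c => F k a b c))) := by
  have s1 := EL_indep p hp {v} (fun L : V → K => L v)
      (fun L : V → K => (ty seed chk kd L d x v, ty seed chk kd L d y v, ty seed chk kd L d z v))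
      (fun L L' h => h v rfl)
      (fun L L' h => by
        rw [ty_dep seed chk kd d x v L L' fun v hv => h v (by rintro rfl; exact nx hv),
          ty_dep seed chk kd d y v L L' fun v hv => h v (by rintro rfl; exact ny hv),
          ty_dep seed chk kd d z v L L' fun v hv => h v (by rintro rfl; exact nz hv)])
      (fun k abc => F k abc.1 abc.2.1 abc.2.2)
  rw [s1]
  have s2 : ∀ k, EL p (fun L : V → K => F k (ty seed chk kd L d x v) (ty seed chk kd L d y v) (ty seed chk kd L d z v)) =
      mu p seed chk d (fun a => mu p seed chk d (fun b => mu p seed chk d (fun c => F k a b c))) := by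
    intro k
    rw [EL_indep p hp (dset kd d x v) (fun L : V → K => ty seed chk kd L d x v)
      (fun L : V → K => (ty seed chk kd L d y v, ty seed chk kd L d z v))
      (fun L L' h => ty_dep seed chk kd d x v L L' h)
      (fun L L' h => by
        rw [ty_dep seed chk kd d y v L L' fun v hv => h v fun hv' => Set.disjoint_left.1 hxy hv' hv,
          ty_dep seed chk kd d z v L L' fun v hv => h v fun hv' => Set.disjoint_left.1 hxz hv' hv])
      (fun a bc => F k a bc.1 bc.2)]
    rw [← EL_ty p seed chk kd hp d x v gx]
    congr 1
    funext L
    rw [EL_indep p hp (dset kd d y v) (fun L : V → K => ty seed chk kd L d y v)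
      (fun L : V → K => ty seed chk kd L d z v)
      (fun L L' h => ty_dep seed chk kd d y v L L' h)
      (fun L L' h => ty_dep seed chk kd d z v L L' fun v hv => h v fun hv' => Set.disjoint_left.1 hyz hv' hv)
      (fun b c => F k (ty seed chk kd L d x v) b c)]
    rw [← EL_ty p seed chk kd hp d y v gy]
    congr 1
    funext L'
    exact EL_ty p seed chk kd hp d z v gz (fun c => F k (ty seed chk kd L d x v) (ty seed chk kd L' d y v) c)
  simp only [s2]
  exact EL_coord p hp v (fun k => mu p seed chk d (fun a => mu p seed chk d (fun b => mu p seed chk d (fun c => F k a b c))))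

end transfer
end ZFC

namespace ZFC
open Finset
set_option linter.unusedSectionVars false
set_option linter.unusedVariables false

open Classical in
/-- indicator -/
noncomputable def ind (P : Prop) : ℝ := if P then 1 else 0

lemma ind_and (P Q : Prop) : ind (P ∧ Q) = ind P * ind Q := by
  unfold ind; by_cases P <;> by_cases Q <;> simp_all
lemma ind_nonneg (P : Prop) : 0 ≤ ind P := by unfold ind; split_ifs <;> norm_num
lemma ind_le_one (P : Prop) : ind P ≤ 1 := by unfold ind; split_ifs <;> norm_num
lemma ind_mono {P Q : Prop} (h : P → Q) : ind P ≤ ind Q := by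
  unfold ind; by_cases hP : P
  · simp [hP, h hP]
  · simp only [hP, if_false]; split_ifs <;> norm_num
lemma ind_true {P : Prop} (h : P) : ind P = 1 := by simp [ind, h]
lemma ind_false {P : Prop} (h : ¬ P) : ind P = 0 := by simp [ind, h]

section mulemmas
variable {K : Type*} [Fintype K] (p : K → ℝ) (seed : K) (chk : ℕ → K → Prop)

lemma mu_add (d : ℕ) (f g : Ty → ℝ) :
    mu p seed chk d (fun a => f a + g a) = mu p seed chk d f + mu p seed chk d g := by
  induction d generalizing f g with
  | zero => rfl
  | succ d ih => simp only [mu, ih, mul_add, Finset.sum_add_distrib]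

lemma mu_smul (d : ℕ) (c : ℝ) (f : Ty → ℝ) :
    mu p seed chk d (fun a => c * f a) = c * mu p seed chk d f := by
  induction d generalizing f with
  | zero => rfl
  | succ d ih =>
    simp only [mu, ih, Finset.mul_sum]
    exact Finset.sum_congr rfl fun k _ => by ring

lemma mu_mulc (d : ℕ) (c : ℝ) (f : Ty → ℝ) :
    mu p seed chk d (fun a => f a * c) = mu p seed chk d f * c := by
  simp only [mul_comm _ c]; exact mu_smul p seed chk d c f

lemma mu_sub (d : ℕ) (f g : Ty → ℝ) :
    mu p seed chk d (fun a => f a - g a) = mu p seed chk d f - mu p seed chk d g := by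
  have := mu_add p seed chk d f (fun a => (-1) * g a)
  rw [mu_smul] at this
  simp only [neg_one_mul, ← sub_eq_add_neg] at this
  exact this

lemma mu_zero (d : ℕ) : mu p seed chk d (fun _ => 0) = 0 := by
  simpa using mu_smul p seed chk d 0 (fun _ => 0)

lemma mu_sum {ι : Type*} (d : ℕ) (s : Finset ι) (f : ι → Ty → ℝ) :
    mu p seed chk d (fun a => ∑ i ∈ s, f i a) = ∑ i ∈ s, mu p seed chk d (f i) := by
  classical
  induction s using Finset.induction_on with
  | empty => simpa using mu_zero p seed chk d
  | insert i s hi ih =>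
    simp only [Finset.sum_insert hi]
    rw [mu_add, ih]

lemma mu_const (hp : ∑ k, p k = 1) (d : ℕ) (c : ℝ) : mu p seed chk d (fun _ => c) = c := by
  induction d with
  | zero => rfl
  | succ d ih => simp only [mu, ih, ← Finset.sum_mul, hp, one_mul]

lemma mu_mono (h0 : ∀ k, 0 ≤ p k) (d : ℕ) (f g : Ty → ℝ) (h : ∀ a, f a ≤ g a) : mu p seed chk d f ≤ mu p seed chk d g := by
  induction d generalizing f g with
  | zero => exact h _
  | succ d ih =>
    simp only [mu]
    exact Finset.sum_le_sum fun k _ => mul_le_mul_of_nonneg_left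
      (ih _ _ fun a => ih _ _ fun b => h _) (h0 k)

/-- probability of not having fired before `t` -/
noncomputable def Nn (d t : ℕ) : ℝ := mu p seed chk d (fun a => ind (a.q t))
/-- joint probability -/
noncomputable def Gg (d s t : ℕ) : ℝ := mu p seed chk d (fun a => ind (a.w s s ∧ a.q t))
/-- probability of white with parent black since `r` -/
noncomputable def YY (d r t : ℕ) : ℝ := mu p seed chk d (fun a => ind (a.w t r))

open Classical in
/-- last check time before `t` -/
noncomputable def lc (k : K) : ℕ → Option ℕ
  | 0 => none
  | t + 1 => if chk t k then some t else lc k t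

/-- `Gg` or `Nn` -/
noncomputable def GO (d : ℕ) (o : Option ℕ) (t : ℕ) : ℝ :=
  match o with
  | none => Nn p seed chk d t
  | some l => Gg p seed chk d l t

lemma lc_none (k : K) (t : ℕ) (h : lc chk k t = none) : ∀ s < t, ¬ chk s k := by
  induction t with
  | zero => intro s hs; omega
  | succ t ih =>
    simp only [lc] at h
    split_ifs at h with hc
    intro s hs
    rcases Nat.lt_succ_iff_lt_or_eq.1 hs with h' | rfl
    · exact ih h s h'
    · exact hc

lemma lc_some (k : K) (t l : ℕ) (h : lc chk k t = some l) : l < t ∧ chk l k ∧ ∀ s < t, chk s k → s ≤ l := by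
  induction t with
  | zero => simp [lc] at h
  | succ t ih =>
    simp only [lc] at h
    split_ifs at h with hc
    · simp only [Option.some.injEq] at h
      subst h
      exact ⟨by omega, hc, fun s hs _ => by omega⟩
    · obtain ⟨h1, h2, h3⟩ := ih h
      refine ⟨by omega, h2, fun s hs hcs => ?_⟩
      rcases Nat.lt_succ_iff_lt_or_eq.1 hs with h' | rfl
      · exact h3 s h' hcs
      · exact absurd hcs hc

lemma wF_iff (k : K) (a b : Ty) (t r : ℕ) : wF seed chk k a b t r ↔ (k ≠ seed ∧ a.q t ∧ b.q t ∧
    ∀ s < t, chk s k → (a.w s s ∨ b.w s s) ∧ (r ≤ s → a.w s s ∧ b.w s s)) := by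
  induction t with
  | zero => simp [wF, a.q_zero, b.q_zero]
  | succ t ih =>
    simp only [wF, ih]
    constructor
    · rintro ⟨⟨h1, h2, h3, h4⟩, h5, h6, h7⟩
      refine ⟨h1, h5, h6, fun s hs => ?_⟩
      rcases Nat.lt_succ_iff_lt_or_eq.1 hs with h' | rfl
      · exact h4 s h'
      · exact h7
    · rintro ⟨h1, h5, h6, h7⟩
      exact ⟨⟨h1, a.q_anti _ h5, b.q_anti _ h6, fun s hs => h7 s (by omega)⟩, h5, h6, h7 t (by omega)⟩

lemma wF_none (k : K) (hk : k ≠ seed) (a b : Ty) (t r : ℕ) (h : lc chk k t = none) :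
    wF seed chk k a b t r ↔ (a.q t ∧ b.q t) := by
  rw [wF_iff]
  have := lc_none chk k t h
  constructor
  · rintro ⟨_, h1, h2, _⟩; exact ⟨h1, h2⟩
  · rintro ⟨h1, h2⟩; exact ⟨hk, h1, h2, fun s hs hc => absurd hc (this s hs)⟩

lemma wF_some (k : K) (hk : k ≠ seed) (a b : Ty) (t r l : ℕ) (h : lc chk k t = some l) :
    wF seed chk k a b t r ↔ (a.q t ∧ b.q t ∧ (a.w l l ∨ b.w l l) ∧ (r ≤ l → a.w l l ∧ b.w l l)) := by
  rw [wF_iff]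
  obtain ⟨hl, hc, hmax⟩ := lc_some chk k t l h
  constructor
  · rintro ⟨_, h1, h2, h3⟩; exact ⟨h1, h2, h3 l hl hc⟩
  · rintro ⟨h1, h2, h3, h4⟩
    refine ⟨hk, h1, h2, fun s hs hcs => ?_⟩
    have hsl := hmax s hs hcs
    have ha : a.w l l → a.w s s := a.w_diag hsl hsl
    have hb : b.w l l → b.w s s := b.w_diag hsl hsl
    exact ⟨h3.imp ha hb, fun hr => ⟨ha (h4 (by omega)).1, hb (h4 (by omega)).2⟩⟩

/-- per-class white probability -/
noncomputable def yk (N g : ℝ) (o : Option ℕ) (r : ℕ) : ℝ :=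
  if o.getD 0 < r then 2 * g * N - g * g else g * g

lemma yk_eq (hp : ∑ k, p k = 1) (d : ℕ) (k : K) (hk : k ≠ seed) (r t : ℕ) :
    mu p seed chk d (fun a => mu p seed chk d (fun b => ind (wF seed chk k a b t r))) =
    yk (Nn p seed chk d t) (GO p seed chk d (lc chk k t) t) (lc chk k t) r := by
  rcases ho : lc chk k t with _ | l
  · simp only [wF_none seed chk k hk _ _ t r ho, ind_and, mu_smul, mu_mulc, GO, yk]
    unfold Nn
    split_ifs <;> ring
  · simp only [wF_some seed chk k hk _ _ t r l ho, GO, yk, Option.getD_some]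
    by_cases hr : l < r
    · have : ∀ a b : Ty, ind (a.q t ∧ b.q t ∧ (a.w l l ∨ b.w l l) ∧ (r ≤ l → a.w l l ∧ b.w l l)) =
        (ind (a.w l l ∧ a.q t) * ind (b.q t) + ind (a.q t) * ind (b.w l l ∧ b.q t)) -
          ind (a.w l l ∧ a.q t) * ind (b.w l l ∧ b.q t) := by
        intro a b
        have : ¬ (r ≤ l) := by omega
        unfold ind
        by_cases h1 : a.q t <;> by_cases h2 : b.q t <;> by_cases h3 : a.w l l <;>
          by_cases h4 : b.w l l <;> simp [h1, h2, h3, h4, this]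
      simp only [this, mu_sub, mu_add, mu_smul, mu_mulc, hr, if_true]
      unfold Nn Gg; ring
    · have : ∀ a b : Ty, ind (a.q t ∧ b.q t ∧ (a.w l l ∨ b.w l l) ∧ (r ≤ l → a.w l l ∧ b.w l l)) =
          ind (a.w l l ∧ a.q t) * ind (b.w l l ∧ b.q t) := by
        intro a b
        have : r ≤ l := by omega
        unfold ind
        by_cases h1 : a.q t <;> by_cases h2 : b.q t <;> by_cases h3 : a.w l l <;>
          by_cases h4 : b.w l l <;> simp [h1, h2, h3, h4, this]
      simp only [this, mu_smul, mu_mulc, hr, if_false]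
      rfl

lemma wF_seed (a b : Ty) (t r : ℕ) : ¬ wF seed chk seed a b t r := by
  rw [wF_iff]; tauto

variable [DecidableEq K]

lemma YY_succ (hp : ∑ k, p k = 1) (d r t : ℕ) : YY p seed chk (d + 1) r t = ∑ k ∈ univ.erase seed,
    p k * yk (Nn p seed chk d t) (GO p seed chk d (lc chk k t) t) (lc chk k t) r := by
  unfold YY
  simp only [mu]
  rw [← Finset.add_sum_erase _ _ (mem_univ seed)]
  have : mu p seed chk d (fun a => mu p seed chk d (fun b => ind ((comp seed chk seed a b).w t r))) = 0 := by
    have : ∀ a b, ind ((comp seed chk seed a b).w t r) = 0 := fun a b => ind_false (wF_seed seed chk a b t r)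
    simp only [this, mu_zero]
  rw [this, mul_zero, zero_add]
  refine Finset.sum_congr rfl fun k hk => ?_
  rw [← yk_eq p seed chk hp d k (Finset.mem_erase.1 hk).1]
  rfl

/-! decomposition of the event of not being fired -/

lemma bt_event (k : K) (hk : k ≠ seed) (a b : Ty) (r t : ℕ) (hr : r + 1 ≤ t) :
    ind (btF seed chk k a b (r + 1) ∧ (a.w t (r + 1) ∨ b.w t (r + 1))) =
      (ind (a.q r) - ind (a.q (r + 1))) * ind (b.w t (r + 1)) +
      ind (a.w t (r + 1)) * (ind (b.q r) - ind (b.q (r + 1))) := by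
  -- one-sided equivalence
  have fwd : ∀ a b : Ty, btF seed chk k a b (r + 1) → b.w t (r + 1) → a.q r ∧ ¬ a.q (r + 1) := by
    intro a b hb hw
    have hbr : b.w r r := b.w_diag (by omega) (by omega) hw
    have hbq : b.q (r + 1) := b.w_q r hbr
    have h1 := hb.2 r (by omega)
    refine ⟨((wF_iff seed chk k a b r r).1 h1).2.1, fun haq => hb.1 ?_⟩
    exact ⟨wF_irrel seed chk k a b r r (r+1) le_rfl (by omega) h1, haq, hbq,
      fun _ => ⟨Or.inr hbr, fun h => by omega⟩⟩
  have bwd : ∀ a b : Ty, b.w t (r + 1) → a.q r → ¬ a.q (r + 1) → btF seed chk k a b (r + 1) := by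
    intro a b hw h1 h2
    have hbr : ∀ s ≤ r, b.w s s := fun s hs => b.w_diag (by omega) (by omega) hw
    refine ⟨fun h => h2 h.2.1, fun s hs => ?_⟩
    rw [wF_iff]
    refine ⟨hk, a.q_le (by omega) h1, b.q_le (by omega) (b.w_q r (hbr r le_rfl)), fun s' hs' _ => ?_⟩
    exact ⟨Or.inr (hbr s' (by omega)), fun h => by omega⟩
  have sym : btF seed chk k a b (r + 1) ↔ btF seed chk k b a (r + 1) := by
    unfold btF
    have : ∀ s r, wF seed chk k a b s r ↔ wF seed chk k b a s r := by
      intro s r; rw [wF_iff, wF_iff]; 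
      constructor
      · rintro ⟨h1, h2, h3, h4⟩; exact ⟨h1, h3, h2, fun s hs hc => ⟨(h4 s hs hc).1.symm, fun h => ((h4 s hs hc).2 h).symm⟩⟩
      · rintro ⟨h1, h2, h3, h4⟩; exact ⟨h1, h3, h2, fun s hs hc => ⟨(h4 s hs hc).1.symm, fun h => ((h4 s hs hc).2 h).symm⟩⟩
    simp only [this]
  have qa := a.q_anti r
  have qb := b.q_anti r
  have wa : a.w t (r + 1) → a.q (r + 1) := fun h => a.w_q r (a.w_diag (by omega) (by omega) h)
  have wb : b.w t (r + 1) → b.q (r + 1) := fun h => b.w_q r (b.w_diag (by omega) (by omega) h)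
  have f1 := fwd a b
  have f2 := fwd b a
  have g1 := bwd a b
  have g2 := bwd b a
  rw [← sym] at f2 g2
  clear fwd bwd sym
  generalize btF seed chk k a b (r+1) = X at *
  generalize a.w t (r+1) = A at *
  generalize b.w t (r+1) = B at *
  generalize a.q (r+1) = C at *
  generalize b.q (r+1) = D at *
  generalize a.q r = E at *
  generalize b.q r = F at *
  unfold ind
  by_cases X <;> by_cases A <;> by_cases B <;> by_cases C <;> by_cases D <;> by_cases E <;> by_cases F <;>
    simp_all

/-- decomposition of `w s s ∧ q (t+1)` -/
lemma q_decomp (k : K) (a b : Ty) (s t : ℕ) (hs : s ≤ t) :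
    ind (wF seed chk k a b s s ∧ qF seed chk k a b (t + 1)) = ind (wF seed chk k a b t t) +
      ∑ r ∈ Ioc s t, ind (btF seed chk k a b r ∧ (a.w t r ∨ b.w t r)) := by
  have hdiag : ∀ s t, s ≤ t → wF seed chk k a b t t → wF seed chk k a b s s :=
    fun s t h hw => (comp seed chk k a b).w_diag h h hw
  have huniq : ∀ r r', btF seed chk k a b r → btF seed chk k a b r' → r = r' := by
    intro r r' h h'
    rcases lt_trichotomy r r' with h1 | h1 | h1
    · exact absurd (h'.2 r h1) h.1
    · exact h1
    · exact absurd (h.2 r' h1) h'.1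
  by_cases hw : wF seed chk k a b t t
  · rw [ind_true ⟨hdiag s t hs hw, Or.inl hw⟩, ind_true hw, Finset.sum_eq_zero, add_zero]
    intro r hr
    refine ind_false fun h => h.1.1 (hdiag r t (Finset.mem_Ioc.1 hr).2 hw)
  · rw [ind_false hw, zero_add]
    by_cases hq : wF seed chk k a b s s ∧ qF seed chk k a b (t + 1)
    · obtain ⟨h1, h2 | ⟨r, hr, hb, h3⟩⟩ := hq
      · exact absurd h2 hw
      have hsr : s < r := by
        by_contra h
        exact hb.1 (hdiag r s (by omega) h1)
      rw [ind_true ⟨h1, Or.inr ⟨r, hr, hb, h3⟩⟩]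
      rw [Finset.sum_eq_single r]
      · rw [ind_true ⟨hb, h3⟩]
      · intro r' _ hne
        exact ind_false fun h => hne (huniq _ _ h.1 hb)
      · intro h; exact absurd (Finset.mem_Ioc.2 ⟨hsr, hr⟩) h
    · rw [ind_false hq, Finset.sum_eq_zero]
      intro r hr
      rw [Finset.mem_Ioc] at hr
      exact ind_false fun h => hq ⟨h.1.2 s hr.1, Or.inr ⟨r, hr.2, h⟩⟩

/-- decomposition of `q (t+1)`, nonseed -/
lemma q_decomp0 (k : K) (hk : k ≠ seed) (a b : Ty) (t : ℕ) :
    ind (qF seed chk k a b (t + 1)) = ind (wF seed chk k a b t t) +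
      ∑ r ∈ Ioc 0 t, ind (btF seed chk k a b r ∧ (a.w t r ∨ b.w t r)) := by
  rw [← q_decomp seed chk k a b 0 t (Nat.zero_le _)]
  congr 1
  simp [wF, hk]

lemma q_seed (a b : Ty) (t : ℕ) :
    ind (qF seed chk seed a b (t + 1)) = ind (a.w t 0) + ind (b.w t 0) - ind (a.w t 0) * ind (b.w t 0) := by
  have : qF seed chk seed a b (t + 1) ↔ (a.w t 0 ∨ b.w t 0) := by
    constructor
    · rintro (h | ⟨r, hr, hb, h⟩)
      · exact absurd h (wF_seed seed chk a b t t)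
      · rcases Nat.eq_zero_or_pos r with rfl | h'
        · exact h
        · exact absurd (hb.2 0 h') (wF_seed seed chk a b 0 0)
    · intro h
      exact Or.inr ⟨0, Nat.zero_le _, ⟨wF_seed seed chk a b 0 0, fun s hs => by omega⟩, h⟩
  rw [this]
  unfold ind
  by_cases h1 : a.w t 0 <;> by_cases h2 : b.w t 0 <;> simp [h1, h2]

end mulemmas
end ZFC

namespace ZFC
open Finset
set_option linter.unusedSectionVars false
set_option linter.unusedVariables false

section recur
variable {K : Type*} [Fintype K] [DecidableEq K] (p : K → ℝ) (seed : K) (chk : ℕ → K → Prop)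

lemma nonseed_term (k : K) (hk : k ≠ seed) (d s t : ℕ) :
    mu p seed chk d (fun a => mu p seed chk d (fun b => ind (wF seed chk k a b t t) +
      ∑ r ∈ Ioc s t, ind (btF seed chk k a b r ∧ (a.w t r ∨ b.w t r)))) =
    mu p seed chk d (fun a => mu p seed chk d (fun b => ind (wF seed chk k a b t t))) +
      2 * ∑ r ∈ Ioc s t, (Nn p seed chk d (r - 1) - Nn p seed chk d r) * YY p seed chk d r t := by
  simp only [mu_add, mu_sum]
  congr 1
  rw [Finset.mul_sum]
  refine Finset.sum_congr rfl fun r hr => ?_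
  rw [Finset.mem_Ioc] at hr
  obtain ⟨r, rfl⟩ : ∃ r', r = r' + 1 := ⟨r - 1, by omega⟩
  simp only [bt_event seed chk k hk _ _ r t hr.2, Nat.add_sub_cancel]
  simp only [mu_add, mu_smul, mu_mulc, mu_sub]
  unfold Nn YY
  ring

lemma sum_seed (hp : ∑ k, p k = 1) (f : K → ℝ) (X : ℝ) :
    ∑ k, p k * (if k = seed then f k else f k + X) = ∑ k, p k * f k + (1 - p seed) * X := by
  have : ∀ k, p k * (if k = seed then f k else f k + X) = p k * f k + p k * X - (if k = seed then p k * X else 0) := by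
    intro k; split_ifs <;> ring
  simp only [this, Finset.sum_sub_distrib, Finset.sum_add_distrib, ← Finset.sum_mul, hp]
  simp
  ring

lemma Gg_succ (hp : ∑ k, p k = 1) (d s t : ℕ) (hs : s ≤ t) :
    Gg p seed chk (d + 1) s (t + 1) = YY p seed chk (d + 1) t t +
      2 * (1 - p seed) * ∑ r ∈ Ioc s t, (Nn p seed chk d (r - 1) - Nn p seed chk d r) * YY p seed chk d r t := by
  have key : ∀ k, mu p seed chk d (fun a => mu p seed chk d (fun b =>
      ind ((comp seed chk k a b).w s s ∧ (comp seed chk k a b).q (t + 1)))) =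
      if k = seed then mu p seed chk d (fun a => mu p seed chk d (fun b => ind ((comp seed chk k a b).w t t))) else
      mu p seed chk d (fun a => mu p seed chk d (fun b => ind ((comp seed chk k a b).w t t))) +
      2 * ∑ r ∈ Ioc s t, (Nn p seed chk d (r - 1) - Nn p seed chk d r) * YY p seed chk d r t := by
    intro k
    split_ifs with hk
    · subst hk
      have h1 : ∀ a b, ind ((comp k chk k a b).w s s ∧ (comp k chk k a b).q (t + 1)) = 0 :=
        fun a b => ind_false fun h => wF_seed k chk a b s s h.1
      have h2 : ∀ a b, ind ((comp k chk k a b).w t t) = 0 := fun a b => ind_false (wF_seed k chk a b t t)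
      simp only [h1, h2]
    · refine Eq.trans ?_ (nonseed_term p seed chk k hk d s t)
      congr 1; funext a; congr 1; funext b
      exact q_decomp seed chk k a b s t hs
  unfold Gg
  simp only [mu]
  simp only [key]
  rw [sum_seed p seed hp]
  simp only [YY, mu]
  ring

lemma Nn_succ (hp : ∑ k, p k = 1) (d t : ℕ) :
    Nn p seed chk (d + 1) (t + 1) = YY p seed chk (d + 1) t t +
      2 * (1 - p seed) * ∑ r ∈ Ioc 0 t, (Nn p seed chk d (r - 1) - Nn p seed chk d r) * YY p seed chk d r t +
      p seed * (2 * YY p seed chk d 0 t - YY p seed chk d 0 t * YY p seed chk d 0 t) := by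
  have key : ∀ k, mu p seed chk d (fun a => mu p seed chk d (fun b =>
      ind ((comp seed chk k a b).q (t + 1)))) =
      (if k = seed then mu p seed chk d (fun a => mu p seed chk d (fun b => ind ((comp seed chk k a b).w t t))) else
      mu p seed chk d (fun a => mu p seed chk d (fun b => ind ((comp seed chk k a b).w t t))) +
      2 * ∑ r ∈ Ioc 0 t, (Nn p seed chk d (r - 1) - Nn p seed chk d r) * YY p seed chk d r t) +
      (if k = seed then (2 * YY p seed chk d 0 t - YY p seed chk d 0 t * YY p seed chk d 0 t) else 0) := by
    intro k
    split_ifs with hk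
    · subst hk
      have h1 : ∀ a b, ind ((comp k chk k a b).q (t + 1)) = ind (a.w t 0) + ind (b.w t 0) - ind (a.w t 0) * ind (b.w t 0) :=
        fun a b => q_seed k chk a b t
      have h2 : ∀ a b, ind ((comp k chk k a b).w t t) = 0 := fun a b => ind_false (wF_seed k chk a b t t)
      simp only [h1, h2, mu_sub, mu_add, mu_smul, mu_mulc, mu_const p k chk hp]
      unfold YY; ring
    · rw [add_zero]
      refine Eq.trans ?_ (nonseed_term p seed chk k hk d 0 t)
      congr 1; funext a; congr 1; funext b
      exact q_decomp0 seed chk k hk a b t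
  have e1 : Nn p seed chk (d + 1) (t + 1) = ∑ k, p k * mu p seed chk d (fun a => mu p seed chk d (fun b =>
      ind ((comp seed chk k a b).q (t + 1)))) := rfl
  have e2 : YY p seed chk (d + 1) t t = ∑ k, p k * mu p seed chk d (fun a => mu p seed chk d (fun b =>
      ind ((comp seed chk k a b).w t t))) := rfl
  rw [e1, e2]
  simp only [key, mul_add, Finset.sum_add_distrib]
  have := sum_seed p seed hp (fun k => mu p seed chk d (fun a => mu p seed chk d (fun b => ind ((comp seed chk k a b).w t t))))
    (2 * ∑ r ∈ Ioc 0 t, (Nn p seed chk d (r - 1) - Nn p seed chk d r) * YY p seed chk d r t)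
  rw [this]
  simp only [mul_ite, mul_zero, Finset.sum_ite_eq', Finset.mem_univ, if_true]
  ring

lemma Nn_anti (h0 : ∀ k, 0 ≤ p k) (d : ℕ) : Antitone (Nn p seed chk d) :=
  antitone_nat_of_succ_le fun t => mu_mono p seed chk h0 d _ _ fun a => ind_mono (a.q_anti t)

lemma Nn_zero (hp : ∑ k, p k = 1) (d : ℕ) : Nn p seed chk d 0 = 1 := by
  unfold Nn
  have : ∀ a : Ty, ind (a.q 0) = 1 := fun a => ind_true a.q_zero
  simp only [this]
  exact mu_const p seed chk hp d 1

lemma telescope (N : ℕ → ℝ) (hN : Antitone N) (A B : ℝ) (l s t : ℕ) (hl : l ≤ t) (hs : s ≤ t) :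
    ∑ r ∈ Ioc s t, (N (r - 1) - N r) * (if l < r then A else B) =
      A * (min (N s) (N l) - N t) + B * (N s - min (N s) (N l)) := by
  have tel : ∀ (C : ℝ) (s t : ℕ), s ≤ t → ∑ r ∈ Ioc s t, (N (r - 1) - N r) * C = C * (N s - N t) := by
    intro C s t hst
    induction t, hst using Nat.le_induction with
    | base => simp
    | succ t hst ih =>
      rw [Finset.sum_Ioc_succ_top (by omega), ih]
      simp only [Nat.add_sub_cancel]; ring
  rcases le_total l s with h | h
  · rw [min_eq_left (hN h)]
    rw [Finset.sum_congr rfl (g := fun r => (N (r - 1) - N r) * A), tel _ _ _ hs]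
    · ring
    · intro r hr
      rw [Finset.mem_Ioc] at hr
      rw [if_pos (by omega)]
  · rw [min_eq_right (hN h)]
    rw [← Finset.sum_Ioc_consecutive _ h hl]
    rw [Finset.sum_congr rfl (g := fun r => (N (r - 1) - N r) * B), tel _ _ _ h,
      Finset.sum_congr rfl (g := fun r => (N (r - 1) - N r) * A), tel _ _ _ hl]
    · ring
    · intro r hr
      rw [Finset.mem_Ioc] at hr
      rw [if_pos (by omega)]
    · intro r hr
      rw [Finset.mem_Ioc] at hr
      rw [if_neg (by omega)]

/-- the A coefficient -/
def cA (g N : ℝ) : ℝ := 2 * g * N - g * g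

lemma lc_le (k : K) (t : ℕ) : (lc chk k t).getD 0 ≤ t := by
  rcases h : lc chk k t with _ | l
  · simp
  · have := (lc_some chk k t l h).1
    simp only [Option.getD_some]; omega

lemma lc_lt (k : K) (t : ℕ) (ht : 0 < t) : (lc chk k t).getD 0 < t := by
  rcases h : lc chk k t with _ | l
  · simpa using ht
  · exact (lc_some chk k t l h).1

/-- `YY` on the diagonal -/
lemma YY_diag (hp : ∑ k, p k = 1) (d t : ℕ) : YY p seed chk (d + 1) t t = ∑ k ∈ univ.erase seed,
    p k * cA (GO p seed chk d (lc chk k t) t) (Nn p seed chk d t) := by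
  rw [YY_succ p seed chk hp]
  refine Finset.sum_congr rfl fun k _ => ?_
  congr 1
  unfold yk cA
  rcases Nat.eq_zero_or_pos t with rfl | ht
  · simp [lc, GO, Nn_zero p seed chk hp]; norm_num
  · rw [if_pos (lc_lt chk k t ht)]

lemma YY_zero (hp : ∑ k, p k = 1) (d t : ℕ) : YY p seed chk (d + 1) 0 t = ∑ k ∈ univ.erase seed,
    p k * (GO p seed chk d (lc chk k t) t * GO p seed chk d (lc chk k t) t) := by
  rw [YY_succ p seed chk hp]
  refine Finset.sum_congr rfl fun k _ => ?_
  congr 1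

/-- the sum term -/
lemma sum_term (hp : ∑ k, p k = 1) (h0 : ∀ k, 0 ≤ p k) (d s t : ℕ) (hs : s ≤ t) :
    ∑ r ∈ Ioc s t, (Nn p seed chk (d + 1) (r - 1) - Nn p seed chk (d + 1) r) * YY p seed chk (d + 1) r t =
    ∑ k ∈ univ.erase seed, p k * (
      cA (GO p seed chk d (lc chk k t) t) (Nn p seed chk d t) *
        (min (Nn p seed chk (d + 1) s) (Nn p seed chk (d + 1) ((lc chk k t).getD 0)) - Nn p seed chk (d + 1) t) +
      (GO p seed chk d (lc chk k t) t * GO p seed chk d (lc chk k t) t) *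
        (Nn p seed chk (d + 1) s - min (Nn p seed chk (d + 1) s) (Nn p seed chk (d + 1) ((lc chk k t).getD 0)))) := by
  simp only [YY_succ p seed chk hp, Finset.mul_sum]
  rw [Finset.sum_comm]
  refine Finset.sum_congr rfl fun k _ => ?_
  rw [← telescope _ (Nn_anti p seed chk h0 (d + 1)) _ _ _ s t (lc_le chk k t) hs, Finset.mul_sum]
  refine Finset.sum_congr rfl fun r _ => ?_
  unfold yk cA
  ring

/-! root -/

/-- triple expectation -/
noncomputable def mu3 (d : ℕ) (f : Ty → Ty → Ty → ℝ) : ℝ :=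
  mu p seed chk d (fun a => mu p seed chk d (fun b => mu p seed chk d (fun c => f a b c)))

/-- at most one black at last check -/
def OA (o : Option ℕ) (a b c : Ty) : Prop :=
  match o with
  | none => True
  | some l => AMO a b c l

/-- cubic polynomial -/
def cub (g N : ℝ) : ℝ := g * g * (3 * N - 2 * g)

lemma mu3_OA (hp : ∑ k, p k = 1) (d : ℕ) (o : Option ℕ) (t : ℕ) :
    mu3 p seed chk d (fun a b c => ind (OA o a b c ∧ Q3 a b c t)) =
      cub (GO p seed chk d o t) (Nn p seed chk d t) := by
  unfold mu3
  rcases o with _ | l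
  · have : ∀ a b c : Ty, ind (OA none a b c ∧ Q3 a b c t) = ind (a.q t) * (ind (b.q t) * ind (c.q t)) := by
      intro a b c
      unfold OA Q3
      simp only [true_and, ind_and]
    simp only [this, mu_smul, mu_mulc, GO, cub]
    unfold Nn; ring
  · have : ∀ a b c : Ty, ind (OA (some l) a b c ∧ Q3 a b c t) =
      ind (a.w l l ∧ a.q t) * ind (b.w l l ∧ b.q t) * ind (c.q t) +
      ind (a.w l l ∧ a.q t) * ind (b.q t) * ind (c.w l l ∧ c.q t) +
      ind (a.q t) * ind (b.w l l ∧ b.q t) * ind (c.w l l ∧ c.q t) -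
      2 * (ind (a.w l l ∧ a.q t) * ind (b.w l l ∧ b.q t) * ind (c.w l l ∧ c.q t)) := by
      intro a b c
      unfold OA Q3 AMO ind
      by_cases h1 : a.q t <;> by_cases h2 : b.q t <;> by_cases h3 : c.q t <;>
      by_cases h4 : a.w l l <;> by_cases h5 : b.w l l <;> by_cases h6 : c.w l l <;>
        simp [h1, h2, h3, h4, h5, h6] <;> norm_num
    simp only [this, mu_sub, mu_add, mu_smul, mu_mulc, GO, cub]
    unfold Nn Gg; ring

lemma AMO_diag (a b c : Ty) {s l : ℕ} (h : s ≤ l) (hA : AMO a b c l) : AMO a b c s := by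
  have ha : a.w l l → a.w s s := a.w_diag h h
  have hb : b.w l l → b.w s s := b.w_diag h h
  have hc : c.w l l → c.w s s := c.w_diag h h
  unfold AMO at *; tauto

lemma RW_iff (k : K) (a b c : Ty) (t : ℕ) :
    RW seed chk k a b c t ↔ k ≠ seed ∧ OA (lc chk k t) a b c ∧ Q3 a b c t := by
  induction t with
  | zero => simp [RW, lc, OA, Q3, a.q_zero, b.q_zero, c.q_zero]
  | succ t ih =>
    simp only [RW, ih]
    have hq : Q3 a b c (t + 1) → Q3 a b c t := fun h => ⟨a.q_anti _ h.1, b.q_anti _ h.2.1, c.q_anti _ h.2.2⟩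
    by_cases hc : chk t k
    · have : lc chk k (t + 1) = some t := by simp [lc, hc]
      rw [this]
      change _ ↔ k ≠ seed ∧ AMO a b c t ∧ Q3 a b c (t + 1)
      have : AMO a b c t → OA (lc chk k t) a b c := by
        intro h
        rcases h' : lc chk k t with _ | l
        · trivial
        · exact AMO_diag a b c (lc_some chk k t l h').1.le h
      constructor
      · rintro ⟨⟨h1, h2, h3⟩, h4, h5⟩; exact ⟨h1, h5 hc, h4⟩
      · rintro ⟨h1, h2, h3⟩; exact ⟨⟨h1, this h2, hq h3⟩, h3, fun _ => h2⟩
    · have : lc chk k (t + 1) = lc chk k t := by simp [lc, hc]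
      rw [this]
      tauto

lemma mu3_mono (h0 : ∀ k, 0 ≤ p k) (d : ℕ) (f g : Ty → Ty → Ty → ℝ) (h : ∀ a b c, f a b c ≤ g a b c) :
    mu3 p seed chk d f ≤ mu3 p seed chk d g :=
  mu_mono p seed chk h0 d _ _ fun a => mu_mono p seed chk h0 d _ _ fun b => mu_mono p seed chk h0 d _ _ fun c => h a b c

open Classical in
/-- cost of class `k` through time `T` -/
noncomputable def ccost (d : ℕ) (k : K) (T : ℕ) : ℝ :=
  ∑ t ∈ range T, if chk t k then
    cub (GO p seed chk d (lc chk k t) (t + 1)) (Nn p seed chk d (t + 1)) -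
    cub (Gg p seed chk d t (t + 1)) (Nn p seed chk d (t + 1)) else 0

lemma mu3_RP (hp : ∑ k, p k = 1) (h0 : ∀ k, 0 ≤ p k) (d T : ℕ) (k : K) (hk : k ≠ seed) :
    mu3 p seed chk d (fun a b c => ind (RP seed chk T k a b c)) ≤
      ccost p seed chk d k T + cub (GO p seed chk d (lc chk k T) T) (Nn p seed chk d T) := by
  classical
  have step : ∀ a b c, ind (RP seed chk T k a b c) ≤ (∑ t ∈ range T, if chk t k then
      ind (OA (lc chk k t) a b c ∧ Q3 a b c (t + 1)) - ind (OA (some t) a b c ∧ Q3 a b c (t + 1)) else 0) +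
      ind (OA (lc chk k T) a b c ∧ Q3 a b c T) := by
    intro a b c
    have hpos : ∀ t, 0 ≤ (if chk t k then
      ind (OA (lc chk k t) a b c ∧ Q3 a b c (t + 1)) - ind (OA (some t) a b c ∧ Q3 a b c (t + 1)) else 0) := by
      intro t
      split_ifs with hc
      · refine sub_nonneg.2 (ind_mono fun h => ⟨?_, h.2⟩)
        rcases h' : lc chk k t with _ | l
        · trivial
        · exact AMO_diag a b c (lc_some chk k t l h').1.le h.1
      · exact le_rfl
    have hsum := Finset.sum_nonneg (s := range T) fun t _ => hpos t
    by_cases h : RP seed chk T k a b c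
    · rw [ind_true h]
      rcases h with h | ⟨t, ht, h1, h2, h3, h4⟩ | h
      · exact absurd h hk
      · have := Finset.single_le_sum (s := range T) (fun t _ => hpos t) (Finset.mem_range.2 ht)
        have e : (if chk t k then ind (OA (lc chk k t) a b c ∧ Q3 a b c (t + 1)) -
            ind (OA (some t) a b c ∧ Q3 a b c (t + 1)) else 0) = 1 := by
          rw [if_pos h3, ind_true ⟨((RW_iff seed chk k a b c t).1 h1).2.1, h2⟩, ind_false fun h => h4 h.1, sub_zero]
        rw [e] at this
        have := ind_nonneg (OA (lc chk k T) a b c ∧ Q3 a b c T)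
        linarith
      · rw [ind_true ((RW_iff seed chk k a b c T).1 h).2]
        linarith
    · rw [ind_false h]
      have := ind_nonneg (OA (lc chk k T) a b c ∧ Q3 a b c T)
      linarith
  refine (mu3_mono p seed chk h0 d _ _ step).trans (le_of_eq ?_)
  rw [← mu3_OA p seed chk hp d (lc chk k T) T]
  have hterm : ∀ t, (if chk t k then
    cub (GO p seed chk d (lc chk k t) (t + 1)) (Nn p seed chk d (t + 1)) -
    cub (Gg p seed chk d t (t + 1)) (Nn p seed chk d (t + 1)) else 0) =
    mu3 p seed chk d (fun a b c => if chk t k then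
      ind (OA (lc chk k t) a b c ∧ Q3 a b c (t + 1)) - ind (OA (some t) a b c ∧ Q3 a b c (t + 1)) else 0) := by
    intro t
    split_ifs with hc
    · rw [← mu3_OA p seed chk hp d (lc chk k t) (t + 1)]
      have := mu3_OA p seed chk hp d (some t) (t + 1)
      simp only [GO] at this
      rw [← this]
      simp only [mu3, mu_sub]
    · simp only [mu3, mu_zero]
  unfold ccost
  simp only [hterm]
  simp only [mu3, mu_sum, mu_add]

end recur
end ZFC

namespace ZFC
open Finset
set_option linter.unusedSectionVars false
set_option linter.unusedVariables false

/-- fixed point scale -/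
def SC : ℕ := 2 ^ 600
lemma SC_pos : 0 < (SC : ℝ) := by unfold SC; positivity

attribute [irreducible] SC

/-- fixed point interval of nonnegative reals -/
structure Iv where
  lo : ℕ
  hi : ℕ

/-- membership -/
def Iv.In (x : ℝ) (X : Iv) : Prop := (X.lo : ℝ) ≤ x * SC ∧ x * SC ≤ X.hi

namespace Iv
def add (X Y : Iv) : Iv := ⟨X.lo + Y.lo, X.hi + Y.hi⟩
def sub (X Y : Iv) : Iv := ⟨X.lo - Y.hi, X.hi - Y.lo⟩
def mul (X Y : Iv) : Iv := ⟨X.lo * Y.lo / SC, X.hi * Y.hi / SC + 1⟩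
def mn (X Y : Iv) : Iv := ⟨Nat.min X.lo Y.lo, Nat.min X.hi Y.hi⟩
def sc (c : ℕ) (X : Iv) : Iv := ⟨c * X.lo, c * X.hi⟩
def dv (X : Iv) (c : ℕ) : Iv := ⟨X.lo / c, X.hi / c + 1⟩
def one : Iv := ⟨SC, SC⟩

lemma In_one : In 1 one := by
  show (SC : ℝ) ≤ 1 * SC ∧ 1 * SC ≤ (SC : ℝ)
  rw [one_mul]; exact ⟨le_rfl, le_rfl⟩

lemma In_add {x y : ℝ} {X Y : Iv} (hx : In x X) (hy : In y Y) : In (x + y) (add X Y) := by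
  unfold In add at *
  push_cast
  constructor <;> nlinarith [hx.1, hx.2, hy.1, hy.2]

lemma In_sub {x y : ℝ} {X Y : Iv} (hx : In x X) (hy : In y Y) (h : y ≤ x) : In (x - y) (sub X Y) := by
  unfold In sub at *
  have h1 : 0 ≤ (x - y) * SC := mul_nonneg (by linarith) SC_pos.le
  have h2 : (Y.lo : ℝ) ≤ X.hi := by nlinarith [hx.2, hy.1]
  have h3 : Y.lo ≤ X.hi := by exact_mod_cast h2
  constructor
  · rcases le_total Y.hi X.lo with h4 | h4
    · simp only
      rw [Nat.cast_sub h4]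
      nlinarith [hx.1, hy.2]
    · simp only
      rw [Nat.sub_eq_zero_of_le h4, Nat.cast_zero]
      exact h1
  · simp only
    rw [Nat.cast_sub h3]
    nlinarith [hx.2, hy.1]

lemma In.nonneg {x : ℝ} {X : Iv} (hx : In x X) : 0 ≤ x := by
  have h1 : (0:ℝ) ≤ X.lo := Nat.cast_nonneg _
  have := h1.trans hx.1
  exact nonneg_of_mul_nonneg_left this SC_pos

lemma In_mul {x y : ℝ} {X Y : Iv} (hx : In x X) (hy : In y Y) : In (x * y) (mul X Y) := by
  have x0 := hx.nonneg
  have y0 := hy.nonneg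
  have hS := SC_pos
  unfold In mul at *
  constructor
  · simp only
    refine Nat.cast_div_le.trans ?_
    rw [div_le_iff₀ hS]
    push_cast
    calc (X.lo : ℝ) * Y.lo ≤ (x * SC) * (y * SC) :=
          mul_le_mul hx.1 hy.1 (Nat.cast_nonneg _) (mul_nonneg x0 hS.le)
      _ = _ := by ring
  · simp only
    have h1 : X.hi * Y.hi < (X.hi * Y.hi / SC + 1) * SC := by
      have : 0 < SC := by exact_mod_cast hS
      rw [mul_comm _ SC]
      exact Nat.lt_mul_div_succ _ this
    have h2 : ((X.hi * Y.hi : ℕ) : ℝ) ≤ ((X.hi * Y.hi / SC + 1 : ℕ) : ℝ) * SC := by exact_mod_cast h1.le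
    have h3 : (x * SC) * (y * SC) ≤ (X.hi : ℝ) * Y.hi :=
      mul_le_mul hx.2 hy.2 (mul_nonneg y0 hS.le) (Nat.cast_nonneg _)
    push_cast at h2
    have h4 : (x * y * SC) * SC ≤ ((X.hi * Y.hi / SC + 1 : ℕ) : ℝ) * SC := by
      push_cast
      calc (x * y * SC) * SC = (x * SC) * (y * SC) := by ring
        _ ≤ _ := h3.trans h2
    exact le_of_mul_le_mul_right h4 hS

lemma In_mn {x y : ℝ} {X Y : Iv} (hx : In x X) (hy : In y Y) : In (min x y) (mn X Y) := by
  have hS := SC_pos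
  unfold In mn at *
  simp only
  rw [min_mul_of_nonneg _ _ hS.le]
  have e1 : ((Nat.min X.lo Y.lo : ℕ) : ℝ) = min (X.lo : ℝ) Y.lo := Nat.cast_min _ _
  have e2 : ((Nat.min X.hi Y.hi : ℕ) : ℝ) = min (X.hi : ℝ) Y.hi := Nat.cast_min _ _
  rw [e1, e2]
  exact ⟨min_le_min hx.1 hy.1, min_le_min hx.2 hy.2⟩

lemma In_sc (c : ℕ) {x : ℝ} {X : Iv} (hx : In x X) : In (c * x) (sc c X) := by
  unfold In sc at *
  push_cast
  have hc : (0:ℝ) ≤ c := Nat.cast_nonneg _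
  constructor
  · nlinarith [mul_le_mul_of_nonneg_left hx.1 hc]
  · nlinarith [mul_le_mul_of_nonneg_left hx.2 hc]

lemma In_dv (c : ℕ) (hc : 0 < c) {x : ℝ} {X : Iv} (hx : In x X) : In (x / c) (dv X c) := by
  unfold In dv at *
  have hc' : (0:ℝ) < c := by exact_mod_cast hc
  constructor
  · simp only
    refine Nat.cast_div_le.trans ?_
    rw [div_mul_eq_mul_div]
    exact div_le_div_of_nonneg_right hx.1 hc'.le
  · simp only
    have h1 : X.hi < (X.hi / c + 1) * c := by
      rw [mul_comm _ c]
      exact Nat.lt_mul_div_succ _ hc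
    have h2 : (X.hi : ℝ) ≤ ((X.hi / c + 1 : ℕ) : ℝ) * c := by exact_mod_cast h1.le
    rw [div_mul_eq_mul_div, div_le_iff₀ hc']
    exact hx.2.trans h2

end Iv

/-- forced evaluation -/
def force {α : Type} (n : ℕ) (f : ℕ → α) : α := Nat.rec (f 0) (fun m _ => f (m + 1)) n
lemma force_eq {α : Type} (n : ℕ) (f : ℕ → α) : force n f = f n := by cases n <;> rfl
def forceI {α : Type} (X : Iv) (f : Iv → α) : α := force X.lo fun l => force X.hi fun h => f ⟨l, h⟩
lemma forceI_eq {α : Type} (X : Iv) (f : Iv → α) : forceI X f = f X := by simp only [forceI, force_eq]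
def forceB {α : Type} (b : Bool) (f : Bool → α) : α := Bool.rec (f false) (f true) b
lemma forceB_eq {α : Type} (b : Bool) (f : Bool → α) : forceB b f = f b := by cases b <;> rfl

/-- class state -/
structure Cl where
  g : Iv
  M : Iv
  fl : Bool

/-- state -/
structure St where
  N : Iv
  c0 : Cl
  c1 : Cl
  c2 : Cl
  c3 : Cl
  cp : ℕ
  cm : ℕ

def forceC {α : Type} (c : Cl) (f : Cl → α) : α :=
  forceI c.g fun g => forceI c.M fun M => forceB c.fl fun b => f ⟨g, M, b⟩
lemma forceC_eq {α : Type} (c : Cl) (f : Cl → α) : forceC c f = f c := by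
  simp only [forceC, forceI_eq, forceB_eq]
def forceS {α : Type} (s : St) (f : St → α) : α :=
  forceI s.N fun N => forceC s.c0 fun c0 => forceC s.c1 fun c1 => forceC s.c2 fun c2 => forceC s.c3 fun c3 =>
  force s.cp fun cp => force s.cm fun cm => f ⟨N, c0, c1, c2, c3, cp, cm⟩
lemma forceS_eq {α : Type} (s : St) (f : St → α) : forceS s f = f s := by
  simp only [forceS, forceI_eq, forceC_eq, force_eq]

open Iv in
/-- weighted sum -/
def wsum (X0 X1 X2 X3 : Iv) : Iv := add (add (add (sc 35 X0) (sc 58 X1)) (sc 62 X2)) (sc 31 X3)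

open Iv in
def ivA (g N : Iv) : Iv := mul g (sub (sc 2 N) g)

open Iv in
def ivT (m N A B M : Iv) : Iv := add (mul A (sub (mn m M) N)) (mul B (sub m (mn m M)))

open Iv in
def ivcub (g N : Iv) : Iv := mul (mul g g) (sub (sc 3 N) (sc 2 g))

open Iv in
/-- the general recursion value -/
def ivG (a m N A0 A1 A2 A3 B0 B1 B2 B3 M0 M1 M2 M3 : Iv) : Iv :=
  add a (dv (sc 93 (wsum (ivT m N A0 B0 M0) (ivT m N A1 B1 M1) (ivT m N A2 B2 M2) (ivT m N A3 B3 M3))) 10000)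

/-- update of one class: not checked -/
def updN (c : Cl) (N2 G : Iv) : Cl := ⟨Bool.rec G N2 c.fl, c.M, c.fl⟩

/-- new state after the check of class `k` -/
def doChk (k : ℕ) (N a : Iv) (s : St) : St :=
  match k with
  | 0 => { s with c0 := ⟨a, N, false⟩, cp := s.cp + 35 * (ivcub s.c0.g s.N).hi, cm := s.cm + 35 * (ivcub a s.N).lo }
  | 1 => { s with c1 := ⟨a, N, false⟩, cp := s.cp + 58 * (ivcub s.c1.g s.N).hi, cm := s.cm + 58 * (ivcub a s.N).lo }
  | 2 => { s with c2 := ⟨a, N, false⟩, cp := s.cp + 62 * (ivcub s.c2.g s.N).hi, cm := s.cm + 62 * (ivcub a s.N).lo }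
  | 3 => { s with c3 := ⟨a, N, false⟩, cp := s.cp + 31 * (ivcub s.c3.g s.N).hi, cm := s.cm + 31 * (ivcub a s.N).lo }
  | _ => s

open Iv in
/-- one step -/
def stepS (k : ℕ) (s : St) : St :=
  forceI (ivA s.c0.g s.N) fun A0 => forceI (ivA s.c1.g s.N) fun A1 =>
  forceI (ivA s.c2.g s.N) fun A2 => forceI (ivA s.c3.g s.N) fun A3 =>
  forceI (mul s.c0.g s.c0.g) fun B0 => forceI (mul s.c1.g s.c1.g) fun B1 =>
  forceI (mul s.c2.g s.c2.g) fun B2 => forceI (mul s.c3.g s.c3.g) fun B3 =>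
  forceI (dv (wsum A0 A1 A2 A3) 200) fun a =>
  forceI (dv (wsum B0 B1 B2 B3) 200) fun y =>
  forceI (add (ivG a one s.N A0 A1 A2 A3 B0 B1 B2 B3 s.c0.M s.c1.M s.c2.M s.c3.M)
    (dv (sc 7 (mul y (sub (sc 2 one) y))) 100)) fun N2 =>
  forceC (updN s.c0 N2 (ivG a s.c0.M s.N A0 A1 A2 A3 B0 B1 B2 B3 s.c0.M s.c1.M s.c2.M s.c3.M)) fun c0 =>
  forceC (updN s.c1 N2 (ivG a s.c1.M s.N A0 A1 A2 A3 B0 B1 B2 B3 s.c0.M s.c1.M s.c2.M s.c3.M)) fun c1 =>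
  forceC (updN s.c2 N2 (ivG a s.c2.M s.N A0 A1 A2 A3 B0 B1 B2 B3 s.c0.M s.c1.M s.c2.M s.c3.M)) fun c2 =>
  forceC (updN s.c3 N2 (ivG a s.c3.M s.N A0 A1 A2 A3 B0 B1 B2 B3 s.c0.M s.c1.M s.c2.M s.c3.M)) fun c3 =>
  forceS (doChk k s.N a ⟨N2, c0, c1, c2, c3, s.cp, s.cm⟩) fun s' => s'

/-- run a schedule -/
def runS (l : List ℕ) : St → (St → Bool) → Bool :=
  List.rec (fun s f => f s) (fun k _ ih s f => forceS (stepS k s) fun s' => ih s' f) l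

lemma runS_nil (s : St) (f : St → Bool) : runS [] s f = f s := rfl
lemma runS_cons (k : ℕ) (l : List ℕ) (s : St) (f : St → Bool) : runS (k :: l) s f = runS l (stepS k s) f := by
  show forceS (stepS k s) (fun s' => runS l s' f) = _
  rw [forceS_eq]

/-- the schedule of checks -/
def sched : List ℕ :=
  [1, 2, 3, 2, 2, 0, 3, 2, 3, 1, 2, 0, 3, 1, 2, 0, 2, 3, 1, 1, 0, 1, 2, 1, 1,
   2, 5, 0, 3, 3, 3, 2, 0, 1, 3, 3, 0, 1, 3, 2, 3, 3, 0, 1, 2, 5, 2, 5, 0, 3,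
   5, 1, 0, 3, 3, 2, 5, 2, 0, 1, 5, 5, 2, 3, 3, 5, 0, 0, 3, 1, 2, 1, 5, 3, 0,
   5, 5, 5, 3, 5, 0, 3, 5, 0, 0, 3, 5, 0, 5, 0, 0, 5, 3, 3, 0, 5, 0, 5, 5, 3,
   5, 0, 5, 0, 5, 5, 0, 5, 0, 5, 5, 0, 5, 5, 5, 5, 5, 0, 5, 5, 5, 5, 5, 5, 5,
   0, 5, 5, 5, 5, 5, 5, 5, 5, 5, 5, 5, 5, 5, 5, 5, 5, 5, 5, 5, 5, 5, 5, 5, 5,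
   5, 5, 5, 5, 5, 5, 5, 5, 5, 5, 5, 5, 5, 5, 5, 5, 5, 5, 5, 5, 5, 5, 5, 5, 5,
   5, 5, 5, 5, 5, 5, 5, 5, 5, 5, 5, 5, 5, 5, 5, 5, 5, 5, 5, 5, 5, 5, 5, 5, 5,
   5, 5, 5, 5, 5, 5, 5, 5, 5, 5, 5, 5, 5, 5, 5, 5, 5, 5, 5, 5, 5, 5, 5, 5, 5]

def initS : St := ⟨Iv.one, ⟨Iv.one, Iv.one, true⟩, ⟨Iv.one, Iv.one, true⟩, ⟨Iv.one, Iv.one, true⟩, ⟨Iv.one, Iv.one, true⟩, 0, 0⟩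

/-- final test: cost at most `0.1702` -/
def finS (s : St) : Bool :=
  Nat.ble ((s.cp + 35 * (ivcub s.c0.g s.N).hi + 58 * (ivcub s.c1.g s.N).hi + 62 * (ivcub s.c2.g s.N).hi +
    31 * (ivcub s.c3.g s.N).hi) * 10000 + 14 * SC * 10000) (1702 * 200 * SC + s.cm * 10000)

theorem run_ok : runS sched initS finS = true := by decide +kernel

/-- horizon -/
def TT : ℕ := 225
lemma sched_len : sched.length = TT := by decide +kernel

attribute [irreducible] sched

end ZFC

namespace ZFC
open Finset
set_option linter.unusedSectionVars false
set_option linter.unusedVariables false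
open Iv

lemma cast_In {x y : ℝ} {X : Iv} (h : In x X) (e : x = y) : In y X := e ▸ h

lemma wsum_In {x0 x1 x2 x3 : ℝ} {X0 X1 X2 X3 : Iv} (h0 : In x0 X0) (h1 : In x1 X1) (h2 : In x2 X2)
    (h3 : In x3 X3) : In (35 * x0 + 58 * x1 + 62 * x2 + 31 * x3) (wsum X0 X1 X2 X3) :=
  cast_In (In_add (In_add (In_add (In_sc 35 h0) (In_sc 58 h1)) (In_sc 62 h2)) (In_sc 31 h3)) (by push_cast; ring)

lemma ivA_In {g N : ℝ} {G M : Iv} (hg : In g G) (hN : In N M) (h : g ≤ N) : In (cA g N) (ivA G M) := by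
  have := hN.nonneg
  refine cast_In (In_mul hg (In_sub (In_sc 2 hN) hg ?_)) ?_
  · push_cast; linarith
  · unfold cA; push_cast; ring

lemma ivcub_In {g N : ℝ} {G M : Iv} (hg : In g G) (hN : In N M) (h : g ≤ N) : In (cub g N) (ivcub G M) := by
  have := hN.nonneg
  refine cast_In (In_mul (In_mul hg hg) (In_sub (In_sc 3 hN) (In_sc 2 hg) ?_)) ?_
  · push_cast; linarith
  · unfold cub; push_cast; ring

lemma ivT_In {m n a b u : ℝ} {m' N A B M : Iv} (hm : In m m') (hn : In n N) (ha : In a A) (hb : In b B)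
    (hu : In u M) (h1 : n ≤ m) (h2 : n ≤ u) :
    In (a * (min m u - n) + b * (m - min m u)) (ivT m' N A B M) :=
  In_add (In_mul ha (In_sub (In_mn hm hu) hn (le_min h1 h2))) (In_mul hb (In_sub hm (In_mn hm hu) (min_le_left _ _)))

/-- class weights -/
noncomputable def pp : Fin 5 → ℝ := ![35/200, 58/200, 62/200, 31/200, 14/200]
lemma pp_sum : ∑ k, pp k = 1 := by simp only [pp, Fin.sum_univ_five]; simp; norm_num
lemma pp_nonneg (k : Fin 5) : 0 ≤ pp k := by fin_cases k <;> simp [pp] <;> norm_num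

/-- checks -/
def ck (t : ℕ) (k : Fin 5) : Prop := sched.getD t 5 = k.val

lemma sum_erase4 (f : Fin 5 → ℝ) : ∑ k ∈ univ.erase 4, f k = f 0 + f 1 + f 2 + f 3 := by
  have := Finset.add_sum_erase univ f (mem_univ 4)
  rw [Fin.sum_univ_five] at this
  linarith

lemma sum_erase4' (f : Fin 5 → ℝ) :
    ∑ k ∈ univ.erase 4, pp k * f k = (35 * f 0 + 58 * f 1 + 62 * f 2 + 31 * f 3) / 200 := by
  rw [sum_erase4]
  simp [pp]; ring

/-- abbreviations -/
noncomputable abbrev NN (d t : ℕ) : ℝ := Nn pp 4 ck d t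
noncomputable abbrev G1 (d : ℕ) (o : Option ℕ) (t : ℕ) : ℝ := GO pp 4 ck d o t
noncomputable abbrev Y1 (d r t : ℕ) : ℝ := YY pp 4 ck d r t
noncomputable abbrev l1 (k : Fin 5) (t : ℕ) : Option ℕ := lc ck k t

lemma G1_le (d : ℕ) (o : Option ℕ) (t : ℕ) : G1 d o t ≤ NN d t := by
  rcases o with _ | l
  · exact le_rfl
  · exact mu_mono pp 4 ck pp_nonneg d _ _ fun a => ind_mono fun h => h.2

lemma Y1_le (d r t : ℕ) : Y1 d r t ≤ 1 := by
  have := mu_mono pp 4 ck pp_nonneg d (fun a => ind (a.w t r)) (fun _ => 1) fun a => ind_le_one _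
  rwa [mu_const pp 4 ck pp_sum] at this

lemma NN_anti (d : ℕ) : Antitone (NN d) := Nn_anti pp 4 ck pp_nonneg d

/-- class invariant -/
def PInv (d : ℕ) (o : Option ℕ) (u : ℕ) (c : Cl) : Prop :=
  In (G1 d o u) c.g ∧ In (NN d (o.getD 0)) c.M ∧ (c.fl = true ↔ o = none)

/-- scaled accumulated cost -/
noncomputable def C1 (d t : ℕ) : ℝ := 35 * ccost pp 4 ck d 0 t + 58 * ccost pp 4 ck d 1 t +
  62 * ccost pp 4 ck d 2 t + 31 * ccost pp 4 ck d 3 t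

/-- the invariant -/
structure SInv (d t u : ℕ) (s : St) : Prop where
  N : In (NN d u) s.N
  c0 : PInv d (l1 0 t) u s.c0
  c1 : PInv d (l1 1 t) u s.c1
  c2 : PInv d (l1 2 t) u s.c2
  c3 : PInv d (l1 3 t) u s.c3
  cost : C1 d t * SC ≤ s.cp - s.cm

/-- interval `A` list -/
def aIv (s : St) : Iv := dv (wsum (ivA s.c0.g s.N) (ivA s.c1.g s.N) (ivA s.c2.g s.N) (ivA s.c3.g s.N)) 200
def yIv (s : St) : Iv := dv (wsum (mul s.c0.g s.c0.g) (mul s.c1.g s.c1.g) (mul s.c2.g s.c2.g) (mul s.c3.g s.c3.g)) 200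
def gIv (s : St) (m : Iv) : Iv := ivG (aIv s) m s.N (ivA s.c0.g s.N) (ivA s.c1.g s.N) (ivA s.c2.g s.N) (ivA s.c3.g s.N)
  (mul s.c0.g s.c0.g) (mul s.c1.g s.c1.g) (mul s.c2.g s.c2.g) (mul s.c3.g s.c3.g) s.c0.M s.c1.M s.c2.M s.c3.M
def nIv (s : St) : Iv := add (gIv s one) (dv (sc 7 (mul (yIv s) (sub (sc 2 one) (yIv s)))) 100)

lemma stepS_eq (k : ℕ) (s : St) : stepS k s = doChk k s.N (aIv s) ⟨nIv s, updN s.c0 (nIv s) (gIv s s.c0.M),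
    updN s.c1 (nIv s) (gIv s s.c1.M), updN s.c2 (nIv s) (gIv s s.c2.M), updN s.c3 (nIv s) (gIv s s.c3.M), s.cp, s.cm⟩ := by
  simp only [stepS, forceI_eq, forceC_eq, forceS_eq]
  rfl

lemma aIv_In (d t : ℕ) (s : St) (h : SInv d t t s) : In (Y1 (d + 1) t t) (aIv s) := by
  have := YY_diag pp 4 ck pp_sum d t
  rw [sum_erase4'] at this
  rw [Y1, this]
  exact_mod_cast In_dv 200 (by norm_num) (wsum_In (ivA_In h.c0.1 h.N (G1_le _ _ _)) (ivA_In h.c1.1 h.N (G1_le _ _ _))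
    (ivA_In h.c2.1 h.N (G1_le _ _ _)) (ivA_In h.c3.1 h.N (G1_le _ _ _)))

lemma yIv_In (d t : ℕ) (s : St) (h : SInv d t t s) : In (Y1 (d + 1) 0 t) (yIv s) := by
  have := YY_zero pp 4 ck pp_sum d t
  rw [sum_erase4'] at this
  rw [Y1, this]
  exact_mod_cast In_dv 200 (by norm_num) (wsum_In (In_mul h.c0.1 h.c0.1) (In_mul h.c1.1 h.c1.1)
    (In_mul h.c2.1 h.c2.1) (In_mul h.c3.1 h.c3.1))

lemma gIv_In (d t r : ℕ) (s : St) (h : SInv d t t s) (h' : SInv (d + 1) t t s) (m : Iv) (hr : r ≤ t)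
    (hm : In (NN (d + 1) r) m) : In (Y1 (d + 2) t t + 2 * (1 - pp 4) *
      ∑ r ∈ Ioc r t, (NN (d + 1) (r - 1) - NN (d + 1) r) * Y1 (d + 1) r t) (gIv s m) := by
  have e := sum_term pp 4 ck pp_sum pp_nonneg d r t hr
  rw [sum_erase4'] at e
  rw [e]
  have a1 : NN (d + 1) t ≤ NN (d + 1) r := NN_anti _ hr
  have T : ∀ (k : Fin 5) (c : Cl), PInv d (l1 k t) t c → PInv (d + 1) (l1 k t) t c → _ := fun k c hc hc' =>
    ivT_In hm h'.N (ivA_In hc.1 h.N (G1_le _ _ _)) (In_mul hc.1 hc.1) hc'.2.1 a1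
      (NN_anti (d + 1) (lc_le ck k t))
  have := In_add (aIv_In (d + 1) t s h') (In_dv 10000 (by norm_num) (In_sc 93 (wsum_In
    (T 0 _ h.c0 h'.c0) (T 1 _ h.c1 h'.c1) (T 2 _ h.c2 h'.c2) (T 3 _ h.c3 h'.c3))))
  refine cast_In this ?_
  have : pp 4 = 14 / 200 := by simp [pp]
  rw [this]
  push_cast
  ring

lemma nIv_In (d t : ℕ) (s : St) (h : SInv d t t s) (h' : SInv (d + 1) t t s) : In (NN (d + 2) (t + 1)) (nIv s) := by
  have e := Nn_succ pp 4 ck pp_sum (d + 1) t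
  have hm : In (NN (d + 1) 0) one := cast_In In_one (Nn_zero pp 4 ck pp_sum (d + 1)).symm
  have := In_add (gIv_In d t 0 s h h' one (Nat.zero_le _) hm) (In_dv 100 (by norm_num) (In_sc 7
    (In_mul (yIv_In d t s h) (In_sub (In_sc 2 In_one) (yIv_In d t s h)
      (by have := Y1_le (d + 1) 0 t; push_cast; linarith)))))
  refine cast_In this ?_
  rw [NN, e]
  have : pp 4 = 14 / 200 := by simp [pp]
  rw [this]
  push_cast
  ring

lemma upd_In (d t : ℕ) (k : Fin 5) (s : St) (h : SInv d t t s) (h' : SInv (d + 1) t t s) (c : Cl)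
    (hc' : PInv (d + 1) (l1 k t) t c) (hc : PInv (d + 2) (l1 k t) t c) :
    PInv (d + 2) (l1 k t) (t + 1) (updN c (nIv s) (gIv s c.M)) := by
  obtain ⟨h1, h2, h3⟩ := hc
  refine ⟨?_, h2, h3⟩
  rcases ho : l1 k t with _ | l
  · have : c.fl = true := h3.2 ho
    simp only [updN, this]
    exact nIv_In d t s h h'
  · have : c.fl = false := by
      by_contra hh
      rw [Bool.not_eq_false] at hh
      have := h3.1 hh
      rw [ho] at this
      simp at this
    simp only [updN, this]
    have hl := (lc_some ck k t l ho).1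
    have e := Gg_succ pp 4 ck pp_sum (d + 1) l t hl.le
    have : G1 (d + 2) (some l) (t + 1) = Gg pp 4 ck (d + 2) l (t + 1) := rfl
    rw [this, e]
    have hM := hc'.2.1
    rw [ho] at hM
    exact gIv_In d t l s h h' c.M hl.le hM

lemma lc_chk (k : Fin 5) (t : ℕ) (h : ck t k) : l1 k (t + 1) = some t := by
  simp [l1, lc, h]
lemma lc_nchk (k : Fin 5) (t : ℕ) (h : ¬ ck t k) : l1 k (t + 1) = l1 k t := by
  simp [l1, lc, h]

open Classical in
lemma cc_succ (d : ℕ) (k : Fin 5) (t : ℕ) : ccost pp 4 ck d k (t + 1) = ccost pp 4 ck d k t +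
    if ck t k then cub (G1 d (l1 k t) (t + 1)) (NN d (t + 1)) - cub (G1 d (some t) (t + 1)) (NN d (t + 1)) else 0 := by
  unfold ccost
  rw [Finset.sum_range_succ]
  rfl

lemma step_inv (t : ℕ) (s : St) (h : ∀ d, 2 * t ≤ d → SInv d t t s) (d : ℕ) (hd : 2 * (t + 1) ≤ d) :
    SInv d (t + 1) (t + 1) (stepS (sched.getD t 5) s) := by
  obtain ⟨d, rfl⟩ : ∃ d', d = d' + 2 := ⟨d - 2, by omega⟩
  have i0 := h d (by omega)
  have i1 := h (d + 1) (by omega)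
  have i2 := h (d + 2) (by omega)
  rw [stepS_eq]
  have n := nIv_In d t s i0 i1
  have u0 := upd_In d t 0 s i0 i1 _ i1.c0 i2.c0
  have u1 := upd_In d t 1 s i0 i1 _ i1.c1 i2.c1
  have u2 := upd_In d t 2 s i0 i1 _ i1.c2 i2.c2
  have u3 := upd_In d t 3 s i0 i1 _ i1.c3 i2.c3
  have hcost := i2.cost
  have ha : In (G1 (d + 2) (some t) (t + 1)) (aIv s) := by
    have e := Gg_succ pp 4 ck pp_sum (d + 1) t t le_rfl
    rw [Finset.Ioc_self, Finset.sum_empty, mul_zero, add_zero] at e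
    exact cast_In (aIv_In (d + 1) t s i1) e.symm
  have new : PInv (d + 2) (some t) (t + 1) ⟨aIv s, s.N, false⟩ := ⟨ha, i2.N, by simp⟩
  have cb : ∀ g o, In (G1 (d + 2) o (t + 1)) g → In (cub (G1 (d + 2) o (t + 1)) (NN (d + 2) (t + 1))) (ivcub g (nIv s)) :=
    fun g o hg => ivcub_In hg n (G1_le _ _ _)
  have cba := cb _ _ ha
  generalize hw0 : updN s.c0 (nIv s) (gIv s s.c0.M) = w0 at *
  generalize hw1 : updN s.c1 (nIv s) (gIv s s.c1.M) = w1 at *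
  generalize hw2 : updN s.c2 (nIv s) (gIv s s.c2.M) = w2 at *
  generalize hw3 : updN s.c3 (nIv s) (gIv s s.c3.M) = w3 at *
  have ckdef : ∀ k : Fin 5, ck t k ↔ sched.getD t 5 = k.val := fun k => Iff.rfl
  generalize sched.getD t 5 = j at *
  have cs := cc_succ (d + 2)
  have key : ∀ k : Fin 5, (ck t k → l1 k (t + 1) = some t) ∧ (¬ ck t k → l1 k (t + 1) = l1 k t) :=
    fun k => ⟨lc_chk k t, lc_nchk k t⟩
  unfold C1 at hcost
  match j, ckdef with
  | 0, ckdef =>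
    have k0 : ck t 0 := (ckdef 0).2 rfl
    have k1 : ¬ ck t 1 := fun h => absurd ((ckdef 1).1 h) (by decide)
    have k2 : ¬ ck t 2 := fun h => absurd ((ckdef 2).1 h) (by decide)
    have k3 : ¬ ck t 3 := fun h => absurd ((ckdef 3).1 h) (by decide)
    refine ⟨n, ?_, ?_, ?_, ?_, ?_⟩
    · rw [(key 0).1 k0]; exact new
    · rw [(key 1).2 k1]; exact u1
    · rw [(key 2).2 k2]; exact u2
    · rw [(key 3).2 k3]; exact u3
    · unfold C1
      rw [cs, cs, cs, cs, if_pos k0, if_neg k1, if_neg k2, if_neg k3]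
      have := cb _ _ u0.1
      simp only [doChk]
      push_cast
      nlinarith [this.2, cba.1]
  | 1, ckdef =>
    have k0 : ¬ ck t 0 := fun h => absurd ((ckdef 0).1 h) (by decide)
    have k1 : ck t 1 := (ckdef 1).2 rfl
    have k2 : ¬ ck t 2 := fun h => absurd ((ckdef 2).1 h) (by decide)
    have k3 : ¬ ck t 3 := fun h => absurd ((ckdef 3).1 h) (by decide)
    refine ⟨n, ?_, ?_, ?_, ?_, ?_⟩
    · rw [(key 0).2 k0]; exact u0
    · rw [(key 1).1 k1]; exact new
    · rw [(key 2).2 k2]; exact u2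
    · rw [(key 3).2 k3]; exact u3
    · unfold C1
      rw [cs, cs, cs, cs, if_neg k0, if_pos k1, if_neg k2, if_neg k3]
      have := cb _ _ u1.1
      simp only [doChk]
      push_cast
      nlinarith [this.2, cba.1]
  | 2, ckdef =>
    have k0 : ¬ ck t 0 := fun h => absurd ((ckdef 0).1 h) (by decide)
    have k1 : ¬ ck t 1 := fun h => absurd ((ckdef 1).1 h) (by decide)
    have k2 : ck t 2 := (ckdef 2).2 rfl
    have k3 : ¬ ck t 3 := fun h => absurd ((ckdef 3).1 h) (by decide)
    refine ⟨n, ?_, ?_, ?_, ?_, ?_⟩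
    · rw [(key 0).2 k0]; exact u0
    · rw [(key 1).2 k1]; exact u1
    · rw [(key 2).1 k2]; exact new
    · rw [(key 3).2 k3]; exact u3
    · unfold C1
      rw [cs, cs, cs, cs, if_neg k0, if_neg k1, if_pos k2, if_neg k3]
      have := cb _ _ u2.1
      simp only [doChk]
      push_cast
      nlinarith [this.2, cba.1]
  | 3, ckdef =>
    have k0 : ¬ ck t 0 := fun h => absurd ((ckdef 0).1 h) (by decide)
    have k1 : ¬ ck t 1 := fun h => absurd ((ckdef 1).1 h) (by decide)
    have k2 : ¬ ck t 2 := fun h => absurd ((ckdef 2).1 h) (by decide)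
    have k3 : ck t 3 := (ckdef 3).2 rfl
    refine ⟨n, ?_, ?_, ?_, ?_, ?_⟩
    · rw [(key 0).2 k0]; exact u0
    · rw [(key 1).2 k1]; exact u1
    · rw [(key 2).2 k2]; exact u2
    · rw [(key 3).1 k3]; exact new
    · unfold C1
      rw [cs, cs, cs, cs, if_neg k0, if_neg k1, if_neg k2, if_pos k3]
      have := cb _ _ u3.1
      simp only [doChk]
      push_cast
      nlinarith [this.2, cba.1]
  | j + 4, ckdef =>
    have k0 : ¬ ck t 0 := fun h => by have := (ckdef 0).1 h; simp at this
    have k1 : ¬ ck t 1 := fun h => by have := (ckdef 1).1 h; simp at this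
    have k2 : ¬ ck t 2 := fun h => by have := (ckdef 2).1 h; simp at this
    have k3 : ¬ ck t 3 := fun h => by have := (ckdef 3).1 h; simp at this
    refine ⟨n, ?_, ?_, ?_, ?_, ?_⟩
    · rw [(key 0).2 k0]; exact u0
    · rw [(key 1).2 k1]; exact u1
    · rw [(key 2).2 k2]; exact u2
    · rw [(key 3).2 k3]; exact u3
    · unfold C1
      rw [cs, cs, cs, cs, if_neg k0, if_neg k1, if_neg k2, if_neg k3]
      simp only [doChk]
      nlinarith

lemma init_inv (d : ℕ) : SInv d 0 0 initS := by
  have h1 : In (NN d 0) one := cast_In In_one (Nn_zero pp 4 ck pp_sum d).symm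
  have h2 : ∀ k, PInv d (l1 k 0) 0 ⟨one, one, true⟩ := fun k => ⟨h1, h1, by simp [l1, lc]⟩
  refine ⟨h1, h2 0, h2 1, h2 2, h2 3, ?_⟩
  simp [C1, ccost, initS]


lemma run_inv (l : List ℕ) (t : ℕ) (s : St) (hl : l = sched.drop t) (ht : t ≤ sched.length)
    (h : ∀ d, 2 * t ≤ d → SInv d t t s)
    (f : St → Bool) (hf : runS l s f = true) : ∃ s', f s' = true ∧ ∀ d, 2 * sched.length ≤ d → SInv d sched.length sched.length s' := by
  induction l generalizing t s with
  | nil =>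
    have : sched.length ≤ t := by
      have := List.drop_eq_nil_iff.1 hl.symm
      exact this
    obtain rfl : t = sched.length := le_antisymm ht this
    exact ⟨s, hf, h⟩
  | cons k l ih =>
    have hlt : t < sched.length := by
      by_contra hh
      rw [List.drop_eq_nil_of_le (by omega)] at hl
      simp at hl
    rw [List.drop_eq_getElem_cons hlt] at hl
    injection hl with h1 h2
    rw [runS_cons] at hf
    refine ih (t + 1) (stepS k s) h2 hlt ?_ hf
    intro d hd
    have := step_inv t s h d hd
    rw [List.getD_eq_getElem _ _ hlt, ← h1] at this
    exact this

theorem cost_bound (d : ℕ) (hd : 2 * TT ≤ d) :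
    ∑ k, pp k * mu3 pp 4 ck d (fun a b c => ind (RP 4 ck TT k a b c)) ≤ 0.1702 := by
  obtain ⟨s, hf, hs⟩ := run_inv sched 0 initS rfl (Nat.zero_le _) (fun d _ => init_inv d) finS run_ok
  rw [sched_len] at hs
  have h := hs d hd
  clear hs
  have hS := SC_pos
  rw [← Finset.add_sum_erase _ _ (mem_univ (4 : Fin 5)), sum_erase4']
  have h4 : mu3 pp 4 ck d (fun a b c => ind (RP 4 ck TT 4 a b c)) ≤ 1 := by
    have := mu3_mono pp 4 ck pp_nonneg d (fun a b c => ind (RP 4 ck TT 4 a b c)) (fun _ _ _ => 1)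
      (fun _ _ _ => ind_le_one _)
    simpa only [mu3, mu_const pp 4 ck pp_sum] using this
  have q4 : pp 4 = 14 / 200 := by simp [pp]
  have r0 := mu3_RP pp 4 ck pp_sum pp_nonneg d TT 0 (by decide)
  have r1 := mu3_RP pp 4 ck pp_sum pp_nonneg d TT 1 (by decide)
  have r2 := mu3_RP pp 4 ck pp_sum pp_nonneg d TT 2 (by decide)
  have r3 := mu3_RP pp 4 ck pp_sum pp_nonneg d TT 3 (by decide)
  have v0 := (ivcub_In h.c0.1 h.N (G1_le _ _ _)).2
  have v1 := (ivcub_In h.c1.1 h.N (G1_le _ _ _)).2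
  have v2 := (ivcub_In h.c2.1 h.N (G1_le _ _ _)).2
  have v3 := (ivcub_In h.c3.1 h.N (G1_le _ _ _)).2
  have hc := h.cost
  unfold C1 at hc
  have hf' := Nat.le_of_ble_eq_true hf
  have hf2 : (((s.cp + 35 * (ivcub s.c0.g s.N).hi + 58 * (ivcub s.c1.g s.N).hi + 62 * (ivcub s.c2.g s.N).hi +
    31 * (ivcub s.c3.g s.N).hi) * 10000 + 14 * SC * 10000 : ℕ) : ℝ) ≤ ((1702 * 200 * SC + s.cm * 10000 : ℕ) : ℝ) := by
    exact_mod_cast hf'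
  push_cast at hf2
  rw [q4]
  simp only [G1, NN, l1] at v0 v1 v2 v3
  generalize (cub (GO pp 4 ck d (lc ck 0 TT) TT) (Nn pp 4 ck d TT)) = x0 at *
  generalize (cub (GO pp 4 ck d (lc ck 1 TT) TT) (Nn pp 4 ck d TT)) = x1 at *
  generalize (cub (GO pp 4 ck d (lc ck 2 TT) TT) (Nn pp 4 ck d TT)) = x2 at *
  generalize (cub (GO pp 4 ck d (lc ck 3 TT) TT) (Nn pp 4 ck d TT)) = x3 at *
  generalize ccost pp 4 ck d 0 TT = y0 at *
  generalize ccost pp 4 ck d 1 TT = y1 at *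
  generalize ccost pp 4 ck d 2 TT = y2 at *
  generalize ccost pp 4 ck d 3 TT = y3 at *
  have big : (14 + 35 * (y0 + x0) + 58 * (y1 + x1) + 62 * (y2 + x2) + 31 * (y3 + x3)) * SC ≤ (0.1702 * 200) * SC := by
    clear r0 r1 r2 r3 h4 hf hf' h
    generalize (SC : ℝ) = σ at *
    linarith
  have big2 := le_of_mul_le_mul_right big hS
  linarith

end ZFC

namespace ZFC
open Finset
set_option linter.unusedSectionVars false
set_option linter.unusedVariables false

section graph
variable {V : Type*}

/-- within distance `k` -/
def NB (G : SimpleGraph V) : ℕ → V → V → Prop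
  | 0, x, y => x = y
  | k + 1, x, y => x = y ∨ ∃ z, G.Adj x z ∧ NB G k z y

lemma NB_refl (G : SimpleGraph V) (k : ℕ) (x : V) : NB G k x x := by
  cases k
  · rfl
  · exact Or.inl rfl

lemma NB_succ (G : SimpleGraph V) (k : ℕ) (x y : V) (h : NB G k x y) : NB G (k + 1) x y := by
  induction k generalizing x with
  | zero => exact Or.inl h
  | succ k ih =>
    rcases h with h | ⟨z, hz, h⟩
    · exact Or.inl h
    · exact Or.inr ⟨z, hz, ih z h⟩

lemma NB_mono (G : SimpleGraph V) {k l : ℕ} (hkl : k ≤ l) (x y : V) (h : NB G k x y) : NB G l x y := by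
  induction l, hkl using Nat.le_induction with
  | base => exact h
  | succ l _ ih => exact NB_succ G l x y ih

lemma NB_trans (G : SimpleGraph V) {k l : ℕ} {x y z : V} (h : NB G k x y) (h' : NB G l y z) : NB G (k + l) x z := by
  induction k generalizing x with
  | zero => obtain rfl : x = y := h; simpa using h'
  | succ k ih =>
    rcases h with rfl | ⟨w, hw, h⟩
    · exact NB_mono G (by omega) _ _ h'
    · rw [Nat.succ_add]; exact Or.inr ⟨w, hw, ih h⟩

lemma NB_adj (G : SimpleGraph V) {x y : V} (h : G.Adj x y) : NB G 1 x y := Or.inr ⟨y, h, rfl⟩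

lemma NB_symm (G : SimpleGraph V) {k : ℕ} {x y : V} (h : NB G k x y) : NB G k y x := by
  induction k generalizing x with
  | zero => exact Eq.symm h
  | succ k ih =>
    rcases h with rfl | ⟨w, hw, h⟩
    · exact NB_refl _ _ _
    · exact NB_trans G (ih h) (NB_adj G hw.symm)

/-- isolate a vertex -/
def iso (G : SimpleGraph V) (u : V) : SimpleGraph V where
  Adj x y := G.Adj x y ∧ x ≠ u ∧ y ≠ u
  symm := ⟨fun x y h => ⟨h.1.symm, h.2.2, h.2.1⟩⟩
  loopless := ⟨fun x h => G.loopless.irrefl x h.1⟩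

lemma iso_ne (G : SimpleGraph V) (u : V) {k : ℕ} {x y : V} (hx : x ≠ u) (h : NB (iso G u) k x y) : y ≠ u := by
  induction k generalizing x with
  | zero => obtain rfl : x = y := h; exact hx
  | succ k ih =>
    rcases h with rfl | ⟨w, hw, h⟩
    · exact hx
    · exact ih hw.2.2 h

/-- short cycle through `x` and the edge `xy` -/
def SP (G : SimpleGraph V) (k : ℕ) (x y : V) : Prop := G.Adj x y ∧ ∃ z, z ≠ y ∧ G.Adj x z ∧ NB (iso G x) k z y

lemma NB_iso_of (G : SimpleGraph V) (x u : V) {d : ℕ} {y w : V} (h : NB (iso G x) d y w)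
    (hu : ¬ NB (iso G x) d y u) : NB (iso G u) d y w := by
  induction d generalizing y with
  | zero => exact h
  | succ d ih =>
    rcases h with h | ⟨y', hy, h⟩
    · exact Or.inl h
    · have h1 : ¬ NB (iso G x) d y' u := fun h' => hu (Or.inr ⟨y', hy, h'⟩)
      refine Or.inr ⟨y', ⟨hy.1, fun e => hu (e ▸ NB_refl _ _ _), fun e => h1 (e ▸ NB_refl _ _ _)⟩, ih h h1⟩

variable {G : SimpleGraph V} {kd : V → V → V × V}

lemma kid_adj (hk : IsKids G kd) {x u : V} (h : G.Adj x u) : G.Adj x (kd x u).1 ∧ G.Adj x (kd x u).2 :=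
  ⟨((hk x u h).2.2.2 _).2 (Or.inr (Or.inl rfl)), ((hk x u h).2.2.2 _).2 (Or.inr (Or.inr rfl))⟩

lemma dset_NB (hk : IsKids G kd) (k d : ℕ) (hd : d ≤ k) (x u : V) (hxu : G.Adj x u)
    (hno : ∀ y, NB G d x y → ∀ z, ¬ SP G k y z) (w : V) (hw : w ∈ dset kd d x u) : NB (iso G u) d x w := by
  induction d generalizing x u with
  | zero => exact absurd hw (Set.notMem_empty _)
  | succ d ih =>
    obtain ⟨k1, k2⟩ := kid_adj hk hxu
    obtain ⟨a1, a2, a3, _⟩ := hk x u hxu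
    have main : ∀ y, G.Adj x y → y ≠ u → w ∈ dset kd d y x → NB (iso G u) (d + 1) x w := by
      intro y hy hyu hwy
      have h1 := ih (by omega) y x hy.symm (fun y' hy' => hno y' (Or.inr ⟨y, hy, hy'⟩)) hwy
      have h2 : ¬ NB (iso G x) d y u := fun h => hno x (NB_refl _ _ _) u ⟨hxu, y, hyu, hy, NB_mono _ (by omega) _ _ h⟩
      exact Or.inr ⟨y, ⟨hy, hxu.ne, hyu⟩, NB_iso_of G x u h1 h2⟩
    rcases hw with hw | hw | hw
    · obtain rfl : w = x := hw
      exact NB_refl _ _ _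
    · exact main _ k1 a2 hw
    · exact main _ k2 a3 hw

lemma dset_notMem (hk : IsKids G kd) (k d : ℕ) (hd : d ≤ k) (x u : V) (hxu : G.Adj x u)
    (hno : ∀ y, NB G d x y → ∀ z, ¬ SP G k y z) : u ∉ dset kd d x u := fun h =>
  iso_ne G u hxu.ne (dset_NB hk k d hd x u hxu hno u h) rfl

lemma dset_disj (hk : IsKids G kd) (k d : ℕ) (hd : 2 * d ≤ k) (x y z : V) (hy : G.Adj x y) (hz : G.Adj x z) (hyz : y ≠ z)
    (hno : ∀ w, NB G (d + 1) x w → ∀ z, ¬ SP G k w z) : Disjoint (dset kd d y x) (dset kd d z x) := by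
  rw [Set.disjoint_left]
  intro w h1 h2
  have n1 := dset_NB hk k d (by omega) y x hy.symm (fun y' hy' => hno y' (Or.inr ⟨y, hy, hy'⟩)) w h1
  have n2 := dset_NB hk k d (by omega) z x hz.symm (fun y' hy' => hno y' (Or.inr ⟨z, hz, hy'⟩)) w h2
  exact hno x (NB_refl _ _ _) z ⟨hz, y, hyz, hy, NB_mono _ (by omega) _ _ (NB_trans _ n1 (NB_symm _ n2))⟩

lemma good_of (hk : IsKids G kd) (k d : ℕ) (hd : 2 * d ≤ k) (x u : V) (hxu : G.Adj x u)
    (hno : ∀ y, NB G d x y → ∀ z, ¬ SP G k y z) : Good kd d x u := by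
  induction d generalizing x u with
  | zero => trivial
  | succ d ih =>
    obtain ⟨k1, k2⟩ := kid_adj hk hxu
    obtain ⟨a1, a2, a3, _⟩ := hk x u hxu
    have n1 : ∀ y', NB G d (kd x u).1 y' → ∀ z, ¬ SP G k y' z := fun y' hy' => hno y' (Or.inr ⟨_, k1, hy'⟩)
    have n2 : ∀ y', NB G d (kd x u).2 y' → ∀ z, ¬ SP G k y' z := fun y' hy' => hno y' (Or.inr ⟨_, k2, hy'⟩)
    exact ⟨ih (by omega) _ _ k1.symm n1, ih (by omega) _ _ k2.symm n2,
      dset_notMem hk k d (by omega) _ _ k1.symm n1, dset_notMem hk k d (by omega) _ _ k2.symm n2,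
      dset_disj hk k d (by omega) x _ _ k1 k2 a1 hno⟩

/-- cubic -/
def Cub (G : SimpleGraph V) : Prop := ∀ v, ∃ x y z, x ≠ y ∧ x ≠ z ∧ y ≠ z ∧ ∀ c, G.Adj v c ↔ (c = x ∨ c = y ∨ c = z)

lemma exists_kids (hG : Cub G) : ∃ kd, IsKids G kd := by
  have : ∀ x u, ∃ q : V × V, G.Adj x u → q.1 ≠ q.2 ∧ q.1 ≠ u ∧ q.2 ≠ u ∧
      ∀ z, G.Adj x z ↔ (z = u ∨ z = q.1 ∨ z = q.2) := by
    intro x u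
    by_cases hxu : G.Adj x u
    · obtain ⟨a, b, c, h1, h2, h3, h⟩ := hG x
      rcases (h u).1 hxu with rfl | rfl | rfl
      · exact ⟨(b, c), fun _ => ⟨h3, h1.symm, h2.symm, h⟩⟩
      · exact ⟨(a, c), fun _ => ⟨h2, h1, h3.symm, fun z => by rw [h]; tauto⟩⟩
      · exact ⟨(a, b), fun _ => ⟨h1, h2, h3, fun z => by rw [h]; tauto⟩⟩
    · exact ⟨(x, x), fun h => absurd h hxu⟩
  choose kd hkd using this
  exact ⟨kd, hkd⟩

variable [Fintype V] [DecidableEq V]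

/-- depth and cycle-length constants -/
def DD : ℕ := 2 * TT + 2
def KK : ℕ := 2 * DD

/-- bad vertices -/
def BadV (G : SimpleGraph V) (v : V) : Prop := ∃ y z, NB G (DD + 1) v y ∧ SP G KK y z

open Classical in
theorem det_bound (hG : Cub G) : (zeroForcingNumber G : ℝ) ≤ 0.1702 * Fintype.card V +
    (univ.filter (BadV G)).card := by
  obtain ⟨kd, hk⟩ := exists_kids hG
  have h1 : ∀ L : V → Fin 5, (zeroForcingNumber G : ℝ) ≤ ∑ v, ind (Paid G 4 ck TT L v) := by
    intro L
    have := zf_le_card G (univ.filter (Paid G 4 ck TT L)) (zf_paid G 4 ck TT L _ (fun v hv => by simpa using hv))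
    have e : ((univ.filter (Paid G 4 ck TT L)).card : ℝ) = ∑ v, ind (Paid G 4 ck TT L v) := by
      rw [Finset.card_filter]; push_cast
      exact Finset.sum_congr rfl fun v _ => by simp [ind]
    rw [← e]; exact_mod_cast this
  have h2 := EL_mono (V := V) pp pp_nonneg _ _ h1
  rw [EL_const pp pp_sum, EL_sum] at h2
  refine h2.trans ?_
  have h3 : ∀ v, EL pp (fun L : V → Fin 5 => ind (Paid G 4 ck TT L v)) ≤ 0.1702 + if BadV G v then 1 else 0 := by
    intro v
    by_cases hb : BadV G v
    · have := EL_mono (V := V) pp pp_nonneg (fun L : V → Fin 5 => ind (Paid G 4 ck TT L v)) (fun _ => 1) fun _ => ind_le_one _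
      rw [EL_const pp pp_sum] at this
      rw [if_pos hb]
      linarith
    · rw [if_neg hb, add_zero]
      have hno : ∀ y, NB G (DD + 1) v y → ∀ z, ¬ SP G KK y z := fun y hy z hz => hb ⟨y, z, hy, hz⟩
      obtain ⟨x, y, z, hxy, hxz, hyz, hadj⟩ := hG v
      have ax : G.Adj v x := (hadj _).2 (by simp)
      have ay : G.Adj v y := (hadj _).2 (by simp)
      have az : G.Adj v z := (hadj _).2 (by simp)
      have nx : ∀ y', NB G DD x y' → ∀ z, ¬ SP G KK y' z := fun y' hy' => hno y' (Or.inr ⟨_, ax, hy'⟩)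
      have ny : ∀ y', NB G DD y y' → ∀ z, ¬ SP G KK y' z := fun y' hy' => hno y' (Or.inr ⟨_, ay, hy'⟩)
      have nz : ∀ y', NB G DD z y' → ∀ z, ¬ SP G KK y' z := fun y' hy' => hno y' (Or.inr ⟨_, az, hy'⟩)
      have hD : DD ≤ KK := by unfold KK; omega
      have hK : 2 * DD ≤ KK := le_rfl
      have key := EL_root pp 4 ck kd pp_sum DD v x y z (good_of hk _ _ hK x v ax.symm nx)
        (good_of hk _ _ hK y v ay.symm ny) (good_of hk _ _ hK z v az.symm nz)
        (dset_notMem hk _ _ hD x v ax.symm nx) (dset_notMem hk _ _ hD y v ay.symm ny) (dset_notMem hk _ _ hD z v az.symm nz)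
        (dset_disj hk _ _ hK v x y ax ay hxy hno) (dset_disj hk _ _ hK v x z ax az hxz hno)
        (dset_disj hk _ _ hK v y z ay az hyz hno) (fun k a b c => ind (RP 4 ck TT k a b c))
      refine (EL_mono (V := V) pp pp_nonneg _ _ fun L => ind_mono
        (root_paid 4 ck L hk v x y z hxy hxz hyz hadj DD TT le_rfl)).trans ?_
      rw [key]
      exact cost_bound DD (by unfold DD; omega)
  refine (Finset.sum_le_sum fun v _ => h3 v).trans (le_of_eq ?_)
  rw [Finset.sum_add_distrib, Finset.sum_const, Finset.card_filter]
  push_cast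
  simp [mul_comm]

end graph
end ZFC

namespace ZFC
open Finset
set_option linter.unusedSectionVars false
set_option linter.unusedVariables false

section sw
variable {V : Type*}

def Ed (a b x y : V) : Prop := (x = a ∧ y = b) ∨ (x = b ∧ y = a)

lemma Ed_comm (a b x y : V) : Ed a b x y ↔ Ed a b y x :=
  ⟨fun h => h.elim (fun h => Or.inr ⟨h.2, h.1⟩) (fun h => Or.inl ⟨h.2, h.1⟩),
    fun h => h.elim (fun h => Or.inr ⟨h.2, h.1⟩) (fun h => Or.inl ⟨h.2, h.1⟩)⟩

/-- the switching -/
def sw (G : SimpleGraph V) (a b c d : V) : SimpleGraph V where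
  Adj x y := x ≠ y ∧ ((G.Adj x y ∧ ¬ Ed a b x y ∧ ¬ Ed c d x y) ∨ Ed a c x y ∨ Ed b d x y)
  symm := ⟨fun x y h => by
    rw [G.adj_comm y x, Ed_comm a b y x, Ed_comm c d y x, Ed_comm a c y x, Ed_comm b d y x]
    exact ⟨h.1.symm, h.2⟩⟩
  loopless := ⟨fun x h => h.1 rfl⟩

lemma sw_adj (G : SimpleGraph V) (a b c d x y : V) : (sw G a b c d).Adj x y ↔
    (x ≠ y ∧ ((G.Adj x y ∧ ¬ Ed a b x y ∧ ¬ Ed c d x y) ∨ Ed a c x y ∨ Ed b d x y)) := Iff.rfl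

/-- the switching conditions -/
structure SwOK (G : SimpleGraph V) (a b c d : V) : Prop where
  ab : G.Adj a b
  cd : G.Adj c d
  ac : a ≠ c
  ad : a ≠ d
  bc : b ≠ c
  bd : b ≠ d
  nac : ¬ G.Adj a c
  nbd : ¬ G.Adj b d

lemma swOK_of (G : SimpleGraph V) {a b c d : V} (ab : G.Adj a b) (cd : G.Adj c d) {k : ℕ} (hk : 3 ≤ k)
    (h : ¬ NB G k a c) : SwOK G a b c d := by
  have h3 : ¬ NB G 3 a c := fun h' => h (NB_mono G hk _ _ h')
  have h2 : ¬ NB G 2 a c := fun h' => h3 (NB_succ G _ _ _ h')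
  have h1 : ¬ NB G 1 a c := fun h' => h2 (NB_succ G _ _ _ h')
  refine ⟨ab, cd, ?_, ?_, ?_, ?_, ?_, ?_⟩
  · rintro rfl; exact h1 (NB_refl G _ _)
  · rintro rfl; exact h1 (NB_adj G cd.symm)
  · rintro rfl; exact h1 (NB_adj G ab)
  · rintro rfl; exact h2 (NB_trans G (NB_adj G ab) (NB_adj G cd.symm))
  · intro hh; exact h1 (NB_adj G hh)
  · intro hh; exact h3 (NB_trans G (NB_adj G ab) (NB_trans G (NB_adj G hh) (NB_adj G cd.symm)))

lemma sw_inv (G : SimpleGraph V) {a b c d : V} (h : SwOK G a b c d) :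
    sw (sw G a b c d) a c b d = G := by
  obtain ⟨ab, cd, ac, ad, bc, bd, nac, nbd⟩ := h
  ext x y
  have hne : G.Adj x y → x ≠ y := fun hh => hh.ne
  have hp : Ed a b x y → G.Adj x y := by
    rintro (⟨rfl, rfl⟩ | ⟨rfl, rfl⟩)
    · exact ab
    · exact ab.symm
  have hq : Ed c d x y → G.Adj x y := by
    rintro (⟨rfl, rfl⟩ | ⟨rfl, rfl⟩)
    · exact cd
    · exact cd.symm
  have hr : Ed a c x y → ¬ G.Adj x y := by
    rintro (⟨rfl, rfl⟩ | ⟨rfl, rfl⟩)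
    · exact nac
    · exact fun hh => nac hh.symm
  have hs : Ed b d x y → ¬ G.Adj x y := by
    rintro (⟨rfl, rfl⟩ | ⟨rfl, rfl⟩)
    · exact nbd
    · exact fun hh => nbd hh.symm
  simp only [sw_adj]
  generalize Ed a b x y = p at *
  generalize Ed c d x y = q at *
  generalize Ed a c x y = r at *
  generalize Ed b d x y = s at *
  generalize G.Adj x y = A at *
  by_cases hA : A
  · have := hne hA
    have h1 : ¬ r := fun h => hr h hA
    have h2 : ¬ s := fun h => hs h hA
    simp only [hA, this, h1, h2]
    tauto
  · have h1 : ¬ p := fun h => hA (hp h)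
    have h2 : ¬ q := fun h => hA (hq h)
    simp only [hA, h1, h2]
    tauto

lemma cub_replace (G G' : SimpleGraph V) {a b c : V}
    (h : ∃ x y z, x ≠ y ∧ x ≠ z ∧ y ≠ z ∧ ∀ c, G.Adj a c ↔ (c = x ∨ c = y ∨ c = z))
    (hab : G.Adj a b) (hac : ¬ G.Adj a c) (hG : ∀ y, G'.Adj a y ↔ (G.Adj a y ∧ y ≠ b) ∨ y = c) :
    ∃ x y z, x ≠ y ∧ x ≠ z ∧ y ≠ z ∧ ∀ c, G'.Adj a c ↔ (c = x ∨ c = y ∨ c = z) := by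
  obtain ⟨x, y, z, h1, h2, h3, h4⟩ := h
  have hcx : c ≠ x := fun e => hac ((h4 c).2 (Or.inl e))
  have hcy : c ≠ y := fun e => hac ((h4 c).2 (Or.inr (Or.inl e)))
  have hcz : c ≠ z := fun e => hac ((h4 c).2 (Or.inr (Or.inr e)))
  rcases (h4 b).1 hab with rfl | rfl | rfl
  · exact ⟨c, y, z, hcy, hcz, h3, fun w => by rw [hG, h4]; grind⟩
  · exact ⟨x, c, z, hcx.symm, h2, hcz, fun w => by rw [hG, h4]; grind⟩
  · exact ⟨x, y, c, h1, hcx.symm, hcy.symm, fun w => by rw [hG, h4]; grind⟩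

lemma sw_cub (G : SimpleGraph V) {a b c d : V} (h : SwOK G a b c d) (hG : Cub G) :
    Cub (sw G a b c d) := by
  obtain ⟨ab, cd, ac, ad, bc, bd, nac, nbd⟩ := h
  have a_b := ab.ne
  have c_d := cd.ne
  intro v
  have hne : ∀ y, G.Adj v y → v ≠ y := fun y hh => hh.ne
  by_cases h1 : v = a
  · subst h1
    exact cub_replace G _ (hG v) ab nac fun y => by
      rw [sw_adj]; unfold Ed; have := hne y; grind
  by_cases h2 : v = b
  · subst h2
    exact cub_replace G _ (hG v) ab.symm nbd fun y => by
      rw [sw_adj]; unfold Ed; have := hne y; grind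
  by_cases h3 : v = c
  · subst h3
    exact cub_replace G _ (hG v) cd (fun hh => nac hh.symm) fun y => by
      rw [sw_adj]; unfold Ed; have := hne y; grind
  by_cases h4 : v = d
  · subst h4
    exact cub_replace G _ (hG v) cd.symm (fun hh => nbd hh.symm) fun y => by
      rw [sw_adj]; unfold Ed; have := hne y; grind
  obtain ⟨x, y, z, k1, k2, k3, k4⟩ := hG v
  refine ⟨x, y, z, k1, k2, k3, fun w => ?_⟩
  rw [← k4, sw_adj]; unfold Ed; have := hne w; grind

lemma sw_NB (G : SimpleGraph V) {a b c d : V} {m : ℕ} {z w : V} (h : NB (iso G a) m z w)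
    (hc : ¬ NB G m z c) : NB (sw G a b c d) m z w := by
  induction m generalizing z with
  | zero => exact h
  | succ m ih =>
    rcases h with h | ⟨z', ⟨h1, h2, h3⟩, h⟩
    · exact Or.inl h
    · have hc' : ¬ NB G m z' c := fun hh => hc (Or.inr ⟨z', h1, hh⟩)
      refine Or.inr ⟨z', ?_, ih h hc'⟩
      have e1 : z ≠ c := by rintro rfl; exact hc (NB_refl G _ _)
      have e2 : z' ≠ c := by rintro rfl; exact hc' (NB_refl G _ _)
      refine ⟨h1.ne, Or.inl ⟨h1, ?_, ?_⟩⟩ <;> unfold Ed <;> tauto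

lemma sw_SP (G : SimpleGraph V) {a b c d : V} {k : ℕ} (h : SP G k a b) (cd : G.Adj c d)
    (hc : ¬ NB G (k + 5) a c) : NB (sw G a b c d) (k + 1) a b := by
  obtain ⟨ab, z, hz, haz, hN⟩ := h
  have ok := swOK_of G ab cd (by omega) hc
  have h1 : ¬ NB G k z c := fun hh => hc (NB_mono G (k := k + 1) (by omega) _ _ (Or.inr ⟨z, haz, hh⟩))
  refine Or.inr ⟨z, ?_, sw_NB G hN h1⟩
  have e1 := ok.ac
  have e2 := ok.ad
  have e3 := ab.ne
  refine ⟨haz.ne, Or.inl ⟨haz, ?_, ?_⟩⟩ <;> unfold Ed <;> tauto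

end sw

section count
open Classical
variable {V : Type*} [Fintype V]

lemma ball_card (G : SimpleGraph V) (hG : Cub G) (k : ℕ) (x : V) :
    (univ.filter (NB G k x)).card ≤ 4 ^ k := by
  induction k generalizing x with
  | zero =>
    have : univ.filter (NB G 0 x) = {x} := by ext y; rw [mem_filter, mem_singleton]; exact ⟨fun h => Eq.symm h.2, fun h => ⟨mem_univ _, Eq.symm h⟩⟩
    rw [this]; simp
  | succ k ih =>
    obtain ⟨p, q, r, -, -, -, h⟩ := hG x
    have : univ.filter (NB G (k+1) x) ⊆ {x} ∪ (univ.filter (NB G k p) ∪ (univ.filter (NB G k q) ∪ univ.filter (NB G k r))) := by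
      intro y hy
      have hy' := (mem_filter.1 hy).2
      simp only [mem_filter, mem_univ, true_and, mem_union, mem_singleton]
      rcases hy' with rfl | ⟨z, hz, hy⟩
      · exact Or.inl rfl
      · rcases (h z).1 hz with rfl | rfl | rfl <;> tauto
    have h1 := card_le_card this
    have h2 := card_union_le {x} (univ.filter (NB G k p) ∪ (univ.filter (NB G k q) ∪ univ.filter (NB G k r)))
    have h3 := card_union_le (univ.filter (NB G k p)) (univ.filter (NB G k q) ∪ univ.filter (NB G k r))
    have h4 := card_union_le (univ.filter (NB G k q)) (univ.filter (NB G k r))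
    have h5 := ih p
    have h6 := ih q
    have h7 := ih r
    have h8 : 1 ≤ 4 ^ k := Nat.one_le_pow _ _ (by norm_num)
    rw [card_singleton] at h2
    rw [pow_succ]
    omega

/-- the pairs on short cycles -/
noncomputable def XX (G : SimpleGraph V) (k : ℕ) : Finset (V × V) := univ.filter fun p => SP G k p.1 p.2

lemma bad_card (G : SimpleGraph V) (hG : Cub G) :
    (univ.filter (BadV G)).card ≤ (XX G KK).card * 4 ^ (DD + 1) := by
  have : univ.filter (BadV G) ⊆ (XX G KK).biUnion fun p => univ.filter (NB G (DD + 1) p.1) := by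
    intro v hv
    obtain ⟨y, z, h1, h2⟩ := (mem_filter.1 hv).2
    exact mem_biUnion.2 ⟨(y, z), mem_filter.2 ⟨mem_univ _, h2⟩, mem_filter.2 ⟨mem_univ _, NB_symm G h1⟩⟩
  exact (card_le_card this).trans (card_biUnion_le_card_mul _ _ _ fun p _ => ball_card G hG _ _)

variable (V) in
noncomputable def CubS : Finset (SimpleGraph V) := univ.filter Cub

lemma nbr (G : SimpleGraph V) (hG : Cub G) (c : V) : ∃ d, G.Adj c d := by
  obtain ⟨p, q, r, -, -, -, h⟩ := hG c
  exact ⟨p, (h p).2 (Or.inl rfl)⟩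

lemma switch_count (k : ℕ) :
    (∑ G ∈ CubS V, (XX G k).card) * (Fintype.card V - 4 ^ (k + 5)) ≤
      (CubS V).card * Fintype.card V * ((4 ^ (k + 2)) ^ 3) := by
  have hd : ∀ (G : SimpleGraph V) (c : V), ∃ d, Cub G → G.Adj c d := by
    intro G c
    by_cases hG : Cub G
    · obtain ⟨d, hd⟩ := nbr G hG c
      exact ⟨d, fun _ => hd⟩
    · exact ⟨c, fun h => absurd h hG⟩
  choose dd hdd using hd
  let P : Finset (SimpleGraph V × V × V) := univ.filter fun t => Cub t.1 ∧ SP t.1 k t.2.1 t.2.2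
  let A : Finset ((SimpleGraph V × V × V) × V) :=
    univ.filter fun t => t.1 ∈ P ∧ ¬ NB t.1.1 (k + 5) t.1.2.1 t.2
  let B : Finset ((SimpleGraph V × V) × (V × V × V)) :=
    univ.filter fun t => Cub t.1.1 ∧ NB t.1.1 (k + 2) t.1.2 t.2.1 ∧ NB t.1.1 (k + 2) t.1.2 t.2.2.1 ∧
      NB t.1.1 (k + 2) t.1.2 t.2.2.2
  have hP : ∑ G ∈ CubS V, (XX G k).card = P.card := by
    rw [card_eq_sum_card_fiberwise (f := Prod.fst) (s := P) (t := CubS V)]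
    · refine sum_congr rfl fun G hG => ?_
      rw [← card_map ⟨fun p : V × V => (G, p), fun p q h => (Prod.mk.inj h).2⟩]
      congr 1
      ext ⟨H, a, b⟩
      simp only [CubS, mem_filter, mem_univ, true_and] at hG
      simp only [XX, P, mem_map, mem_filter, mem_univ, true_and, Prod.exists]
      constructor
      · rintro ⟨x, y, h, e⟩
        have e1 : G = H := (Prod.mk.inj e).1
        have e2 := (Prod.mk.inj e).2
        obtain ⟨e3, e4⟩ := Prod.mk.inj e2
        subst e1 e3 e4
        exact ⟨⟨hG, h⟩, rfl⟩
      · rintro ⟨⟨h1, h2⟩, rfl⟩; exact ⟨a, b, h2, rfl⟩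
    · intro t ht
      have := (mem_filter.1 ht).2.1
      simpa [CubS] using this
  have hA : P.card * (Fintype.card V - 4 ^ (k + 5)) ≤ A.card := by
    rw [card_eq_sum_card_fiberwise (f := Prod.fst) (s := A) (t := P)]
    · rw [← smul_eq_mul]
      refine card_nsmul_le_sum _ _ _ fun t ht => ?_
      have hc := (mem_filter.1 ht).2.1
      have h1 := ball_card t.1 hc (k + 5) t.2.1
      have h2 := card_filter_add_card_filter_not (s := (univ : Finset V)) (NB t.1 (k + 5) t.2.1)
      have h3 : (univ.filter fun c => ¬ NB t.1 (k + 5) t.2.1 c).card ≤ (A.filter fun s => s.1 = t).card := by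
        refine card_le_card_of_injOn (fun c => (t, c)) ?_ ?_
        · intro c hc
          have := (mem_filter.1 hc).2
          exact mem_filter.2 ⟨mem_filter.2 ⟨mem_univ _, ht, this⟩, rfl⟩
        · intro c _ c' _ h
          exact (Prod.mk.inj h).2
      rw [card_univ] at h2
      omega
    · intro t ht
      exact (mem_filter.1 ht).2.1
  have hAB : A.card ≤ B.card := by
    refine card_le_card_of_injOn
      (fun t => ((sw t.1.1 t.1.2.1 t.1.2.2 t.2 (dd t.1.1 t.2), t.1.2.1), (t.1.2.2, t.2, dd t.1.1 t.2))) ?_ ?_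
    · rintro ⟨⟨G, a, b⟩, c⟩ ht
      obtain ⟨h1, h2⟩ := (mem_filter.1 ht).2
      obtain ⟨hG, hS⟩ := (mem_filter.1 h1).2
      dsimp only at hG hS h2
      have hcd := hdd G c hG
      have ok := swOK_of G hS.1 hcd (by omega) h2
      have e0 := sw_SP G hS hcd h2
      refine mem_filter.2 ⟨mem_univ _, sw_cub G ok hG, NB_succ _ _ _ _ e0, ?_, ?_⟩
      · refine NB_mono _ (by omega) _ _ (NB_adj _ (?_ : (sw G a b c (dd G c)).Adj a c))
        exact ⟨ok.ac, Or.inr (Or.inl (Or.inl ⟨rfl, rfl⟩))⟩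
      · refine NB_trans _ (l := 1) e0 (NB_adj _ (?_ : (sw G a b c (dd G c)).Adj b (dd G c)))
        exact ⟨ok.bd, Or.inr (Or.inr (Or.inl ⟨rfl, rfl⟩))⟩
    · rintro ⟨⟨G, a, b⟩, c⟩ ht ⟨⟨G', a', b'⟩, c'⟩ ht' he
      obtain ⟨h1, h2⟩ := (mem_filter.1 ht).2
      obtain ⟨hG, hS⟩ := (mem_filter.1 h1).2
      obtain ⟨h1', h2'⟩ := (mem_filter.1 ht').2
      obtain ⟨hG', hS'⟩ := (mem_filter.1 h1').2
      dsimp only at hG hS h2 hG' hS' h2'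
      have ok := swOK_of G hS.1 (hdd G c hG) (by omega) h2
      have ok' := swOK_of G' hS'.1 (hdd G' c' hG') (by omega) h2'
      simp only [Prod.mk.injEq] at he
      obtain ⟨⟨e1, e2⟩, e3, e4, e5⟩ := he
      subst e2 e3 e4
      have i1 := sw_inv G ok
      have i2 := sw_inv G' ok'
      rw [← e1, ← e5] at i2
      rw [i1] at i2
      rw [i2]
  have hB : B.card ≤ ((4 ^ (k + 2)) ^ 3) * ((CubS V) ×ˢ (univ : Finset V)).card := by
    refine card_le_mul_card_image_of_maps_to (f := Prod.fst) ?_ _ ?_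
    · intro t ht
      have := (mem_filter.1 ht).2.1
      simpa [CubS] using this
    · rintro ⟨G, a⟩ ht
      have hG : Cub G := by simpa [CubS] using ht
      let U := univ.filter (NB G (k + 2) a)
      have hU : U.card ≤ 4 ^ (k + 2) := ball_card G hG _ _
      calc (B.filter fun s => s.1 = (G, a)).card ≤ (U ×ˢ (U ×ˢ U)).card := by
            refine card_le_card_of_injOn Prod.snd ?_ ?_
            · rintro ⟨⟨G', a'⟩, b, c, d⟩ h
              obtain ⟨h1, h2⟩ := mem_filter.1 h
              obtain ⟨rfl, rfl⟩ := Prod.mk.inj h2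
              obtain ⟨-, -, h3, h4, h5⟩ := mem_filter.1 h1
              simp only [coe_product, Set.mem_prod, mem_coe]
              exact ⟨mem_filter.2 ⟨mem_univ _, h3⟩, mem_filter.2 ⟨mem_univ _, h4⟩, mem_filter.2 ⟨mem_univ _, h5⟩⟩
            · rintro ⟨p, q⟩ h ⟨p', q'⟩ h' e
              have e1 := (mem_filter.1 h).2
              have e2 := (mem_filter.1 h').2
              dsimp only at e1 e2 e
              rw [e1, e2, e]
        _ = U.card ^ 3 := by rw [card_product, card_product]; ring
        _ ≤ _ := Nat.pow_le_pow_left hU 3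
  rw [hP]
  calc _ ≤ _ := hA
    _ ≤ _ := hAB
    _ ≤ _ := hB
    _ = _ := by rw [card_product, card_univ]; ring

end count
end ZFC

namespace ZFC
open Finset
set_option linter.unusedSectionVars false
set_option linter.unusedVariables false

lemma natCast_ne (n k : ℕ) (h0 : 0 < k) (h : k < n) : (k : ZMod n) ≠ 0 := by
  intro e
  rw [ZMod.natCast_eq_zero_iff] at e
  exact absurd (Nat.le_of_dvd h0 e) (by omega)

lemma exists_cub_zmod (m : ℕ) (hm : 2 ≤ m) : ∃ G : SimpleGraph (ZMod (2 * m)), Cub G := by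
  have hmm : (m : ZMod (2 * m)) + m = 0 := by
    have := ZMod.natCast_self (2 * m)
    push_cast at this
    linear_combination this
  have h1 : (1 : ZMod (2 * m)) ≠ 0 := by simpa using natCast_ne (2 * m) 1 (by omega) (by omega)
  have h2 : (2 : ZMod (2 * m)) ≠ 0 := by simpa using natCast_ne (2 * m) 2 (by omega) (by omega)
  have h3 : (m : ZMod (2 * m)) ≠ 0 := natCast_ne (2 * m) m (by omega) (by omega)
  have h4 : (m : ZMod (2 * m)) + 1 ≠ 0 := by
    simpa using natCast_ne (2 * m) (m + 1) (by omega) (by omega)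
  have h5 : (m : ZMod (2 * m)) - 1 ≠ 0 := by
    have := natCast_ne (2 * m) (m - 1) (by omega) (by omega)
    rwa [Nat.cast_sub (by omega), Nat.cast_one] at this
  generalize (m : ZMod (2 * m)) = t at *
  refine ⟨⟨fun x y => y = x + 1 ∨ y = x - 1 ∨ y = x + t, ⟨?_⟩, ⟨?_⟩⟩, ?_⟩
  · rintro x y (rfl | rfl | rfl)
    · right; left; ring
    · left; ring
    · right; right; linear_combination -hmm
  · rintro x (h | h | h)
    · exact h1 (by linear_combination -h)
    · exact h1 (by linear_combination h)
    · exact h3 (by linear_combination -h)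
  · intro v
    refine ⟨v + 1, v - 1, v + t, ?_, ?_, ?_, fun c => Iff.rfl⟩
    · intro h; exact h2 (by linear_combination h)
    · intro h; exact h5 (by linear_combination -h)
    · intro h; exact h4 (by linear_combination -h)

lemma exists_cub (n : ℕ) (hn : 4 ≤ n) (he : Even n) : ∃ G : SimpleGraph (Fin n), Cub G := by
  obtain ⟨m, rfl⟩ := he
  obtain ⟨k, rfl⟩ : ∃ k, m = k + 1 := ⟨m - 1, by omega⟩
  have := exists_cub_zmod (k + 1) (by omega)
  rw [two_mul] at this
  exact this

lemma cub_iff {V : Type*} (G : SimpleGraph V) [G.LocallyFinite] :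
    G.IsRegularOfDegree 3 ↔ Cub G := by
  classical
  unfold SimpleGraph.IsRegularOfDegree Cub
  refine forall_congr' fun v => ?_
  rw [← SimpleGraph.card_neighborFinset_eq_degree, Finset.card_eq_three]
  refine exists_congr fun x => exists_congr fun y => exists_congr fun z => ?_
  rw [Finset.ext_iff]
  simp

section fin
open Classical

lemma mem_CubS {V : Type*} [Fintype V] (G : SimpleGraph V) : G ∈ CubS V ↔ Cub G := by
  unfold CubS
  rw [mem_filter]
  exact ⟨fun h => h.2, fun h => ⟨mem_univ _, h⟩⟩

lemma card_CubS {V : Type*} [Fintype V] (p : SimpleGraph V → Prop) :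
    Nat.card {G : SimpleGraph V // Cub G ∧ p G} = ((CubS V).filter p).card := by
  rw [Nat.card_eq_fintype_card, Fintype.card_subtype, CubS, filter_filter]

lemma card_CubS_all {V : Type*} [Fintype V] :
    Nat.card {G : SimpleGraph V // Cub G} = (CubS V).card := by
  rw [Nat.card_eq_fintype_card, Fintype.card_subtype]; rfl

noncomputable def Bd (n : ℕ) : Finset (SimpleGraph (Fin n)) :=
  (CubS (Fin n)).filter fun G => ¬ ((zeroForcingNumber G : ℝ) ≤ 0.17057 * n)

lemma bd_bound : ∃ (K : ℝ) (M : ℕ), ∀ n, M ≤ n → 0 < n →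
    ((Bd n).card : ℝ) * n ≤ K * (CubS (Fin n)).card := by
  obtain ⟨a, ha⟩ : ∃ a : ℕ, a = 4 ^ (DD + 1) := ⟨_, rfl⟩
  obtain ⟨b, hb⟩ : ∃ b : ℕ, b = 4 ^ (KK + 5) := ⟨_, rfl⟩
  obtain ⟨c, hc⟩ : ∃ c : ℕ, c = (4 ^ (KK + 2)) ^ 3 := ⟨_, rfl⟩
  refine ⟨a * (2 * c) / 0.00037, 2 * b, fun n hn hn0 => ?_⟩
  have h1 := switch_count (V := Fin n) KK
  rw [← hb, ← hc, Fintype.card_fin] at h1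
  have h2 : ∀ G ∈ Bd n, 0.00037 * (n : ℝ) ≤ ((XX G KK).card : ℝ) * a := by
    intro G hG
    obtain ⟨hG1, hG2⟩ := mem_filter.1 hG
    have hC : Cub G := (mem_CubS G).1 hG1
    have e1 := det_bound hC
    have e2 : ((univ.filter (BadV G)).card : ℝ) ≤ ((XX G KK).card : ℝ) * a := by
      have := bad_card G hC
      rw [← ha] at this
      exact_mod_cast this
    rw [Fintype.card_fin] at e1
    push Not at hG2
    linarith
  have h3 : ((Bd n).card : ℝ) * (0.00037 * n) ≤ (∑ G ∈ CubS (Fin n), (XX G KK).card : ℕ) * (a : ℝ) := by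
    rw [← nsmul_eq_mul]
    refine (card_nsmul_le_sum _ _ _ h2).trans ?_
    rw [← sum_mul]
    push_cast
    refine mul_le_mul_of_nonneg_right ?_ (Nat.cast_nonneg _)
    exact sum_le_sum_of_subset_of_nonneg (filter_subset _ _) fun _ _ _ => Nat.cast_nonneg _
  clear h2
  generalize (∑ G ∈ CubS (Fin n), (XX G KK).card : ℕ) = S at *
  clear ha hb hc
  have h4 : (S : ℝ) * ((n : ℝ) - b) ≤ (CubS (Fin n)).card * n * c := by
    have : ((n - b : ℕ) : ℝ) = (n : ℝ) - b := by rw [Nat.cast_sub (by omega)]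
    rw [← this]
    exact_mod_cast h1
  have hn' : (2 : ℝ) * b ≤ n := by exact_mod_cast hn
  have hn1 : (0 : ℝ) < n := by exact_mod_cast hn0
  have h5 : (S : ℝ) ≤ 2 * c * (CubS (Fin n)).card := by
    have : (S : ℝ) * (n / 2) ≤ S * ((n : ℝ) - b) :=
      mul_le_mul_of_nonneg_left (by linarith) (Nat.cast_nonneg _)
    refine le_of_mul_le_mul_right (a := (n : ℝ)) ?_ hn1
    nlinarith
  have h6 : (S : ℝ) * a ≤ 2 * c * (CubS (Fin n)).card * a := mul_le_mul_of_nonneg_right h5 (Nat.cast_nonneg _)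
  rw [div_mul_eq_mul_div, le_div_iff₀ (by norm_num)]
  linarith

lemma prop_eq (n : ℕ) (hn : 4 ≤ n) (he : Even n) :
    regularProportion 3 n (fun G => (zeroForcingNumber G : ℝ) ≤ 0.17057 * n) =
      1 - (Bd n).card / (CubS (Fin n)).card ∧ 0 < (CubS (Fin n)).card := by
  have h0 : 0 < (CubS (Fin n)).card := by
    obtain ⟨G, hG⟩ := exists_cub n hn he
    exact Finset.card_pos.2 ⟨G, (mem_CubS G).2 hG⟩
  refine ⟨?_, h0⟩
  unfold regularProportion
  simp only [cub_iff]
  have e1 : Nat.card {G : SimpleGraph (Fin n) // Cub G} = (CubS (Fin n)).card := card_CubS_all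
  have e2 : Nat.card {G : SimpleGraph (Fin n) // Cub G ∧ (zeroForcingNumber G : ℝ) ≤ 0.17057 * n} =
      ((CubS (Fin n)).filter fun G => (zeroForcingNumber G : ℝ) ≤ 0.17057 * n).card := card_CubS _
  have e3 := card_filter_add_card_filter_not (s := CubS (Fin n))
    (fun G => (zeroForcingNumber G : ℝ) ≤ 0.17057 * n)
  rw [e1, e2]
  have e4 : (((CubS (Fin n)).filter fun G => (zeroForcingNumber G : ℝ) ≤ 0.17057 * n).card : ℝ) +
    (Bd n).card = (CubS (Fin n)).card := by exact_mod_cast e3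
  have h0' : ((CubS (Fin n)).card : ℝ) ≠ 0 := Nat.cast_ne_zero.2 h0.ne'
  field_simp
  linarith

end fin

lemma final : Filter.Tendsto
      (fun n : ℕ => regularProportion 3 n fun G =>
        (zeroForcingNumber G : ℝ) ≤ 0.17057 * n)
      (Filter.atTop ⊓ Filter.principal {n : ℕ | Even n}) (nhds 1) := by
  obtain ⟨K, M, h⟩ := bd_bound
  have hK : Filter.Tendsto (fun n : ℕ => 1 - K / (n : ℝ))
      (Filter.atTop ⊓ Filter.principal {n : ℕ | Even n}) (nhds 1) := by
    have := (tendsto_const_div_atTop_nhds_zero_nat K).const_sub 1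
    rw [sub_zero] at this
    exact this.mono_left inf_le_left
  have hev : ∀ᶠ n : ℕ in Filter.atTop ⊓ Filter.principal {n : ℕ | Even n}, Even n ∧ 4 ≤ n ∧ M ≤ n := by
    rw [Filter.eventually_inf_principal]
    filter_upwards [Filter.eventually_ge_atTop 4, Filter.eventually_ge_atTop M] with n h1 h2 h3
    exact ⟨h3, h1, h2⟩
  refine tendsto_of_tendsto_of_tendsto_of_le_of_le' hK tendsto_const_nhds ?_ ?_
  · filter_upwards [hev] with n hn
    obtain ⟨e1, e2⟩ := prop_eq n hn.2.1 hn.1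
    rw [e1]
    have h1 := h n hn.2.2 (by omega)
    have h2 : (0 : ℝ) < n := by exact_mod_cast (by omega : 0 < n)
    have h3 : (0 : ℝ) < (CubS (Fin n)).card := by exact_mod_cast e2
    have : ((Bd n).card : ℝ) / (CubS (Fin n)).card ≤ K / n := by
      rw [div_le_div_iff₀ h3 h2]; exact h1
    linarith
  · filter_upwards [hev] with n hn
    obtain ⟨e1, e2⟩ := prop_eq n hn.2.1 hn.1
    rw [e1]
    have : (0 : ℝ) ≤ ((Bd n).card : ℝ) / (CubS (Fin n)).card := by positivity
    linarith

end ZFC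

/-- A.a.s. (as `n → ∞` along even `n`) a uniformly random simple 3-regular graph `G`
on `n` labelled vertices satisfies `Z(G) ≤ 0.17057 n`. -/
theorem aas_zeroForcing_cubic_upper :
    Filter.Tendsto
      (fun n : ℕ => regularProportion 3 n fun G =>
        (zeroForcingNumber G : ℝ) ≤ 0.17057 * n)
      (Filter.atTop ⊓ Filter.principal {n : ℕ | Even n}) (nhds 1) := by
  exact ZFC.final
end
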